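/- Assume f : ℝ → ℝ is odd and entire (given by a power series converging on all of ℝ) with f(0) = 0, f'(0) = 0 and f'''(0) > 0. Then there exist ε₀ > 0, c > 0 and C > 0 such that for every ε ∈ (0, ε₀) the nonlinear Klein–Gordon equation u_tt = u_xx − u + f(u), x ∈ ℝ, has a classical (C²) solution u : ℝ_x × ℝ_t → ℝ which is periodic in t with period T_ε = 2π/√(1−ε²), odd in t (u(x,−t) = −u(x,t) for all x, t), satisfies sup_{x,t} |u(x,t)| ≤ Cε, is nontrivial of amplitude of order ε (sup_x (∫_0^{T_ε} (u(x,t)² + (∂_t u(x,t))²) dt)^{1/2} ≥ ε/C), and has exponentially small tails: limsup_{|x|→∞} (∫_0^{T_ε} (u(x,t)² + (∂_t u(x,t))²) dt)^{1/2} ≤ C e^{−c/ε}. -/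

import Mathlib

noncomputable section

open Real Filter Set

/-- Partial derivative in `t` of a function `u = u(x,t)`. -/
def dt (u : ℝ → ℝ → ℝ) (x t : ℝ) : ℝ := deriv (u x) t

/-- Second partial derivative in `t`. -/
def dtt (u : ℝ → ℝ → ℝ) (x t : ℝ) : ℝ := deriv (deriv (u x)) t

/-- Second partial derivative in `x`. -/
def dxx (u : ℝ → ℝ → ℝ) (x t : ℝ) : ℝ :=
  deriv (fun y => deriv (fun z => u z t) y) x

/-- The `H¹` norm in `t` of the time-periodic profile `u(x,·)` over one period `[0,T]`:
`(∫_0^T u(x,t)² + (∂_t u(x,t))² dt)^{1/2}`. -/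
def profileNorm (u : ℝ → ℝ → ℝ) (T x : ℝ) : ℝ :=
  Real.sqrt (∫ t in (0 : ℝ)..T, (u x t) ^ 2 + (dt u x t) ^ 2)

open Topology in
/-- Differentiation under an interval integral, for jointly continuous data. -/
theorem hasDerivAt_intervalIntegral_param {k k' : ℝ → ℝ → ℝ} {a b : ℝ}
    (hk : ∀ x, Continuous (k x)) (hk' : Continuous (Function.uncurry k'))
    (hd : ∀ x t, HasDerivAt (fun y => k y t) (k' x t) x) (x : ℝ) :
    HasDerivAt (fun y => ∫ t in a..b, k y t) (∫ t in a..b, k' x t) x := by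
  have hcomp : IsCompact (Icc (x - 1) (x + 1) ×ˢ uIcc a b) := isCompact_Icc.prod isCompact_uIcc
  obtain ⟨C, hC⟩ := hcomp.exists_bound_of_continuousOn hk'.continuousOn
  have hs : Icc (x - 1) (x + 1) ∈ 𝓝 x := Icc_mem_nhds (by linarith) (by linarith)
  refine (intervalIntegral.hasDerivAt_integral_of_dominated_loc_of_deriv_le
    (F := k) (F' := k') (s := Icc (x - 1) (x + 1)) (bound := fun _ => C) hs
    (Eventually.of_forall fun y => (hk y).aestronglyMeasurable)
    ((hk x).intervalIntegrable _ _)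
    ((hk'.comp (Continuous.prodMk_right x)).aestronglyMeasurable) ?_
    intervalIntegrable_const ?_).2
  · refine Eventually.of_forall fun t ht y hy => hC (y, t) ⟨hy, uIoc_subset_uIcc ht⟩
  · exact Eventually.of_forall fun t _ y _ => hd y t

/-- The partial derivatives of a function of two variables up to order two, all continuous. -/
structure IsC2 (u ux ut uxx uxt utt : ℝ → ℝ → ℝ) : Prop where
  hx : ∀ x t, HasDerivAt (fun y => u y t) (ux x t) x
  ht : ∀ x t, HasDerivAt (u x) (ut x t) t
  hxx : ∀ x t, HasDerivAt (fun y => ux y t) (uxx x t) x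
  hxt : ∀ x t, HasDerivAt (ux x) (uxt x t) t
  htx : ∀ x t, HasDerivAt (fun y => ut y t) (uxt x t) x
  htt : ∀ x t, HasDerivAt (ut x) (utt x t) t
  cxx : Continuous (Function.uncurry uxx)
  cxt : Continuous (Function.uncurry uxt)
  ctt : Continuous (Function.uncurry utt)

/-- A function with continuous partial derivatives is differentiable. -/
theorem hasFDerivAt_uncurry_of_partial {u ux ut : ℝ → ℝ → ℝ}
    (hx : ∀ x t, HasDerivAt (fun y => u y t) (ux x t) x)
    (ht : ∀ x t, HasDerivAt (u x) (ut x t) t)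
    (cx : Continuous (Function.uncurry ux)) (ct : Continuous (Function.uncurry ut)) (p : ℝ × ℝ) :
    HasFDerivAt (Function.uncurry u)
      (ux p.1 p.2 • ContinuousLinearMap.fst ℝ ℝ ℝ + ut p.1 p.2 • ContinuousLinearMap.snd ℝ ℝ ℝ)
      p := by
  have := (hasStrictFDerivAt_uncurry_coprod (𝕜 := ℝ) (u := p) (f := u)
    (f₁ := fun x t => ContinuousLinearMap.toSpanSingleton ℝ (ux x t))
    (f₂ := fun x t => ContinuousLinearMap.toSpanSingleton ℝ (ut x t))
    (Eventually.of_forall fun v => (hx v.1 v.2).hasFDerivAt)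
    (Eventually.of_forall fun v => (ht v.1 v.2).hasFDerivAt)
    (ContinuousLinearMap.toSpanSingletonCLE.continuous.comp cx).continuousAt
    (ContinuousLinearMap.toSpanSingletonCLE.continuous.comp ct).continuousAt).hasFDerivAt
  refine (this : HasFDerivAt (Function.uncurry u) _ p).congr_fderiv ?_
  ext
  · simp [Function.HasUncurry.uncurry]
  · simp [Function.HasUncurry.uncurry]

theorem contDiff_one_uncurry_of_partial {u ux ut : ℝ → ℝ → ℝ}
    (hx : ∀ x t, HasDerivAt (fun y => u y t) (ux x t) x)
    (ht : ∀ x t, HasDerivAt (u x) (ut x t) t)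
    (cx : Continuous (Function.uncurry ux)) (ct : Continuous (Function.uncurry ut)) :
    ContDiff ℝ 1 (Function.uncurry u) := by
  rw [contDiff_one_iff_hasFDerivAt]
  refine ⟨_, ?_, hasFDerivAt_uncurry_of_partial hx ht cx ct⟩
  exact (cx.smul continuous_const).add (ct.smul continuous_const)

namespace IsC2

variable {u ux ut uxx uxt utt : ℝ → ℝ → ℝ}

theorem contDiff_x (h : IsC2 u ux ut uxx uxt utt) : ContDiff ℝ 1 (Function.uncurry ux) :=
  contDiff_one_uncurry_of_partial h.hxx h.hxt h.cxx h.cxt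

theorem contDiff_t (h : IsC2 u ux ut uxx uxt utt) : ContDiff ℝ 1 (Function.uncurry ut) :=
  contDiff_one_uncurry_of_partial h.htx h.htt h.cxt h.ctt

theorem contDiff (h : IsC2 u ux ut uxx uxt utt) : ContDiff ℝ 2 (Function.uncurry u) := by
  have h2 : (2 : WithTop ℕ∞) = ((1 : ℕ) : WithTop ℕ∞) + 1 := by norm_num
  rw [h2, contDiff_succ_iff_hasFDerivAt]
  refine ⟨_, ?_, hasFDerivAt_uncurry_of_partial h.hx h.ht
    h.contDiff_x.continuous h.contDiff_t.continuous⟩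
  exact (h.contDiff_x.smul contDiff_const).add (h.contDiff_t.smul contDiff_const)

theorem continuous (h : IsC2 u ux ut uxx uxt utt) : Continuous (Function.uncurry u) :=
  h.contDiff.continuous

theorem cx (h : IsC2 u ux ut uxx uxt utt) : Continuous (Function.uncurry ux) :=
  h.contDiff_x.continuous

theorem ct (h : IsC2 u ux ut uxx uxt utt) : Continuous (Function.uncurry ut) :=
  h.contDiff_t.continuous

theorem sub {v vx vt vxx vxt vtt : ℝ → ℝ → ℝ} (h : IsC2 u ux ut uxx uxt utt)
    (g : IsC2 v vx vt vxx vxt vtt) :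
    IsC2 (fun x t => u x t - v x t) (fun x t => ux x t - vx x t) (fun x t => ut x t - vt x t)
      (fun x t => uxx x t - vxx x t) (fun x t => uxt x t - vxt x t)
      (fun x t => utt x t - vtt x t) where
  hx x t := (h.hx x t).sub (g.hx x t)
  ht x t := (h.ht x t).sub (g.ht x t)
  hxx x t := (h.hxx x t).sub (g.hxx x t)
  hxt x t := (h.hxt x t).sub (g.hxt x t)
  htx x t := (h.htx x t).sub (g.htx x t)
  htt x t := (h.htt x t).sub (g.htt x t)
  cxx := h.cxx.sub g.cxx
  cxt := h.cxt.sub g.cxt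
  ctt := h.ctt.sub g.ctt

end IsC2

/-- The integral of `G` along the characteristic of slope `-c` through `(x, t)`. -/
def charInt (c : ℝ) (G : ℝ → ℝ → ℝ) (x t : ℝ) : ℝ := ∫ y in (0 : ℝ)..x, G y (t + c * (x - y))

theorem continuous_charInt {c : ℝ} {G : ℝ → ℝ → ℝ} (hG : Continuous (Function.uncurry G)) :
    Continuous (Function.uncurry (charInt c G)) := by
  refine intervalIntegral.continuous_parametric_intervalIntegral_of_continuous
    (f := fun (p : ℝ × ℝ) y => G y (p.2 + c * (p.1 - y))) ?_ continuous_fst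
  exact hG.comp (by fun_prop : Continuous fun z : (ℝ × ℝ) × ℝ =>
    (z.2, z.1.2 + c * (z.1.1 - z.2)))

theorem hasDerivAt_charInt_t {c : ℝ} {H H' : ℝ → ℝ → ℝ} (hH : Continuous (Function.uncurry H))
    (hH' : Continuous (Function.uncurry H')) (hd : ∀ x t, HasDerivAt (H x) (H' x t) t) (x t : ℝ) :
    HasDerivAt (charInt c H x) (charInt c H' x t) t := by
  refine hasDerivAt_intervalIntegral_param (k := fun s y => H y (s + c * (x - y)))
    (k' := fun s y => H' y (s + c * (x - y))) ?_ ?_ ?_ t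
  · intro s
    exact hH.comp (by fun_prop : Continuous fun y : ℝ => (y, s + c * (x - y)))
  · exact hH'.comp (by fun_prop : Continuous fun z : ℝ × ℝ => (z.2, z.1 + c * (x - z.2)))
  · intro s y
    exact (hd y (s + c * (x - y))).comp_add_const s (c * (x - y))

theorem hasDerivAt_charInt_x {c : ℝ} {H H' : ℝ → ℝ → ℝ} (hH : Continuous (Function.uncurry H))
    (hH' : Continuous (Function.uncurry H')) (hd : ∀ x t, HasDerivAt (H x) (H' x t) t) (x t : ℝ) :
    HasDerivAt (fun y => charInt c H y t) (H x t + c * charInt c H' x t) x := by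
  have hB : ∀ p : ℝ × ℝ, HasFDerivAt
      (Function.uncurry fun x ξ => ∫ y in (0 : ℝ)..x, H y (ξ - c * y)) _ p :=
    hasFDerivAt_uncurry_of_partial (ux := fun x ξ => H x (ξ - c * x))
      (ut := fun x ξ => ∫ y in (0 : ℝ)..x, H' y (ξ - c * y)) ?_ ?_ ?_ ?_
  · have h2 : HasDerivAt (fun y : ℝ => (y, t + c * y)) (1, c) x := by
      simpa using (hasDerivAt_id x).prodMk (((hasDerivAt_id x).const_mul c).const_add t)
    have h3 := (hB (x, t + c * x)).comp_hasDerivAt x h2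
    have e1 : ∀ y z : ℝ, t + c * (y - z) = t + c * y - c * z := fun y z => by ring
    have h4 : (fun y => charInt c H y t) =
        (Function.uncurry fun x ξ => ∫ y in (0 : ℝ)..x, H y (ξ - c * y)) ∘
          fun y => (y, t + c * y) := by
      ext y; simp [charInt, e1]
    rw [h4]
    refine h3.congr_deriv ?_
    simp [charInt, e1, mul_comm]
  · intro x ξ
    have hc : Continuous fun y => H y (ξ - c * y) :=
      hH.comp (by fun_prop : Continuous fun y : ℝ => (y, ξ - c * y))
    exact intervalIntegral.integral_hasDerivAt_right (hc.intervalIntegrable _ _)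
      (hc.stronglyMeasurableAtFilter _ _) hc.continuousAt
  · intro x ξ
    refine hasDerivAt_intervalIntegral_param (k := fun ξ y => H y (ξ - c * y))
      (k' := fun ξ y => H' y (ξ - c * y)) ?_ ?_ ?_ ξ
    · intro s
      exact hH.comp (by fun_prop : Continuous fun y : ℝ => (y, s - c * y))
    · exact hH'.comp (by fun_prop : Continuous fun z : ℝ × ℝ => (z.2, z.1 - c * z.2))
    · intro s y
      exact (hd y (s - c * y)).comp_sub_const s (c * y)
  · exact hH.comp (by fun_prop : Continuous fun z : ℝ × ℝ => (z.1, z.2 - c * z.1))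
  · refine intervalIntegral.continuous_parametric_intervalIntegral_of_continuous
      (f := fun (p : ℝ × ℝ) y => H' y (p.2 - c * y)) ?_ continuous_fst
    exact hH'.comp (by fun_prop : Continuous fun z : (ℝ × ℝ) × ℝ => (z.2, z.1.2 - c * z.2))

open scoped BoundedContinuousFunction

/-- The Duhamel integral of the wave equation: the integral of `G` over the characteristic
triangle with vertex `(x, t)`. -/
def duhamel (G : ℝ → ℝ → ℝ) (x t : ℝ) : ℝ :=
  ∫ y in (0 : ℝ)..x, ∫ s in (t - (x - y))..(t + (x - y)), G y s

theorem duhamel_comp_add (G : ℝ → ℝ → ℝ) (T x t : ℝ) :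
    duhamel (fun y s => G y (s + T)) x t = duhamel G x (t + T) := by
  unfold duhamel
  congr 1; ext y
  rw [intervalIntegral.integral_comp_add_right (fun s => G y s)]
  congr 1 <;> ring

theorem duhamel_comp_neg_right (G : ℝ → ℝ → ℝ) (x t : ℝ) :
    duhamel (fun y s => -G y (-s)) x t = -duhamel G x (-t) := by
  unfold duhamel
  rw [← intervalIntegral.integral_neg]
  congr 1; ext y
  rw [intervalIntegral.integral_neg, intervalIntegral.integral_comp_neg (fun s => G y s)]
  congr 2 <;> ring

theorem duhamel_comp_neg_left (G : ℝ → ℝ → ℝ) (x t : ℝ) :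
    duhamel (fun y s => G (-y) s) x t = duhamel G (-x) t := by
  unfold duhamel
  have h1 : ∀ y, (∫ s in (t - (x - y))..(t + (x - y)), G (-y) s) =
      (fun z => -∫ s in (t - (-x - z))..(t + (-x - z)), G z s) (-y) := by
    intro y
    simp only
    rw [← intervalIntegral.integral_symm]
    congr 1 <;> ring
  simp_rw [h1]
  rw [intervalIntegral.integral_comp_neg
    (fun z => -∫ s in (t - (-x - z))..(t + (-x - z)), G z s), intervalIntegral.integral_neg,
    neg_zero, intervalIntegral.integral_symm, neg_neg]

theorem continuous_primitive {G : ℝ → ℝ → ℝ} (hG : Continuous (Function.uncurry G)) :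
    Continuous (Function.uncurry fun y s => ∫ z in (0 : ℝ)..s, G y z) :=
  intervalIntegral.continuous_parametric_intervalIntegral_of_continuous
    (f := fun (p : ℝ × ℝ) z => G p.1 z)
    (hG.comp (by fun_prop : Continuous fun z : (ℝ × ℝ) × ℝ => (z.1.1, z.2))) continuous_snd

theorem duhamel_eq_charInt {G : ℝ → ℝ → ℝ} (hG : Continuous (Function.uncurry G)) (x t : ℝ) :
    duhamel G x t = charInt 1 (fun y s => ∫ z in (0 : ℝ)..s, G y z) x t -
      charInt (-1) (fun y s => ∫ z in (0 : ℝ)..s, G y z) x t := by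
  unfold duhamel charInt
  have hc := continuous_primitive hG
  rw [← intervalIntegral.integral_sub]
  · congr 1; ext y
    have hy : Continuous (G y) := hG.comp (Continuous.prodMk_right y)
    rw [intervalIntegral.integral_interval_sub_left (hy.intervalIntegrable _ _)
      (hy.intervalIntegrable _ _)]
    congr 1 <;> ring
  · exact (hc.comp (by fun_prop : Continuous fun y : ℝ =>
      (y, t + 1 * (x - y)))).intervalIntegrable _ _
  · exact (hc.comp (by fun_prop : Continuous fun y : ℝ =>
      (y, t + (-1) * (x - y)))).intervalIntegrable _ _

theorem abs_duhamel_le {G : ℝ → ℝ → ℝ} {M l : ℝ} (hM : 0 ≤ M) (hl : 0 < l)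
    (h : ∀ y s, |G y s| ≤ M * cosh (l * y)) (x t : ℝ) :
    |duhamel G x t| ≤ 2 * M / l ^ 2 * cosh (l * x) := by
  have h1 : ∀ y, ‖∫ s in (t - (x - y))..(t + (x - y)), G y s‖ ≤
      2 * M * (|x - y| * cosh (l * y)) := by
    intro y
    refine (intervalIntegral.norm_integral_le_of_norm_le_const
      (C := M * cosh (l * y)) fun s _ => h y s).trans ?_
    rw [show t + (x - y) - (t - (x - y)) = 2 * (x - y) by ring, abs_mul, abs_two]
    linarith
  have hcont : ∀ x, Continuous fun y => 2 * M * (|x - y| * cosh (l * y)) := by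
    intro x; fun_prop
  have h2 := intervalIntegral.norm_integral_le_abs_of_norm_le
    (μ := MeasureTheory.volume) (a := 0) (b := x) (Eventually.of_forall fun y => h1 y)
    ((hcont x).intervalIntegrable _ _)
  have hprim : ∫ y in (0 : ℝ)..x, (x - y) * cosh (l * y) = (cosh (l * x) - 1) / l ^ 2 := by
    have hd : ∀ y ∈ uIcc 0 x, HasDerivAt
        (fun y => (x - y) * (sinh (l * y) / l) + cosh (l * y) / l ^ 2)
        ((x - y) * cosh (l * y)) y := by
      intro y _
      have e1 : HasDerivAt (fun y => l * y) l y := by simpa using (hasDerivAt_id y).const_mul l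
      have e2 := (((hasDerivAt_id y).const_sub x).mul ((e1.sinh).div_const l)).add
        ((e1.cosh).div_const (l ^ 2))
      refine e2.congr_deriv ?_
      field_simp
      simp
      ring
    rw [intervalIntegral.integral_eq_sub_of_hasDerivAt hd
      ((by fun_prop : Continuous fun y => (x - y) * cosh (l * y)).intervalIntegrable _ _)]
    simp
    field_simp
  have h3 : |∫ y in (0 : ℝ)..x, |x - y| * cosh (l * y)| = (cosh (l * x) - 1) / l ^ 2 := by
    have hp : 0 ≤ (cosh (l * x) - 1) / l ^ 2 :=
      div_nonneg (by linarith [one_le_cosh (l * x)]) (by positivity)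
    rcases le_total 0 x with hx | hx
    · rw [intervalIntegral.integral_congr (g := fun y => (x - y) * cosh (l * y)), hprim,
        abs_of_nonneg hp]
      intro y hy
      rw [uIcc_of_le hx] at hy
      simp only [abs_of_nonneg (sub_nonneg.2 hy.2)]
    · rw [intervalIntegral.integral_congr (g := fun y => -((x - y) * cosh (l * y))),
        intervalIntegral.integral_neg, hprim, abs_neg, abs_of_nonneg hp]
      intro y hy
      rw [uIcc_of_ge hx] at hy
      simp only [abs_of_nonpos (sub_nonpos.2 hy.1)]
      ring
  calc |duhamel G x t| ≤ |∫ y in (0 : ℝ)..x, 2 * M * (|x - y| * cosh (l * y))| := h2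
    _ = 2 * M * ((cosh (l * x) - 1) / l ^ 2) := by
      rw [intervalIntegral.integral_const_mul, abs_mul, h3, abs_of_nonneg (by positivity)]
    _ ≤ 2 * M / l ^ 2 * cosh (l * x) := by
      rw [mul_div_assoc', div_mul_eq_mul_div]
      gcongr
      linarith

/-- Continuity of the Duhamel integral with respect to a parameter. -/
theorem continuous_duhamel_param {G : ℝ → ℝ → ℝ → ℝ}
    (hG : Continuous fun p : ℝ × ℝ × ℝ => G p.1 p.2.1 p.2.2) :
    Continuous fun p : ℝ × ℝ × ℝ => duhamel (G p.1) p.2.1 p.2.2 := by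
  unfold duhamel
  refine intervalIntegral.continuous_parametric_intervalIntegral_of_continuous
    (f := fun (p : ℝ × ℝ × ℝ) y =>
      ∫ s in (p.2.2 - (p.2.1 - y))..(p.2.2 + (p.2.1 - y)), G p.1 y s) ?_
    (continuous_fst.comp continuous_snd)
  have h0 : ∀ z : (ℝ × ℝ × ℝ) × ℝ,
      (∫ s in (z.1.2.2 - (z.1.2.1 - z.2))..(z.1.2.2 + (z.1.2.1 - z.2)), G z.1.1 z.2 s) =
      (∫ s in (0 : ℝ)..(z.1.2.2 + (z.1.2.1 - z.2)), G z.1.1 z.2 s) -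
      ∫ s in (0 : ℝ)..(z.1.2.2 - (z.1.2.1 - z.2)), G z.1.1 z.2 s := by
    intro z
    have hy : Continuous (G z.1.1 z.2) :=
      hG.comp (by fun_prop : Continuous fun s : ℝ => (z.1.1, z.2, s))
    rw [intervalIntegral.integral_interval_sub_left (hy.intervalIntegrable _ _)
      (hy.intervalIntegrable _ _)]
  unfold Function.uncurry
  simp_rw [h0]
  have hG2 : Continuous (Function.uncurry fun (z : (ℝ × ℝ × ℝ) × ℝ) s => G z.1.1 z.2 s) :=
    hG.comp (by fun_prop : Continuous fun w : ((ℝ × ℝ × ℝ) × ℝ) × ℝ => (w.1.1.1, w.1.2, w.2))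
  refine Continuous.sub ?_ ?_
  · exact intervalIntegral.continuous_parametric_intervalIntegral_of_continuous hG2 (by fun_prop)
  · exact intervalIntegral.continuous_parametric_intervalIntegral_of_continuous hG2 (by fun_prop)

theorem continuous_uncurry_of_param {G : ℝ → ℝ → ℝ → ℝ}
    (hG : Continuous fun p : ℝ × ℝ × ℝ => G p.1 p.2.1 p.2.2) (a : ℝ) :
    Continuous (Function.uncurry (G a)) :=
  hG.comp (by fun_prop : Continuous fun p : ℝ × ℝ => (a, p.1, p.2))

theorem duhamel_sub {G K : ℝ → ℝ → ℝ} (hG : Continuous (Function.uncurry G))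
    (hK : Continuous (Function.uncurry K)) (x t : ℝ) :
    duhamel (fun y s => G y s - K y s) x t = duhamel G x t - duhamel K x t := by
  have h1 : ∀ y s, (∫ z in (0 : ℝ)..s, (G y z - K y z)) =
      (∫ z in (0 : ℝ)..s, G y z) - ∫ z in (0 : ℝ)..s, K y z := fun y s =>
    intervalIntegral.integral_sub
      ((hG.comp (Continuous.prodMk_right y)).intervalIntegrable _ _)
      ((hK.comp (Continuous.prodMk_right y)).intervalIntegrable _ _)
  have h2 : ∀ c, charInt c (fun y s => ∫ z in (0 : ℝ)..s, (G y z - K y z)) x t =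
      charInt c (fun y s => ∫ z in (0 : ℝ)..s, G y z) x t -
      charInt c (fun y s => ∫ z in (0 : ℝ)..s, K y z) x t := by
    intro c
    unfold charInt
    simp_rw [h1]
    refine intervalIntegral.integral_sub ?_ ?_
    · exact ((continuous_primitive hG).comp (by fun_prop : Continuous fun y : ℝ =>
        (y, t + c * (x - y)))).intervalIntegrable _ _
    · exact ((continuous_primitive hK).comp (by fun_prop : Continuous fun y : ℝ =>
        (y, t + c * (x - y)))).intervalIntegrable _ _
  have hGK : Continuous (Function.uncurry fun y s => G y s - K y s) := hG.sub hK
  rw [duhamel_eq_charInt hGK, duhamel_eq_charInt hG, duhamel_eq_charInt hK, h2, h2]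
  ring

/-- Solutions of the integral form of the semilinear wave equation, in a weighted space of
continuous functions. -/
theorem exists_unique_integral_eq {h : ℝ → ℝ} {L : ℝ} (hL0 : 0 ≤ L) (h0 : h 0 = 0)
    (hL : ∀ s s', |h s - h s'| ≤ L * |s - s'|)
    {D : ℝ → ℝ → ℝ → ℝ} (hD : Continuous fun p : ℝ × ℝ × ℝ => D p.1 p.2.1 p.2.2)
    {B : ℝ} (hB : ∀ a x t, |D a x t| ≤ B) :
    ∃! φ : (ℝ × ℝ × ℝ) →ᵇ ℝ, ∀ a x t, cosh ((L + 1) * x) * φ (a, x, t) = D a x t +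
      1 / 2 * duhamel (fun y s => h (cosh ((L + 1) * y) * φ (a, y, s))) x t := by
  set l := L + 1 with hl
  have hlpos : 0 < l := by linarith
  have hLc : Continuous h := by
    have : LipschitzWith ⟨L, hL0⟩ h := LipschitzWith.of_dist_le_mul fun x y => by
      rw [Real.dist_eq, Real.dist_eq]; exact hL x y
    exact this.continuous
  have hG : ∀ φ : (ℝ × ℝ × ℝ) →ᵇ ℝ, Continuous fun p : ℝ × ℝ × ℝ =>
      (fun a y s => h (cosh (l * y) * φ (a, y, s))) p.1 p.2.1 p.2.2 := by
    intro φ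
    have := φ.continuous
    fun_prop
  have hcosh : ∀ x, 0 < cosh (l * x) := fun x => cosh_pos _
  have hest : ∀ φ ψ : (ℝ × ℝ × ℝ) →ᵇ ℝ, ∀ a x t,
      |duhamel (fun y s => h (cosh (l * y) * φ (a, y, s))) x t -
        duhamel (fun y s => h (cosh (l * y) * ψ (a, y, s))) x t| ≤
      (2 * (L * dist φ ψ) / l ^ 2) * cosh (l * x) := by
    intro φ ψ a x t
    have c1 := continuous_uncurry_of_param (G := fun a y s => h (cosh (l * y) * φ (a, y, s))) (hG φ) a
    have c2 := continuous_uncurry_of_param (G := fun a y s => h (cosh (l * y) * ψ (a, y, s))) (hG ψ) a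
    rw [← duhamel_sub c1 c2]
    refine abs_duhamel_le (by positivity) hlpos (fun y s => ?_) x t
    refine (hL _ _).trans ?_
    rw [← mul_sub, abs_mul, abs_of_pos (hcosh y)]
    have := BoundedContinuousFunction.dist_coe_le_dist (f := φ) (g := ψ) (a, y, s)
    rw [Real.dist_eq] at this
    have h3 := mul_le_mul_of_nonneg_left this (mul_nonneg hL0 (hcosh y).le)
    linarith
  have hL2 : L / l ^ 2 ≤ 1 / 2 := by
    rw [div_le_div_iff₀ (by positivity) (by norm_num)]
    nlinarith
  let S : ((ℝ × ℝ × ℝ) →ᵇ ℝ) → ((ℝ × ℝ × ℝ) →ᵇ ℝ) := fun φ =>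
    BoundedContinuousFunction.ofNormedAddCommGroup
      (fun p => (cosh (l * p.2.1))⁻¹ * (D p.1 p.2.1 p.2.2 +
        1 / 2 * duhamel (fun y s => h (cosh (l * y) * φ (p.1, y, s))) p.2.1 p.2.2))
      (by
        have h1 := continuous_duhamel_param (G := fun a y s => h (cosh (l * y) * φ (a, y, s))) (hG φ)
        have h2 : Continuous fun p : ℝ × ℝ × ℝ => (cosh (l * p.2.1))⁻¹ :=
          (by fun_prop : Continuous fun p : ℝ × ℝ × ℝ => cosh (l * p.2.1)).inv₀
            fun p => (hcosh _).ne'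
        exact h2.mul (hD.add (h1.const_mul (1 / 2))))
      (B + 1 / 2 * (2 * (L * dist φ 0) / l ^ 2))
      (by
        rintro ⟨a, x, t⟩
        have h1 := hest φ 0 a x t
        simp only [BoundedContinuousFunction.coe_zero, Pi.zero_apply, mul_zero, h0] at h1
        have h2 : duhamel (fun y s => (0 : ℝ)) x t = 0 := by simp [duhamel]
        rw [h2, sub_zero] at h1
        rw [Real.norm_eq_abs, abs_mul, abs_of_pos (inv_pos.2 (hcosh x)), inv_mul_le_iff₀ (hcosh x)]
        have hB0 : 0 ≤ B := (abs_nonneg _).trans (hB a x t)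
        have hc1 := one_le_cosh (l * x)
        have h4 := abs_add_le (D a x t)
          (1 / 2 * duhamel (fun y s => h (cosh (l * y) * φ (a, y, s))) x t)
        rw [abs_mul, abs_of_pos (by norm_num : (0 : ℝ) < 1 / 2)] at h4
        have := hB a x t
        nlinarith)
  have hSfix : ∀ φ : (ℝ × ℝ × ℝ) →ᵇ ℝ, S φ = φ ↔ ∀ a x t, cosh (l * x) * φ (a, x, t) = D a x t +
      1 / 2 * duhamel (fun y s => h (cosh (l * y) * φ (a, y, s))) x t := by
    intro φ
    have hS : ∀ a x t, S φ (a, x, t) = (cosh (l * x))⁻¹ * (D a x t +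
        1 / 2 * duhamel (fun y s => h (cosh (l * y) * φ (a, y, s))) x t) := fun _ _ _ => rfl
    constructor
    · intro hfix a x t
      have h1 := hS a x t
      rw [hfix] at h1
      rw [h1, mul_inv_cancel_left₀ (hcosh x).ne']
    · intro hE
      ext ⟨a, x, t⟩
      rw [hS, ← hE, inv_mul_cancel_left₀ (hcosh x).ne']
  have hcontr : ContractingWith (1 / 2) S := by
    refine ⟨by rw [← NNReal.coe_lt_coe]; norm_num, LipschitzWith.of_dist_le_mul fun φ ψ => ?_⟩
    rw [BoundedContinuousFunction.dist_le (by positivity)]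
    rintro ⟨a, x, t⟩
    have hS : ∀ φ, S φ (a, x, t) = (cosh (l * x))⁻¹ * (D a x t +
        1 / 2 * duhamel (fun y s => h (cosh (l * y) * φ (a, y, s))) x t) := fun _ => rfl
    rw [hS, hS, Real.dist_eq, ← mul_sub, abs_mul, abs_of_pos (inv_pos.2 (hcosh x)),
      inv_mul_le_iff₀ (hcosh x), add_sub_add_left_eq_sub, ← mul_sub, abs_mul,
      abs_of_pos (by norm_num : (0 : ℝ) < 1 / 2)]
    have h1 := hest φ ψ a x t
    have h2 : 1 / 2 * (2 * (L * dist φ ψ) / l ^ 2) ≤ 1 / 2 * dist φ ψ := by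
      have := mul_le_mul_of_nonneg_right hL2 (dist_nonneg (x := φ) (y := ψ))
      have e : 1 / 2 * (2 * (L * dist φ ψ) / l ^ 2) = L / l ^ 2 * dist φ ψ := by ring
      rw [e]; exact this
    have h3 := mul_le_mul_of_nonneg_right h2 (hcosh x).le
    push_cast
    linarith
  refine ⟨hcontr.fixedPoint, (hSfix _).1 hcontr.fixedPoint_isFixedPt, fun ψ hψ => ?_⟩
  exact hcontr.fixedPoint_unique ((hSfix ψ).2 hψ)

/-- A continuous solution of the integral equation is a classical solution. -/
theorem IsC2.of_integral_eq {h h' : ℝ → ℝ} (hh : ∀ s, HasDerivAt h (h' s) s) (hh' : Continuous h')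
    {φ φ' φ'' : ℝ → ℝ} (hφ : ∀ t, HasDerivAt φ (φ' t) t) (hφ' : ∀ t, HasDerivAt φ' (φ'' t) t)
    (cφ : Continuous φ'') {u : ℝ → ℝ → ℝ} (hu : Continuous (Function.uncurry u))
    (hE : ∀ x t, u x t = 1 / 2 * (φ (t + x) + φ (t - x)) +
      1 / 2 * duhamel (fun y s => h (u y s)) x t) :
    ∃ ux ut uxx uxt utt, IsC2 u ux ut uxx uxt utt ∧ (∀ x t, uxx x t = utt x t + h (u x t)) ∧
      ∀ t, ux 0 t = 0 := by
  have ch : Continuous h := continuous_iff_continuousAt.2 fun s => (hh s).continuousAt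
  set G : ℝ → ℝ → ℝ := fun y s => h (u y s) with hGdef
  have cG : Continuous (Function.uncurry G) := ch.comp hu
  set H : ℝ → ℝ → ℝ := fun y s => ∫ z in (0 : ℝ)..s, G y z with hHdef
  have cH : Continuous (Function.uncurry H) := continuous_primitive cG
  have dH : ∀ x t, HasDerivAt (H x) (G x t) t := fun x t =>
    (cG.comp (Continuous.prodMk_right x)).integral_hasStrictDerivAt 0 t |>.hasDerivAt
  have hu' : ∀ x t, u x t = 1 / 2 * (φ (t + x) + φ (t - x)) +
      1 / 2 * (charInt 1 H x t - charInt (-1) H x t) := fun x t => by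
    rw [hE, duhamel_eq_charInt cG]
  have ap : ∀ {g g' : ℝ → ℝ}, (∀ t, HasDerivAt g (g' t) t) → ∀ x t,
      HasDerivAt (fun y => g (t + y)) (g' (t + x)) x := fun hg x t => (hg _).comp_const_add t x
  have am : ∀ {g g' : ℝ → ℝ}, (∀ t, HasDerivAt g (g' t) t) → ∀ x t,
      HasDerivAt (fun y => g (t - y)) (-g' (t - x)) x := fun hg x t => (hg _).comp_const_sub t x
  have bp : ∀ {g g' : ℝ → ℝ}, (∀ t, HasDerivAt g (g' t) t) → ∀ x t,
      HasDerivAt (fun s => g (s + x)) (g' (t + x)) t := fun hg x t => (hg _).comp_add_const t x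
  have bm : ∀ {g g' : ℝ → ℝ}, (∀ t, HasDerivAt g (g' t) t) → ∀ x t,
      HasDerivAt (fun s => g (s - x)) (g' (t - x)) t := fun hg x t => (hg _).comp_sub_const t x
  set ut : ℝ → ℝ → ℝ := fun x t => 1 / 2 * (φ' (t + x) + φ' (t - x)) +
      1 / 2 * (charInt 1 G x t - charInt (-1) G x t) with hut
  have dut : ∀ x t, HasDerivAt (u x) (ut x t) t := fun x t => by
    have e : u x = fun t => 1 / 2 * (φ (t + x) + φ (t - x)) +
      1 / 2 * (charInt 1 H x t - charInt (-1) H x t) := funext (hu' x)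
    rw [e]
    exact (((bp hφ x t).add (bm hφ x t)).const_mul (1 / 2)).add
      (((hasDerivAt_charInt_t cH cG dH x t).sub (hasDerivAt_charInt_t cH cG dH x t)).const_mul
        (1 / 2))
  set ux : ℝ → ℝ → ℝ := fun x t => 1 / 2 * (φ' (t + x) - φ' (t - x)) +
      1 / 2 * (charInt 1 G x t + charInt (-1) G x t) with hux
  have dux : ∀ x t, HasDerivAt (fun y => u y t) (ux x t) x := fun x t => by
    have e : (fun y => u y t) = fun x => 1 / 2 * (φ (t + x) + φ (t - x)) +
      1 / 2 * (charInt 1 H x t - charInt (-1) H x t) := funext fun x => hu' x t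
    rw [e]
    refine ((((ap hφ x t).add (am hφ x t)).const_mul (1 / 2)).add
      (((hasDerivAt_charInt_x cH cG dH x t).sub (hasDerivAt_charInt_x cH cG dH x t)).const_mul
        (1 / 2))).congr_deriv ?_
    simp only [hux]
    ring
  have cφ' : Continuous φ' := continuous_iff_continuousAt.2 fun s => (hφ' s).continuousAt
  have cut : Continuous (Function.uncurry ut) := by
    have h1 := continuous_charInt (c := 1) cG
    have h2 := continuous_charInt (c := -1) cG
    have h3 : Continuous (Function.uncurry fun x t => 1 / 2 * (φ' (t + x) + φ' (t - x))) := by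
      unfold Function.uncurry; fun_prop
    exact h3.add ((h1.sub h2).const_mul (1 / 2))
  set Gt : ℝ → ℝ → ℝ := fun y s => h' (u y s) * ut y s with hGt
  have cGt : Continuous (Function.uncurry Gt) := (hh'.comp hu).mul cut
  have dG : ∀ x t, HasDerivAt (G x) (Gt x t) t := fun x t => (hh _).comp t (dut x t)
  have k1 := continuous_charInt (c := 1) cGt
  have k2 := continuous_charInt (c := -1) cGt
  have cutt : Continuous (Function.uncurry fun x t => 1 / 2 * (φ'' (t + x) + φ'' (t - x)) +
      1 / 2 * (charInt 1 Gt x t - charInt (-1) Gt x t)) := by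
    have h3 : Continuous (Function.uncurry fun x t => 1 / 2 * (φ'' (t + x) + φ'' (t - x))) := by
      unfold Function.uncurry; fun_prop
    exact h3.add ((k1.sub k2).const_mul (1 / 2))
  have cuxt : Continuous (Function.uncurry fun x t => 1 / 2 * (φ'' (t + x) - φ'' (t - x)) +
      1 / 2 * (charInt 1 Gt x t + charInt (-1) Gt x t)) := by
    have h3 : Continuous (Function.uncurry fun x t => 1 / 2 * (φ'' (t + x) - φ'' (t - x))) := by
      unfold Function.uncurry; fun_prop
    exact h3.add ((k1.add k2).const_mul (1 / 2))
  refine ⟨ux, ut, fun x t => (1 / 2 * (φ'' (t + x) + φ'' (t - x)) +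
      1 / 2 * (charInt 1 Gt x t - charInt (-1) Gt x t)) + G x t,
    fun x t => 1 / 2 * (φ'' (t + x) - φ'' (t - x)) +
      1 / 2 * (charInt 1 Gt x t + charInt (-1) Gt x t),
    fun x t => 1 / 2 * (φ'' (t + x) + φ'' (t - x)) +
      1 / 2 * (charInt 1 Gt x t - charInt (-1) Gt x t),
    ⟨dux, dut, fun x t => ?_, fun x t => ?_, fun x t => ?_, fun x t => ?_, ?_, cuxt, cutt⟩,
    fun x t => rfl, fun t => ?_⟩
  · refine ((((ap hφ' x t).sub (am hφ' x t)).const_mul (1 / 2)).add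
      (((hasDerivAt_charInt_x cG cGt dG x t).add (hasDerivAt_charInt_x cG cGt dG x t)).const_mul
        (1 / 2))).congr_deriv ?_
    ring
  · exact (((bp hφ' x t).sub (bm hφ' x t)).const_mul (1 / 2)).add
      (((hasDerivAt_charInt_t cG cGt dG x t).add (hasDerivAt_charInt_t cG cGt dG x t)).const_mul
        (1 / 2))
  · refine ((((ap hφ' x t).add (am hφ' x t)).const_mul (1 / 2)).add
      (((hasDerivAt_charInt_x cG cGt dG x t).sub (hasDerivAt_charInt_x cG cGt dG x t)).const_mul
        (1 / 2))).congr_deriv ?_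
    ring
  · exact (((bp hφ' x t).add (bm hφ' x t)).const_mul (1 / 2)).add
      (((hasDerivAt_charInt_t cG cGt dG x t).sub (hasDerivAt_charInt_t cG cGt dG x t)).const_mul
        (1 / 2))
  · exact cutt.add cG
  · simp [hux, charInt]

/-- Global solvability of `u_xx = u_tt + h(u)` with data prescribed at `x = 0`, depending
continuously on a parameter, for odd Lipschitz `h`. -/
theorem exists_wave_solution {h h' : ℝ → ℝ} {L : ℝ} (hL0 : 0 ≤ L)
    (hh : ∀ s, HasDerivAt h (h' s) s) (hh' : Continuous h') (hodd : ∀ s, h (-s) = -h s)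
    (hL : ∀ s s', |h s - h s'| ≤ L * |s - s'|) {Φ Φ' Φ'' : ℝ → ℝ → ℝ}
    (cΦ : Continuous (Function.uncurry Φ)) {B : ℝ} (hB : ∀ a t, |Φ a t| ≤ B)
    (dΦ : ∀ a t, HasDerivAt (Φ a) (Φ' a t) t) (dΦ' : ∀ a t, HasDerivAt (Φ' a) (Φ'' a t) t)
    (cΦ'' : ∀ a, Continuous (Φ'' a)) (oddΦ : ∀ a t, Φ a (-t) = -Φ a t) {T : ℝ}
    (perΦ : ∀ a t, Φ a (t + T) = Φ a t) :
    ∃ u : ℝ → ℝ → ℝ → ℝ, Continuous (fun p : ℝ × ℝ × ℝ => u p.1 p.2.1 p.2.2) ∧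
      (∀ a, ∃ ux ut uxx uxt utt, IsC2 (u a) ux ut uxx uxt utt ∧
        (∀ x t, uxx x t = utt x t + h (u a x t)) ∧ ∀ t, ux 0 t = 0) ∧
      (∀ a t, u a 0 t = Φ a t) ∧ (∀ a x t, u a (-x) t = u a x t) ∧
      (∀ a x t, u a x (-t) = -u a x t) ∧ ∀ a x t, u a x (t + T) = u a x t := by
  have h0 : h 0 = 0 := by
    have := hodd 0
    rw [neg_zero] at this
    linarith
  let D : ℝ → ℝ → ℝ → ℝ := fun a x t => 1 / 2 * (Φ a (t + x) + Φ a (t - x))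
  have hD : Continuous fun p : ℝ × ℝ × ℝ => D p.1 p.2.1 p.2.2 := by
    have e1 := cΦ.comp (by fun_prop : Continuous fun p : ℝ × ℝ × ℝ => (p.1, p.2.2 + p.2.1))
    have e2 := cΦ.comp (by fun_prop : Continuous fun p : ℝ × ℝ × ℝ => (p.1, p.2.2 - p.2.1))
    exact (e1.add e2).const_mul (1 / 2)
  have hDB : ∀ a x t, |D a x t| ≤ B := by
    intro a x t
    have h1 := abs_le.1 (hB a (t + x))
    have h2 := abs_le.1 (hB a (t - x))
    refine abs_le.2 ⟨?_, ?_⟩ <;> simp only [D] <;> linarith [h1.1, h1.2, h2.1, h2.2]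
  obtain ⟨φ, hφ, huniq⟩ := exists_unique_integral_eq hL0 h0 hL hD hDB
  have cu : Continuous fun p : ℝ × ℝ × ℝ => cosh ((L + 1) * p.2.1) * φ p :=
    (by fun_prop : Continuous fun p : ℝ × ℝ × ℝ => cosh ((L + 1) * p.2.1)).mul φ.continuous
  have symm_x : ∀ a x t, φ (a, -x, t) = φ (a, x, t) := by
    have := huniq (φ.compContinuous ⟨fun p : ℝ × ℝ × ℝ => (p.1, -p.2.1, p.2.2), by fun_prop⟩) ?_
    · intro a x t
      have h1 := DFunLike.congr_fun this (a, x, t)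
      simpa using h1
    · intro a x t
      simp only [BoundedContinuousFunction.compContinuous_apply, ContinuousMap.coe_mk]
      have h1 := hφ a (-x) t
      rw [← duhamel_comp_neg_left] at h1
      simp only [mul_neg, cosh_neg] at h1
      rw [h1]
      simp only [D]
      rw [add_right_cancel_iff, sub_neg_eq_add, ← sub_eq_add_neg, add_comm (Φ a (t - x))]
  have symm_t : ∀ a x t, φ (a, x, -t) = -φ (a, x, t) := by
    have := huniq (-(φ.compContinuous
      ⟨fun p : ℝ × ℝ × ℝ => (p.1, p.2.1, -p.2.2), by fun_prop⟩)) ?_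
    · intro a x t
      have h1 := DFunLike.congr_fun this (a, x, t)
      simp only [BoundedContinuousFunction.coe_neg, Pi.neg_apply,
        BoundedContinuousFunction.compContinuous_apply, ContinuousMap.coe_mk] at h1
      linarith
    · intro a x t
      simp only [BoundedContinuousFunction.coe_neg, Pi.neg_apply,
        BoundedContinuousFunction.compContinuous_apply, ContinuousMap.coe_mk, mul_neg, hodd]
      have h2 := duhamel_comp_neg_right (fun y s => h (cosh ((L + 1) * y) * φ (a, y, s))) x t
      rw [h2, hφ a x (-t)]
      have e1 := oddΦ a (t + x)
      have e2 := oddΦ a (t - x)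
      simp only [D]
      rw [show -t + x = -(t - x) by ring, show -t - x = -(t + x) by ring, e1, e2]
      ring
  have symm_T : ∀ a x t, φ (a, x, t + T) = φ (a, x, t) := by
    have := huniq (φ.compContinuous ⟨fun p : ℝ × ℝ × ℝ => (p.1, p.2.1, p.2.2 + T), by fun_prop⟩) ?_
    · intro a x t
      have h1 := DFunLike.congr_fun this (a, x, t)
      simpa using h1
    · intro a x t
      simp only [BoundedContinuousFunction.compContinuous_apply, ContinuousMap.coe_mk]
      have h2 := duhamel_comp_add (fun y s => h (cosh ((L + 1) * y) * φ (a, y, s))) T x t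
      rw [h2, hφ a x (t + T)]
      simp only [D]
      rw [show t + T + x = t + x + T by ring, show t + T - x = t - x + T by ring, perΦ, perΦ]
  refine ⟨fun a x t => cosh ((L + 1) * x) * φ (a, x, t), cu, fun a => ?_, fun a t => ?_,
    fun a x t => ?_, fun a x t => ?_, fun a x t => ?_⟩
  · exact IsC2.of_integral_eq hh hh' (dΦ a) (dΦ' a) (cΦ'' a)
      (cu.comp (by fun_prop : Continuous fun p : ℝ × ℝ => (a, p.1, p.2))) (hφ a)
  · have := hφ a 0 t
    simp only [this]
    simp [duhamel, D]
    ring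
  · simp only [mul_neg, cosh_neg, symm_x]
  · simp only [symm_t, mul_neg]
  · simp only [symm_T]

/-- Polynomials in two commuting variables, the coefficient of `pᵃ qᵇ` being indexed by `(a, b)`. -/
abbrev WavePoly := AddMonoidAlgebra ℝ (ℕ × ℕ)

namespace WavePoly

/-- The sum of the absolute values of the coefficients. -/
def wnorm (X : WavePoly) : ℝ := X.coeff.sum fun _ c => |c|

theorem wnorm_eq_sum {X : WavePoly} {s : Finset (ℕ × ℕ)} (h : X.coeff.support ⊆ s) :
    wnorm X = ∑ i ∈ s, |X.coeff i| :=
  Finsupp.sum_of_support_subset _ h _ fun _ _ => abs_zero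

theorem wnorm_nonneg (X : WavePoly) : 0 ≤ wnorm X :=
  Finset.sum_nonneg fun _ _ => abs_nonneg _

theorem wnorm_zero : wnorm 0 = 0 := by simp [wnorm]

theorem wnorm_single (i : ℕ × ℕ) (c : ℝ) : wnorm (AddMonoidAlgebra.single i c) = |c| := by
  simp [wnorm]

theorem wnorm_add_le (X Y : WavePoly) : wnorm (X + Y) ≤ wnorm X + wnorm Y := by
  classical
  have h1 : X.coeff.support ⊆ X.coeff.support ∪ Y.coeff.support := Finset.subset_union_left
  have h2 : Y.coeff.support ⊆ X.coeff.support ∪ Y.coeff.support := Finset.subset_union_right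
  have h3 : (X + Y).coeff.support ⊆ X.coeff.support ∪ Y.coeff.support := Finsupp.support_add
  rw [wnorm_eq_sum h1, wnorm_eq_sum h2, wnorm_eq_sum h3, ← Finset.sum_add_distrib]
  exact Finset.sum_le_sum fun i _ => abs_add_le _ _

theorem wnorm_neg (X : WavePoly) : wnorm (-X) = wnorm X := by
  have h : (-X).coeff.support ⊆ X.coeff.support := by
    rw [AddMonoidAlgebra.coeff_neg, Finsupp.support_neg]
  rw [wnorm_eq_sum h, wnorm_eq_sum (Finset.Subset.refl _)]
  simp

theorem wnorm_sub_le (X Y : WavePoly) : wnorm (X - Y) ≤ wnorm X + wnorm Y := by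
  rw [sub_eq_add_neg, ← wnorm_neg Y]
  exact wnorm_add_le _ _

theorem wnorm_smul (c : ℝ) (X : WavePoly) : wnorm (c • X) = |c| * wnorm X := by
  have h : (c • X).coeff.support ⊆ X.coeff.support := Finsupp.support_smul
  rw [wnorm_eq_sum h, wnorm_eq_sum (Finset.Subset.refl _), Finset.mul_sum]
  simp [abs_mul]

theorem wnorm_sum_le {ι : Type*} (s : Finset ι) (F : ι → WavePoly) :
    wnorm (∑ i ∈ s, F i) ≤ ∑ i ∈ s, wnorm (F i) := by
  classical
  induction s using Finset.induction_on with
  | empty => simp [wnorm_zero]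
  | insert a s ha ih =>
    rw [Finset.sum_insert ha, Finset.sum_insert ha]
    exact (wnorm_add_le _ _).trans (by linarith)

theorem wnorm_mul_le (X Y : WavePoly) : wnorm (X * Y) ≤ wnorm X * wnorm Y := by
  rw [AddMonoidAlgebra.mul_def]
  refine (wnorm_sum_le _ _).trans ?_
  rw [wnorm, wnorm, Finsupp.sum, Finset.sum_mul]
  refine Finset.sum_le_sum fun i _ => (wnorm_sum_le _ _).trans ?_
  rw [Finsupp.sum, Finset.mul_sum]
  refine Finset.sum_le_sum fun j _ => ?_
  rw [wnorm_single, abs_mul]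

theorem wnorm_one : wnorm 1 = 1 := by
  rw [AddMonoidAlgebra.one_def, wnorm_single, abs_one]

theorem wnorm_pow_le (X : WavePoly) (n : ℕ) : wnorm (X ^ n) ≤ wnorm X ^ n := by
  induction n with
  | zero => simp [wnorm_one]
  | succ n ih =>
    rw [pow_succ, pow_succ]
    exact (wnorm_mul_le _ _).trans (mul_le_mul_of_nonneg_right ih (wnorm_nonneg _))

theorem wnorm_pow_sub_pow_le {X Y : WavePoly} {R : ℝ} (hX : wnorm X ≤ R) (hY : wnorm Y ≤ R)
    (n : ℕ) : wnorm (X ^ n - Y ^ n) ≤ n * R ^ (n - 1) * wnorm (X - Y) := by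
  have hR : 0 ≤ R := (wnorm_nonneg X).trans hX
  induction n with
  | zero => simp [wnorm_zero]
  | succ n ih =>
    have e : X ^ (n + 1) - Y ^ (n + 1) = X * (X ^ n - Y ^ n) + (X - Y) * Y ^ n := by ring
    rw [e]
    refine (wnorm_add_le _ _).trans ?_
    have h1 : wnorm (X * (X ^ n - Y ^ n)) ≤ R * (n * R ^ (n - 1) * wnorm (X - Y)) :=
      (wnorm_mul_le _ _).trans (mul_le_mul hX ih (wnorm_nonneg _) hR)
    have h2 : wnorm ((X - Y) * Y ^ n) ≤ wnorm (X - Y) * R ^ n :=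
      (wnorm_mul_le _ _).trans (mul_le_mul_of_nonneg_left
        ((wnorm_pow_le _ _).trans (pow_le_pow_left₀ (wnorm_nonneg _) hY _)) (wnorm_nonneg _))
    have h3 : R * (n * R ^ (n - 1) * wnorm (X - Y)) = n * R ^ n * wnorm (X - Y) := by
      rcases n with _ | n
      · simp
      · simp only [Nat.add_sub_cancel, pow_succ]; ring
    rw [h3] at h1
    push_cast
    linarith

/-- Sums of coefficients along an injective family of indices are bounded by the norm. -/
theorem sum_abs_coeff_le {ι : Type*} (X : WavePoly) (s : Finset ι) (g : ι → ℕ × ℕ)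
    (hg : Set.InjOn g s) : ∑ i ∈ s, |X.coeff (g i)| ≤ wnorm X := by
  classical
  rw [← Finset.sum_image (f := fun i => |X.coeff i|) hg]
  rw [wnorm_eq_sum (X := X) (s := X.coeff.support ∪ s.image g) Finset.subset_union_left]
  exact Finset.sum_le_sum_of_subset_of_nonneg Finset.subset_union_right fun _ _ _ => abs_nonneg _

/-- Multiplication of the coefficients by a weight. -/
def diag (w : ℕ × ℕ → ℝ) (X : WavePoly) : WavePoly :=
  X.coeff.sum fun i c => AddMonoidAlgebra.single i (w i * c)

theorem coeff_diag (w : ℕ × ℕ → ℝ) (X : WavePoly) (i : ℕ × ℕ) :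
    (diag w X).coeff i = w i * X.coeff i := by
  classical
  rw [diag, Finsupp.sum, AddMonoidAlgebra.coeff_sum, Finsupp.finsetSum_apply]
  simp only [AddMonoidAlgebra.coeff_single, Finsupp.single_apply]
  rw [Finset.sum_ite_eq']
  split_ifs with h
  · rfl
  · rw [Finsupp.notMem_support_iff.1 h, mul_zero]

theorem diag_add (w : ℕ × ℕ → ℝ) (X Y : WavePoly) : diag w (X + Y) = diag w X + diag w Y := by
  ext i
  rw [AddMonoidAlgebra.coeff_add, Finsupp.add_apply, coeff_diag, coeff_diag, coeff_diag,
    AddMonoidAlgebra.coeff_add, Finsupp.add_apply, mul_add]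

theorem wnorm_diag_le {w : ℕ × ℕ → ℝ} {X : WavePoly} {C : ℝ}
    (h : ∀ i, X.coeff i ≠ 0 → |w i| ≤ C) : wnorm (diag w X) ≤ C * wnorm X := by
  refine (wnorm_sum_le _ _).trans ?_
  rw [wnorm, Finsupp.sum, Finset.mul_sum]
  refine Finset.sum_le_sum fun i hi => ?_
  rw [wnorm_single, abs_mul]
  exact mul_le_mul_of_nonneg_right (h i (Finsupp.mem_support_iff.1 hi)) (abs_nonneg _)

/-- Exchange of the two variables. -/
def swap : WavePoly ≃ₐ[ℝ] WavePoly :=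
  AddMonoidAlgebra.domCongr ℝ ℝ (AddEquiv.prodComm : ℕ × ℕ ≃+ ℕ × ℕ)

theorem coeff_swap (X : WavePoly) (a b : ℕ) : (swap X).coeff (a, b) = X.coeff (b, a) := by
  rw [swap, AddMonoidAlgebra.coeff_domCongr]
  rfl

theorem swap_single (a b : ℕ) (c : ℝ) :
    swap (AddMonoidAlgebra.single (a, b) c) = AddMonoidAlgebra.single (b, a) c := by
  rw [swap, AddMonoidAlgebra.domCongr_single]
  rfl

theorem swap_diag {w : ℕ × ℕ → ℝ} (hw : ∀ a b, w (a, b) = w (b, a)) {X : WavePoly}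
    (hX : swap X = X) : swap (diag w X) = diag w X := by
  ext ⟨a, b⟩
  rw [coeff_swap, coeff_diag, coeff_diag, hw, ← coeff_swap X, hX]

/-- All monomials have degree at least `d` and of the same parity as `d`. -/
def DegGe (d : ℕ) (X : WavePoly) : Prop :=
  ∀ a b, X.coeff (a, b) ≠ 0 → d ≤ a + b ∧ (a + b) % 2 = d % 2

theorem DegGe.add {d : ℕ} {X Y : WavePoly} (hX : DegGe d X) (hY : DegGe d Y) :
    DegGe d (X + Y) := by
  intro a b h
  by_cases h1 : X.coeff (a, b) = 0
  · by_cases h2 : Y.coeff (a, b) = 0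
    · simp [h1, h2] at h
    · exact hY a b h2
  · exact hX a b h1

theorem DegGe.smul {d : ℕ} {X : WavePoly} (c : ℝ) (hX : DegGe d X) : DegGe d (c • X) := by
  intro a b h
  refine hX a b fun h1 => h ?_
  simp [h1]

theorem DegGe.zero (d : ℕ) : DegGe d 0 := by
  intro a b h
  simp at h

theorem DegGe.sum {ι : Type*} {d : ℕ} (s : Finset ι) {F : ι → WavePoly}
    (h : ∀ i ∈ s, DegGe d (F i)) : DegGe d (∑ i ∈ s, F i) := by
  classical
  induction s using Finset.induction_on with
  | empty => simpa using DegGe.zero d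
  | insert a s ha ih =>
    rw [Finset.sum_insert ha]
    exact (h a (Finset.mem_insert_self _ _)).add (ih fun i hi => h i (Finset.mem_insert_of_mem hi))

theorem DegGe.single {d a b : ℕ} (c : ℝ) (h1 : d ≤ a + b) (h2 : (a + b) % 2 = d % 2) :
    DegGe d (AddMonoidAlgebra.single (a, b) c) := by
  classical
  intro a' b' h
  rw [AddMonoidAlgebra.coeff_single, Finsupp.single_apply] at h
  split_ifs at h with h3
  · simp only [Prod.mk.injEq] at h3
    rw [← h3.1, ← h3.2]
    exact ⟨h1, h2⟩
  · exact absurd rfl h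

theorem DegGe.mul {d e : ℕ} {X Y : WavePoly} (hX : DegGe d X) (hY : DegGe e Y) :
    DegGe (d + e) (X * Y) := by
  rw [AddMonoidAlgebra.mul_def]
  refine DegGe.sum _ fun i hi => DegGe.sum _ fun j hj => ?_
  have h1 := hX i.1 i.2 (Finsupp.mem_support_iff.1 hi)
  have h2 := hY j.1 j.2 (Finsupp.mem_support_iff.1 hj)
  refine DegGe.single _ ?_ ?_ <;> omega

theorem DegGe.mono {d e : ℕ} {X : WavePoly} (hX : DegGe d X) (h1 : e ≤ d) (h2 : d % 2 = e % 2) :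
    DegGe e X := by
  intro a b h
  have := hX a b h
  omega

theorem DegGe.pow {X : WavePoly} (hX : DegGe 1 X) {n : ℕ} (hn : n ≠ 0) : DegGe n (X ^ n) := by
  induction n with
  | zero => exact absurd rfl hn
  | succ n ih =>
    rcases Nat.eq_zero_or_pos n with h | h
    · simpa [h] using hX
    · rw [pow_succ]
      exact (ih h.ne').mul hX

theorem DegGe.diag {d : ℕ} {X : WavePoly} (w : ℕ × ℕ → ℝ) (hX : DegGe d X) :
    DegGe d (diag w X) := by
  intro a b h
  rw [coeff_diag] at h
  exact hX a b (right_ne_zero_of_mul h)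

theorem coeff_shift (c : ℝ) (X : WavePoly) (a b i j : ℕ) :
    (AddMonoidAlgebra.single (i, j) c * X).coeff (a + i, b + j) = c * X.coeff (a, b) := by
  refine AddMonoidAlgebra.coeff_single_mul_eq_mul_coeff _ fun m _ => ?_
  obtain ⟨m1, m2⟩ := m
  simp only [Prod.mk_add_mk, Prod.mk.injEq]
  omega

theorem coeff_shift_of_lt (c : ℝ) (X : WavePoly) {a b i j : ℕ} (h : a < i ∨ b < j) :
    (AddMonoidAlgebra.single (i, j) c * X).coeff (a, b) = 0 := by
  refine AddMonoidAlgebra.coeff_single_mul_of_forall_add_ne _ _ fun d hd => ?_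
  obtain ⟨d1, d2⟩ := d
  simp only [Prod.mk_add_mk, Prod.mk.injEq] at hd
  omega

end WavePoly

open scoped NNReal in
/-- A fixed point theorem for maps contracting the `ℓ¹` norm on finitely many coordinates. -/
theorem exists_fixed_of_l1_contraction {ι : Type*} (s : Finset ι) (Γ : (ι → ℝ) → ι → ℝ) {η : ℝ}
    (h0 : ∑ i ∈ s, |Γ 0 i| ≤ η / 2)
    (hc : ∀ y y' : ι → ℝ, ∑ i ∈ s, |y i| ≤ η → ∑ i ∈ s, |y' i| ≤ η →
      ∑ i ∈ s, |Γ y i - Γ y' i| ≤ 1 / 2 * ∑ i ∈ s, |y i - y' i|) :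
    ∃ y : ι → ℝ, ∑ i ∈ s, |y i| ≤ η ∧ ∑ i ∈ s, |y i| ≤ 2 * ∑ i ∈ s, |Γ 0 i| ∧
      ∀ i ∈ s, Γ y i = y i := by
  classical
  let E := PiLp 1 (fun _ : s => ℝ)
  let ex : E → ι → ℝ := fun y i => if h : i ∈ s then y ⟨i, h⟩ else 0
  have hex : ∀ (y : E) (i : s), ex y i = y i := fun y i => by simp [ex]
  let F : E → E := fun y => WithLp.toLp 1 fun i : s => Γ (ex y) i
  have hdist : ∀ y y' : E, dist y y' = ∑ i ∈ s, |ex y i - ex y' i| := by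
    intro y y'
    rw [PiLp.dist_eq_sum (by norm_num)]
    simp only [ENNReal.toReal_one, rpow_one, ne_eq, one_ne_zero, not_false_eq_true, div_self,
      Real.dist_eq]
    rw [← Finset.sum_coe_sort s (fun i => |ex y i - ex y' i|)]
    refine Finset.sum_congr rfl fun i _ => ?_
    rw [hex, hex]
  have hF : ∀ (y : E) (i), i ∈ s → ex (F y) i = Γ (ex y) i := by
    intro y i hi
    simp [ex, F, hi]
  have hF2 : ∀ y y' : E, dist (F y) (F y') = ∑ i ∈ s, |Γ (ex y) i - Γ (ex y') i| := by
    intro y y'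
    rw [hdist]
    refine Finset.sum_congr rfl fun i hi => ?_
    rw [hF y i hi, hF y' i hi]
  have hex0 : ex 0 = 0 := by
    ext i
    simp [ex]
  have hd0 : ∀ y : E, dist y 0 = ∑ i ∈ s, |ex y i| := by
    intro y
    rw [hdist, hex0]
    simp
  have hη : 0 ≤ η := by
    have : 0 ≤ ∑ i ∈ s, |Γ 0 i| := Finset.sum_nonneg fun _ _ => abs_nonneg _
    linarith
  have hmaps : MapsTo F (Metric.closedBall 0 η) (Metric.closedBall 0 η) := by
    intro y hy
    rw [Metric.mem_closedBall] at hy ⊢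
    have h1 : dist (F y) (F 0) ≤ 1 / 2 * η := by
      rw [hF2]
      have h2 : (0 : E) ∈ Metric.closedBall (0 : E) η := Metric.mem_closedBall_self hη
      rw [Metric.mem_closedBall] at h2
      refine (hc _ _ (by rw [← hd0]; exact hy) (by rw [← hd0]; exact h2)).trans ?_
      rw [← hdist]
      linarith
    have h2 : dist (F 0) 0 ≤ η / 2 := by
      rw [hd0]
      refine le_trans (le_of_eq ?_) h0
      refine Finset.sum_congr rfl fun i hi => ?_
      rw [hF _ _ hi, hex0]
    linarith [dist_triangle (F y) (F 0) 0]
  have hcontr : ContractingWith (1 / 2 : ℝ≥0) (hmaps.restrict F _ _) := by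
    refine ⟨by rw [← NNReal.coe_lt_coe]; norm_num, LipschitzWith.of_dist_le_mul ?_⟩
    rintro ⟨y, hy⟩ ⟨y', hy'⟩
    rw [Metric.mem_closedBall] at hy hy'
    have h1 := hc (ex y) (ex y') (by rw [← hd0]; exact hy) (by rw [← hd0]; exact hy')
    rw [← hdist, ← hF2] at h1
    simpa [Subtype.dist_eq] using h1
  have hcomp : IsComplete (Metric.closedBall (0 : E) η) := Metric.isClosed_closedBall.isComplete
  obtain ⟨y, hy, hfix, -⟩ := hcontr.exists_fixedPoint' hcomp hmaps
    (Metric.mem_closedBall_self hη) (edist_ne_top _ _)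
  have hfix' : F y = y := hfix
  rw [Metric.mem_closedBall] at hy
  have hs := hd0 y
  refine ⟨ex y, by rw [← hs]; exact hy, ?_, fun i hi => ?_⟩
  · have h1 := hc (ex y) 0 (by rw [← hs]; exact hy) (by simpa using hη)
    have h2 : ∑ i ∈ s, |ex y i| ≤ ∑ i ∈ s, (|Γ (ex y) i - Γ 0 i| + |Γ 0 i|) := by
      refine Finset.sum_le_sum fun i hi => ?_
      have : ex y i = Γ (ex y) i := by rw [← hF y i hi, hfix']
      calc |ex y i| = |(Γ (ex y) i - Γ 0 i) + Γ 0 i| := by rw [sub_add_cancel, ← this]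
        _ ≤ _ := abs_add_le _ _
    rw [Finset.sum_add_distrib] at h2
    simp only [Pi.zero_apply, sub_zero] at h1
    linarith
  · rw [← hF y i hi, hfix']

namespace WavePoly

/-- The leading order term. -/
def lead (α : ℝ) : WavePoly :=
  AddMonoidAlgebra.single (1, 0) (α / 2) + AddMonoidAlgebra.single (0, 1) (α / 2)

/-- The nonlinearity. -/
def nonlin (b : ℝ) (J : Finset ℕ) (β : ℕ → ℝ) (X : WavePoly) : WavePoly :=
  b • X ^ 3 + ∑ j ∈ J, β j • X ^ j

/-- The symbol of `∂ₓ² - ∂ₜ² - 1`, up to terms of higher degree. -/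
def symb (ε : ℝ) (i : ℕ × ℕ) : ℝ :=
  ((i.1 : ℝ) + i.2) ^ 2 * ε ^ 2 + ((i.1 : ℝ) - i.2) ^ 2 * (1 - ε ^ 2) - 1

/-- The weight of the term raising the degree in `∂ₓ²`. -/
def raise (i : ℕ × ℕ) : ℝ := ((i.1 : ℝ) + i.2) * ((i.1 : ℝ) + i.2 + 1)

/-- The residual of the stationary equation. -/
def resid (ε r : ℝ) (b : ℝ) (J : Finset ℕ) (β : ℕ → ℝ) (X : WavePoly) : WavePoly :=
  diag (symb ε) X - AddMonoidAlgebra.single (1, 1) r * diag raise X + r • nonlin b J β X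

/-- Symmetric monomials of frequency `2j+1`. -/
def sym (i : ℕ × ℕ) : WavePoly :=
  AddMonoidAlgebra.single (i.2 + 2 * i.1 + 1, i.2) 1 +
    AddMonoidAlgebra.single (i.2, i.2 + 2 * i.1 + 1) 1

/-- The weight attached to the frequency `2j+1`. -/
def wt (i : ℕ × ℕ) : ℝ := if i.1 = 0 then 1 else 1 / 8

theorem wt_pos (i : ℕ × ℕ) : 0 < wt i := by unfold wt; split_ifs <;> norm_num

theorem wt_le_one (i : ℕ × ℕ) : wt i ≤ 1 := by unfold wt; split_ifs <;> norm_num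

/-- Assembling a symmetric polynomial from its coefficients. -/
def toW (s : Finset (ℕ × ℕ)) (y : ℕ × ℕ → ℝ) : WavePoly := ∑ i ∈ s, (wt i * y i) • sym i

theorem coeff_toW (s : Finset (ℕ × ℕ)) (y : ℕ × ℕ → ℝ) (j b : ℕ) :
    (toW s y).coeff (b + 2 * j + 1, b) = if (j, b) ∈ s then wt (j, b) * y (j, b) else 0 := by
  classical
  rw [toW, AddMonoidAlgebra.coeff_sum, Finsupp.finsetSum_apply, ← Finset.sum_ite_eq' s (j, b)
    fun i => wt i * y i]
  refine Finset.sum_congr rfl fun i _ => ?_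
  obtain ⟨i1, i2⟩ := i
  simp only [sym, AddMonoidAlgebra.coeff_smul, AddMonoidAlgebra.coeff_add, Finsupp.smul_apply,
    Finsupp.add_apply, AddMonoidAlgebra.coeff_single, Finsupp.single_apply, Prod.mk.injEq,
    smul_eq_mul]
  by_cases h : i1 = j ∧ i2 = b
  · obtain ⟨rfl, rfl⟩ := h
    have : ¬ (i2 = i2 + 2 * i1 + 1 ∧ i2 + 2 * i1 + 1 = i2) := by omega
    simp [this]
  · have h1 : ¬ (i2 + 2 * i1 + 1 = b + 2 * j + 1 ∧ i2 = b) := by omega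
    have h2 : ¬ (i2 = b + 2 * j + 1 ∧ i2 + 2 * i1 + 1 = b) := by omega
    rw [if_neg h1, if_neg h2, if_neg h]
    simp

theorem swap_toW (s : Finset (ℕ × ℕ)) (y : ℕ × ℕ → ℝ) : swap (toW s y) = toW s y := by
  rw [toW, map_sum]
  refine Finset.sum_congr rfl fun i _ => ?_
  rw [map_smul, sym, map_add, swap_single, swap_single, add_comm]

theorem toW_sub (s : Finset (ℕ × ℕ)) (y y' : ℕ × ℕ → ℝ) :
    toW s y - toW s y' = toW s (fun i => y i - y' i) := by
  rw [toW, toW, toW, ← Finset.sum_sub_distrib]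
  refine Finset.sum_congr rfl fun i _ => ?_
  rw [← sub_smul, mul_sub]

theorem wnorm_sym_le (i : ℕ × ℕ) : wnorm (sym i) ≤ 2 := by
  refine (wnorm_add_le _ _).trans ?_
  rw [wnorm_single, wnorm_single]
  norm_num

theorem wnorm_toW_le (s : Finset (ℕ × ℕ)) (y : ℕ × ℕ → ℝ) :
    wnorm (toW s y) ≤ 2 * ∑ i ∈ s, |y i| := by
  refine (wnorm_sum_le _ _).trans ?_
  rw [Finset.mul_sum]
  refine Finset.sum_le_sum fun i _ => ?_
  rw [wnorm_smul, abs_mul, abs_of_pos (wt_pos i)]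
  have h1 := wt_le_one i
  have h2 := wnorm_sym_le i
  have h3 := wnorm_nonneg (sym i)
  have h4 : wt i * |y i| ≤ |y i| := mul_le_of_le_one_left (abs_nonneg _) h1
  calc wt i * |y i| * wnorm (sym i) ≤ |y i| * 2 := by gcongr
    _ = _ := by ring

theorem degGe_sym (i : ℕ × ℕ) : DegGe 1 (sym i) :=
  (DegGe.single _ (by omega) (by omega)).add (DegGe.single _ (by omega) (by omega))

theorem degGe_toW (s : Finset (ℕ × ℕ)) (y : ℕ × ℕ → ℝ) : DegGe 1 (toW s y) :=
  DegGe.sum _ fun i _ => (degGe_sym i).smul _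

theorem degGe_lead (α : ℝ) : DegGe 1 (lead α) :=
  (DegGe.single _ (by omega) (by omega)).add (DegGe.single _ (by omega) (by omega))

theorem swap_lead (α : ℝ) : swap (lead α) = lead α := by
  rw [lead, map_add, swap_single, swap_single, add_comm]

theorem wnorm_lead_le {α : ℝ} (hα : 0 ≤ α) : wnorm (lead α) ≤ α := by
  refine (wnorm_add_le _ _).trans ?_
  rw [wnorm_single, wnorm_single, abs_of_nonneg (by positivity)]
  linarith

theorem degGe_nonlin {b : ℝ} {J : Finset ℕ} {β : ℕ → ℝ} (hJ : ∀ j ∈ J, 5 ≤ j ∧ j % 2 = 1)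
    {X : WavePoly} (hX : DegGe 1 X) : DegGe 3 (nonlin b J β X) := by
  refine ((hX.pow (by norm_num)).smul _).add (DegGe.sum _ fun j hj => ?_)
  have := hJ j hj
  exact ((hX.pow (by omega)).mono (by omega) (by omega)).smul _

theorem degGe_resid {ε r b : ℝ} {J : Finset ℕ} {β : ℕ → ℝ} (hJ : ∀ j ∈ J, 5 ≤ j ∧ j % 2 = 1)
    {X : WavePoly} (hX : DegGe 1 X) : DegGe 1 (resid ε r b J β X) := by
  rw [resid, sub_eq_add_neg, ← neg_one_smul ℝ (_ * _)]
  refine ((hX.diag _).add (DegGe.smul _ ?_)).add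
    (((degGe_nonlin hJ hX).mono (by norm_num) (by norm_num)).smul _)
  exact ((DegGe.single (d := 2) r (by norm_num) (by norm_num)).mul (hX.diag _)).mono
    (by norm_num) (by norm_num)

theorem swap_resid {ε r b : ℝ} {J : Finset ℕ} {β : ℕ → ℝ} {X : WavePoly} (hX : swap X = X) :
    swap (resid ε r b J β X) = resid ε r b J β X := by
  have h1 : swap (diag (symb ε) X) = diag (symb ε) X :=
    swap_diag (fun a b => by simp only [symb]; ring) hX
  have h2 : swap (diag raise X) = diag raise X :=
    swap_diag (fun a b => by simp only [raise]; ring) hX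
  rw [resid, map_add, map_sub, map_mul, h1, h2, swap_single, map_smul, nonlin, map_add, map_smul,
    map_pow, hX, map_sum]
  congr 3
  refine Finset.sum_congr rfl fun j _ => ?_
  rw [map_smul, map_pow, hX]

/-- The box of indices. -/
def box (M : ℕ) : Finset (ℕ × ℕ) := Finset.range (M + 1) ×ˢ Finset.range (M + 1)

theorem mem_box {M j b : ℕ} : (j, b) ∈ box M ↔ j ≤ M ∧ b ≤ M := by
  simp [box]

theorem coeff_toW_box_ne {M : ℕ} {y : ℕ × ℕ → ℝ} {a b : ℕ}
    (h : (toW (box M) y).coeff (a, b) ≠ 0) : a + b ≤ 4 * M + 1 := by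
  have hp := degGe_toW _ _ a b h
  wlog hab : b < a generalizing a b
  · have h' : (toW (box M) y).coeff (b, a) ≠ 0 := by rwa [← coeff_swap, swap_toW]
    have := this h' (by omega) (by omega)
    omega
  obtain ⟨j, rfl⟩ : ∃ j, a = b + 2 * j + 1 := ⟨(a - b) / 2, by omega⟩
  rw [coeff_toW] at h
  split_ifs at h with h1
  · rw [mem_box] at h1
    omega
  · exact absurd rfl h

/-- Sums of coefficients along injective families. -/
theorem sum_coeff_toW_le {ι : Type*} {s : Finset (ℕ × ℕ)} {y : ℕ × ℕ → ℝ} {S : Finset ι}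
    {g : ι → ℕ × ℕ} (hg : Set.InjOn g S) {C : ℝ} (hC0 : 0 ≤ C)
    (hC : ∀ x ∈ S, wt (g x) ≤ C) :
    ∑ x ∈ S, |(toW s y).coeff ((g x).2 + 2 * (g x).1 + 1, (g x).2)| ≤ C * ∑ i ∈ s, |y i| := by
  classical
  rw [Finset.mul_sum]
  have h1 : ∀ x ∈ S, |(toW s y).coeff ((g x).2 + 2 * (g x).1 + 1, (g x).2)| ≤
      if g x ∈ s then C * |y (g x)| else 0 := by
    intro x hx
    rw [coeff_toW]
    simp only [Prod.mk.eta]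
    split_ifs
    · rw [abs_mul, abs_of_pos (wt_pos _)]
      exact mul_le_mul_of_nonneg_right (hC x hx) (abs_nonneg _)
    · simp
  refine (Finset.sum_le_sum h1).trans ?_
  rw [← Finset.sum_filter]
  have hg' : Set.InjOn g (S.filter fun x => g x ∈ s) :=
    hg.mono (by exact_mod_cast Finset.filter_subset _ _)
  rw [← Finset.sum_image (f := fun i => C * |y i|) hg']
  refine Finset.sum_le_sum_of_subset_of_nonneg ?_ fun _ _ _ => by positivity
  intro i hi
  simp only [Finset.mem_image, Finset.mem_filter] at hi
  obtain ⟨x, ⟨-, hx⟩, rfl⟩ := hi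
  exact hx

/-- The linearization of the nonlinearity at the leading term. -/
def quad : WavePoly :=
  AddMonoidAlgebra.single (2, 0) 2 + AddMonoidAlgebra.single (1, 1) 4 +
    AddMonoidAlgebra.single (0, 2) 2

theorem wnorm_quad_le : wnorm quad ≤ 8 := by
  refine (wnorm_add_le _ _).trans ?_
  have := wnorm_add_le (AddMonoidAlgebra.single (2, 0) 2) (AddMonoidAlgebra.single (1, 1) 4)
  rw [wnorm_single, wnorm_single] at this
  rw [wnorm_single]
  norm_num at this ⊢
  linarith

theorem smul_lead_sq {b α : ℝ} (h : b * α ^ 2 = 8 / 3) : (3 * b) • lead α ^ 2 = quad := by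
  have e : lead α ^ 2 = AddMonoidAlgebra.single (2, 0) (α ^ 2 / 4) +
      AddMonoidAlgebra.single (1, 1) (α ^ 2 / 2) + AddMonoidAlgebra.single (0, 2) (α ^ 2 / 4) := by
    rw [lead, add_sq, AddMonoidAlgebra.single_pow, AddMonoidAlgebra.single_pow, mul_assoc,
      AddMonoidAlgebra.single_mul_single, two_mul, ← AddMonoidAlgebra.single_add]
    congr 3 <;> ring
  rw [e, quad, smul_add, smul_add, AddMonoidAlgebra.smul_single, AddMonoidAlgebra.smul_single,
    AddMonoidAlgebra.smul_single]
  simp only [smul_eq_mul]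
  congr 3 <;> linarith

theorem nonlin_sub {b α δ ρ : ℝ} (hb : 0 ≤ b) (hα : 0 ≤ α) (h : b * α ^ 2 = 8 / 3) {J : Finset ℕ}
    {β : ℕ → ℝ} (hρ : ρ ≤ 1) (hδ : ∑ j ∈ J, j * |β j| * (α + 1) ^ (j - 1) ≤ δ)
    {Y Y' : WavePoly} (hY : wnorm Y ≤ ρ) (hY' : wnorm Y' ≤ ρ) :
    ∃ Q, nonlin b J β (lead α + Y) - nonlin b J β (lead α + Y') = quad * (Y - Y') + Q ∧
      wnorm Q ≤ (b * (6 * α * ρ + 3 * ρ ^ 2) + δ) * wnorm (Y - Y') := by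
  set U := lead α
  have hU : wnorm U ≤ α := wnorm_lead_le hα
  have hρ0 : 0 ≤ ρ := (wnorm_nonneg _).trans hY
  have hN := wnorm_nonneg (Y - Y')
  refine ⟨b • ((3 : ℝ) • (U * (Y + Y')) * (Y - Y') + (Y * Y + Y * Y' + Y' * Y') * (Y - Y')) +
    ∑ j ∈ J, β j • ((U + Y) ^ j - (U + Y') ^ j), ?_, ?_⟩
  · rw [← smul_lead_sq h, nonlin, nonlin]
    have e2 : ∑ j ∈ J, β j • ((U + Y) ^ j - (U + Y') ^ j) =
        ∑ j ∈ J, β j • (U + Y) ^ j - ∑ j ∈ J, β j • (U + Y') ^ j := by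
      rw [← Finset.sum_sub_distrib]
      exact Finset.sum_congr rfl fun j _ => smul_sub _ _ _
    rw [e2]
    simp only [Algebra.smul_def, map_mul, map_ofNat]
    ring
  · refine (wnorm_add_le _ _).trans ?_
    rw [add_mul (b * (6 * α * ρ + 3 * ρ ^ 2)) δ (wnorm (Y - Y'))]
    refine add_le_add ?_ ?_
    · rw [wnorm_smul, abs_of_nonneg hb, mul_assoc]
      refine mul_le_mul_of_nonneg_left ?_ hb
      rw [← add_mul]
      refine (wnorm_mul_le _ _).trans (mul_le_mul_of_nonneg_right ?_ hN)
      have hs : wnorm (Y + Y') ≤ 2 * ρ := (wnorm_add_le Y Y').trans (by linarith)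
      have h1 : wnorm ((3 : ℝ) • (U * (Y + Y'))) ≤ 6 * α * ρ := by
        rw [wnorm_smul]
        have := (wnorm_mul_le U (Y + Y')).trans (mul_le_mul hU hs (wnorm_nonneg _) hα)
        rw [abs_of_pos (by norm_num : (0 : ℝ) < 3)]
        linarith
      have hm : ∀ {A B : WavePoly}, wnorm A ≤ ρ → wnorm B ≤ ρ → wnorm (A * B) ≤ ρ ^ 2 := by
        intro A B hA hB
        rw [sq]
        exact (wnorm_mul_le _ _).trans (mul_le_mul hA hB (wnorm_nonneg _) hρ0)
      have h2 := wnorm_add_le (Y * Y) (Y * Y')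
      have h3 := wnorm_add_le (Y * Y + Y * Y') (Y' * Y')
      have h4 := wnorm_add_le ((3 : ℝ) • (U * (Y + Y'))) (Y * Y + Y * Y' + Y' * Y')
      have h5 := hm hY hY
      have h6 := hm hY hY'
      have h7 := hm hY' hY'
      linarith
    · refine (wnorm_sum_le _ _).trans ?_
      refine le_trans ?_ (mul_le_mul_of_nonneg_right hδ hN)
      rw [Finset.sum_mul]
      refine Finset.sum_le_sum fun j _ => ?_
      rw [wnorm_smul]
      have h1 : wnorm (U + Y) ≤ α + 1 := (wnorm_add_le U Y).trans (by linarith)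
      have h2 : wnorm (U + Y') ≤ α + 1 := (wnorm_add_le U Y').trans (by linarith)
      have h3 := mul_le_mul_of_nonneg_left (wnorm_pow_sub_pow_le h1 h2 j) (abs_nonneg (β j))
      rw [add_sub_add_left_eq_sub] at h3
      linarith

theorem resid_sub {ε r b : ℝ} {J : Finset ℕ} {β : ℕ → ℝ} {X X' Q : WavePoly}
    (h : nonlin b J β X - nonlin b J β X' = quad * (X - X') + Q) :
    resid ε r b J β X - resid ε r b J β X' = diag (symb ε) (X - X') -
      AddMonoidAlgebra.single (1, 1) r * diag raise (X - X') + r • (quad * (X - X') + Q) := by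
  have e : ∀ w, diag w (X - X') = diag w X - diag w X' := fun w => by
    rw [eq_sub_iff_add_eq, ← diag_add, sub_add_cancel]
  rw [← h, e, e, resid, resid, smul_sub, mul_sub]
  abel

theorem coeff_quad_mul (X : WavePoly) (b : ℕ) : (quad * X).coeff (b + 2, b + 1) =
    2 * X.coeff (b, b + 1) + 4 * X.coeff (b + 1, b) +
      if b = 0 then 0 else 2 * X.coeff (b + 2, b - 1) := by
  rw [quad, add_mul, add_mul, AddMonoidAlgebra.coeff_add, AddMonoidAlgebra.coeff_add,
    Finsupp.add_apply, Finsupp.add_apply]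
  congr 1
  · congr 1
    · exact coeff_shift 2 X b (b + 1) 2 0
    · exact coeff_shift 4 X (b + 1) b 1 1
  · rcases b with _ | b
    · rw [if_pos rfl]
      exact coeff_shift_of_lt _ _ (by omega)
    · rw [if_neg (by omega)]
      exact coeff_shift 2 X (b + 3) b 0 2

end WavePoly

namespace WavePoly

/-- The diagonal of the linearization in frequency one. -/
def dg (b : ℕ) : ℝ := (2 * b + 1) * (2 * b + 2) - 6

theorem four_le_abs_dg (b : ℕ) : 4 ≤ |dg b| := by
  rcases b with _ | b
  · norm_num [dg]
  · rw [dg, abs_of_nonneg] <;> push_cast <;> nlinarith [(Nat.cast_nonneg b : (0 : ℝ) ≤ b)]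

theorem sq_sub_one_le_abs_dg (b : ℕ) : (2 * (b : ℝ) + 3) ^ 2 - 1 ≤ 4 * |dg b| := by
  rcases b with _ | b
  · norm_num [dg]
  · rw [dg, abs_of_nonneg] <;> push_cast <;> nlinarith [(Nat.cast_nonneg b : (0 : ℝ) ≤ b)]

theorem seven_le_symb {ε : ℝ} (hε : ε ^ 2 ≤ 1 / 9) {j : ℕ} (hj : j ≠ 0) (b : ℕ) :
    7 ≤ symb ε (b + 2 * j + 1, b) := by
  have : (1 : ℝ) ≤ j := by exact_mod_cast Nat.one_le_iff_ne_zero.2 hj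
  simp only [symb]
  push_cast
  have h1 : 0 ≤ ((b : ℝ) + 2 * j + 1 + b) ^ 2 * ε ^ 2 := by positivity
  have h2 : (9 : ℝ) ≤ ((b : ℝ) + 2 * j + 1 - b) ^ 2 := by nlinarith
  nlinarith

theorem coeff_lin_zero {ε : ℝ} {X : WavePoly} (hX : swap X = X) (Q : WavePoly) (b : ℕ) :
    (diag (symb ε) X - AddMonoidAlgebra.single (1, 1) (64 * ε ^ 2) * diag raise X +
      (64 * ε ^ 2) • (quad * X + Q)).coeff (b + 2, b + 1) = 64 * ε ^ 2 *
      (((2 * (b : ℝ) + 3) ^ 2 - 1) / 64 * X.coeff (b + 2, b + 1) - dg b * X.coeff (b + 1, b) +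
        (if b = 0 then 0 else 2 * X.coeff (b + 2, b - 1)) + Q.coeff (b + 2, b + 1)) := by
  simp only [AddMonoidAlgebra.coeff_smul, AddMonoidAlgebra.coeff_add, Finsupp.smul_apply,
    Finsupp.add_apply, smul_eq_mul, AddMonoidAlgebra.coeff_sub, Finsupp.sub_apply, coeff_quad_mul]
  rw [show ((b + 2, b + 1) : ℕ × ℕ) = ((b + 1) + 1, b + 1) from rfl, coeff_shift, coeff_diag,
    coeff_diag]
  have : X.coeff (b, b + 1) = X.coeff (b + 1, b) := by rw [← coeff_swap, hX]
  rw [this]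
  simp only [symb, raise, dg]
  push_cast
  ring

theorem coeff_lin_pos {ε r : ℝ} (X Q : WavePoly) (j b : ℕ) :
    (diag (symb ε) X - AddMonoidAlgebra.single (1, 1) r * diag raise X +
      r • (quad * X + Q)).coeff (b + 2 * j + 1, b) =
      symb ε (b + 2 * j + 1, b) * X.coeff (b + 2 * j + 1, b) -
        (if b = 0 then 0 else r * (raise (b + 2 * j, b - 1) * X.coeff (b + 2 * j, b - 1))) +
        r * (quad * X + Q).coeff (b + 2 * j + 1, b) := by
  simp only [AddMonoidAlgebra.coeff_smul, AddMonoidAlgebra.coeff_add, Finsupp.smul_apply,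
    Finsupp.add_apply, smul_eq_mul, AddMonoidAlgebra.coeff_sub, Finsupp.sub_apply]
  rw [coeff_diag]
  congr 2
  rcases b with _ | b
  · rw [if_pos rfl]
    exact coeff_shift_of_lt _ _ (by omega)
  · rw [if_neg (by omega), show b + 1 + 2 * j + 1 = (b + 2 * j + 1) + 1 by ring, coeff_shift,
      coeff_diag]
    rw [show b + 1 + 2 * j = b + 2 * j + 1 by ring]
    rfl

/-- The monomial whose coefficient determines the unknown of index `i`. -/
def tgt (i : ℕ × ℕ) : ℕ × ℕ := if i.1 = 0 then (i.2 + 2, i.2 + 1) else (i.2 + 2 * i.1 + 1, i.2)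

/-- The factor of the unknown of index `i` in the equation of index `tgt i`. -/
def den (ε : ℝ) (i : ℕ × ℕ) : ℝ :=
  if i.1 = 0 then 64 * ε ^ 2 * dg i.2 else -(symb ε (i.2 + 2 * i.1 + 1, i.2) / 8)

theorem tgt_injOn_zero (s : Finset (ℕ × ℕ)) : Set.InjOn tgt (s.filter fun i => i.1 = 0) := by
  rintro ⟨i1, i2⟩ hi ⟨j1, j2⟩ hj h
  simp only [Finset.coe_filter, Set.mem_ofPred_eq] at hi hj
  have h1 : i1 = 0 := hi.2
  have h2 : j1 = 0 := hj.2
  simp only [tgt, h1, h2, eq_self, if_true, Prod.mk.injEq, true_and] at h ⊢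
  omega

theorem tgt_injOn_pos (s : Finset (ℕ × ℕ)) : Set.InjOn tgt (s.filter fun i => ¬ i.1 = 0) := by
  rintro ⟨i1, i2⟩ hi ⟨j1, j2⟩ hj h
  simp only [Finset.coe_filter, Set.mem_ofPred_eq] at hi hj
  have h1 : ¬ i1 = 0 := hi.2
  have h2 : ¬ j1 = 0 := hj.2
  simp only [tgt, h1, h2, if_false, Prod.mk.injEq] at h ⊢
  omega

theorem box_contraction {ε : ℝ} (hε : 0 < ε) {κ : ℝ} (hκ : κ ≤ 1 / 8)
    (hr : 64 * ε ^ 2 ≤ 1 / 200) {M : ℕ} (hM : (4 * (M : ℝ) + 1) ^ 2 * (64 * ε ^ 2) ≤ 1)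
    (d : ℕ × ℕ → ℝ) {Q : WavePoly} (hQ : wnorm Q ≤ κ * wnorm (toW (box M) d)) :
    ∑ i ∈ box M, |d i + (diag (symb ε) (toW (box M) d) -
      AddMonoidAlgebra.single (1, 1) (64 * ε ^ 2) * diag raise (toW (box M) d) +
      (64 * ε ^ 2) • (quad * toW (box M) d + Q)).coeff (tgt i) / den ε i| ≤
      1 / 2 * ∑ i ∈ box M, |d i| := by
  set X := toW (box M) d with hXdef
  set S := ∑ i ∈ box M, |d i| with hS
  have hS0 : 0 ≤ S := Finset.sum_nonneg fun _ _ => abs_nonneg _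
  have hX : wnorm X ≤ 2 * S := wnorm_toW_le _ _
  have hQ0 := wnorm_nonneg Q
  have hX0 := wnorm_nonneg X
  have hQS : wnorm Q ≤ 1 / 4 * S := by nlinarith
  have hr0 : 0 < 64 * ε ^ 2 := by positivity
  rw [← Finset.sum_filter_add_sum_filter_not (box M) fun i => i.1 = 0]
  have hz : ∑ i ∈ (box M).filter (fun i => i.1 = 0), |d i + (diag (symb ε) X -
      AddMonoidAlgebra.single (1, 1) (64 * ε ^ 2) * diag raise X +
      (64 * ε ^ 2) • (quad * X + Q)).coeff (tgt i) / den ε i| ≤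
      1 / 16 * S + 1 / 2 * (1 / 8 * S) + 1 / 4 * wnorm Q := by
    have h1 : ∑ i ∈ (box M).filter (fun i => i.1 = 0), |X.coeff (i.2 + 2, i.2 + 1)| ≤ 1 * S := by
      refine sum_coeff_toW_le (g := fun i : ℕ × ℕ => (0, i.2 + 1)) ?_ zero_le_one
        fun i _ => wt_le_one _
      rintro ⟨i1, i2⟩ hi ⟨j1, j2⟩ hj h
      simp only [Finset.coe_filter, Set.mem_ofPred_eq, Prod.mk.injEq] at hi hj h ⊢
      omega
    have h2 : ∑ i ∈ (box M).filter (fun i => i.1 = 0),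
        (if i.2 = 0 then 0 else |X.coeff (i.2 + 2, i.2 - 1)|) ≤ 1 / 8 * S := by
      rw [Finset.sum_ite, Finset.sum_const_zero, zero_add]
      refine le_trans (Finset.sum_le_sum fun i hi => ?_)
        (sum_coeff_toW_le (S := ((box M).filter (fun i => i.1 = 0)).filter fun i => ¬ i.2 = 0)
        (g := fun i : ℕ × ℕ => (1, i.2 - 1)) ?_ (by norm_num) fun i _ => by simp [wt])
      · simp only [Finset.mem_filter] at hi
        dsimp only
        rw [show i.2 - 1 + 2 * 1 + 1 = i.2 + 2 by omega]
      · rintro ⟨i1, i2⟩ hi ⟨j1, j2⟩ hj h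
        simp only [Finset.coe_filter, Set.mem_ofPred_eq, Prod.mk.injEq, Finset.mem_filter] at hi hj h ⊢
        omega
    have h3 := sum_abs_coeff_le Q _ tgt (tgt_injOn_zero (box M))
    refine le_trans (Finset.sum_le_sum (g := fun i : ℕ × ℕ => 1 / 16 * |X.coeff (i.2 + 2, i.2 + 1)| +
      1 / 2 * (if i.2 = 0 then 0 else |X.coeff (i.2 + 2, i.2 - 1)|) + 1 / 4 * |Q.coeff (tgt i)|)
      fun i hi => ?_) ?_
    · obtain ⟨i1, b⟩ := i
      simp only [Finset.mem_filter] at hi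
      obtain ⟨hi, rfl⟩ := hi
      simp only [tgt, den, if_true]
      rw [coeff_lin_zero (swap_toW _ _)]
      have e : X.coeff (b + 1, b) = d (0, b) := by
        have := coeff_toW (box M) d 0 b
        rw [if_pos hi, wt, if_pos rfl, one_mul] at this
        exact this
      have hd4 := four_le_abs_dg b
      have hdq := sq_sub_one_le_abs_dg b
      have hd0 : dg b ≠ 0 := fun h => by rw [h, abs_zero] at hd4; norm_num at hd4
      rw [e, mul_div_mul_left _ _ hr0.ne']
      set A := X.coeff (b + 2, b + 1)
      set q := Q.coeff (b + 2, b + 1)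
      have : d (0, b) + (((2 * (b : ℝ) + 3) ^ 2 - 1) / 64 * A - dg b * d (0, b) +
          (if b = 0 then 0 else 2 * X.coeff (b + 2, b - 1)) + q) / dg b =
          (((2 * (b : ℝ) + 3) ^ 2 - 1) / 64 * A +
          (if b = 0 then 0 else 2 * X.coeff (b + 2, b - 1)) + q) / dg b := by
        field_simp
        ring
      rw [this, abs_div, div_le_iff₀ (by linarith)]
      refine (abs_add_le _ _).trans ?_
      rw [add_mul]
      refine add_le_add ((abs_add_le _ _).trans ?_) (by nlinarith [abs_nonneg q])
      rw [add_mul]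
      refine add_le_add ?_ ?_
      · rw [abs_mul, abs_of_nonneg (by nlinarith [(Nat.cast_nonneg b : (0 : ℝ) ≤ b)])]
        nlinarith [abs_nonneg A]
      · split_ifs
        · simp
        · rw [abs_mul, abs_two]
          nlinarith [abs_nonneg (X.coeff (b + 2, b - 1))]
    · rw [Finset.sum_add_distrib, Finset.sum_add_distrib, ← Finset.mul_sum, ← Finset.mul_sum,
        ← Finset.mul_sum]
      linarith
  have hp : ∑ i ∈ (box M).filter (fun i => ¬ i.1 = 0), |d i + (diag (symb ε) X -
      AddMonoidAlgebra.single (1, 1) (64 * ε ^ 2) * diag raise X +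
      (64 * ε ^ 2) • (quad * X + Q)).coeff (tgt i) / den ε i| ≤
      8 / 7 * (1 / 8 * S) + 8 / 7 * (64 * ε ^ 2) * wnorm (quad * X + Q) := by
    have h2 : ∑ i ∈ (box M).filter (fun i => ¬ i.1 = 0),
        (if i.2 = 0 then 0 else |X.coeff (i.2 + 2 * i.1, i.2 - 1)|) ≤ 1 / 8 * S := by
      rw [Finset.sum_ite, Finset.sum_const_zero, zero_add]
      refine le_trans (Finset.sum_le_sum fun i hi => ?_)
        (sum_coeff_toW_le (S := ((box M).filter (fun i => ¬ i.1 = 0)).filter fun i => ¬ i.2 = 0)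
        (g := fun i : ℕ × ℕ => (i.1, i.2 - 1)) ?_ (by norm_num) fun i hi => ?_)
      · simp only [Finset.mem_filter] at hi
        dsimp only
        rw [show i.2 - 1 + 2 * i.1 + 1 = i.2 + 2 * i.1 by omega]
      · rintro ⟨i1, i2⟩ hi ⟨j1, j2⟩ hj h
        simp only [Finset.coe_filter, Set.mem_ofPred_eq, Prod.mk.injEq, Finset.mem_filter] at hi hj h ⊢
        omega
      · simp only [Finset.mem_filter] at hi
        simp [wt, hi.1.2]
    have h3 := sum_abs_coeff_le (quad * X + Q) _ tgt (tgt_injOn_pos (box M))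
    refine le_trans (Finset.sum_le_sum (g := fun i : ℕ × ℕ =>
      8 / 7 * (if i.2 = 0 then 0 else |X.coeff (i.2 + 2 * i.1, i.2 - 1)|) +
      8 / 7 * (64 * ε ^ 2) * |(quad * X + Q).coeff (tgt i)|) fun i hi => ?_) ?_
    · obtain ⟨j, b⟩ := i
      simp only [Finset.mem_filter] at hi
      obtain ⟨hi, hj⟩ := hi
      simp only [tgt, den, if_neg hj]
      rw [coeff_lin_pos]
      have e : X.coeff (b + 2 * j + 1, b) = 1 / 8 * d (j, b) := by
        have := coeff_toW (box M) d j b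
        rw [if_pos hi, wt, if_neg hj] at this
        exact this
      have h7 : 7 ≤ symb ε (b + 2 * j + 1, b) := seven_le_symb (by linarith) hj b
      rw [e]
      set q := (quad * X + Q).coeff (b + 2 * j + 1, b)
      set σ := symb ε (b + 2 * j + 1, b)
      have hσ : σ ≠ 0 := by positivity
      set P := (if b = 0 then 0 else
        64 * ε ^ 2 * (raise (b + 2 * j, b - 1) * X.coeff (b + 2 * j, b - 1))) with hP
      have hPb : |P| ≤ if b = 0 then 0 else |X.coeff (b + 2 * j, b - 1)| := by
        rw [hP]
        split_ifs with hb
        · simp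
        · rw [← mul_assoc, abs_mul]
          refine mul_le_of_le_one_left (abs_nonneg _) ?_
          obtain ⟨b, rfl⟩ := Nat.exists_eq_succ_of_ne_zero hb
          rw [mem_box] at hi
          have k1 : (j : ℝ) ≤ M := by exact_mod_cast hi.1
          have k2 : (b : ℝ) + 1 ≤ M := by exact_mod_cast hi.2
          simp only [raise]
          push_cast
          rw [abs_of_nonneg (by positivity)]
          refine le_trans ?_ hM
          rw [mul_comm]
          refine mul_le_mul_of_nonneg_right ?_ hr0.le
          rw [sq]
          refine mul_le_mul ?_ ?_ (by positivity) (by positivity) <;> linarith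
      have : d (j, b) + (σ * (1 / 8 * d (j, b)) - P + 64 * ε ^ 2 * q) / -(σ / 8) =
          8 * (P - 64 * ε ^ 2 * q) / σ := by
        field_simp
        ring
      rw [this, abs_div, abs_of_pos (by linarith : 0 < σ), div_le_iff₀ (by linarith), abs_mul]
      have k1 : |P - 64 * ε ^ 2 * q| ≤ |P| + 64 * ε ^ 2 * |q| := by
        refine (abs_sub _ _).trans ?_
        rw [abs_mul, abs_of_pos hr0]
      have k2 : 0 ≤ 64 * ε ^ 2 * |q| := by positivity
      rw [show |(8 : ℝ)| = 8 by norm_num]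
      set Z := (if b = 0 then 0 else |X.coeff (b + 2 * j, b - 1)|)
      have k3 : 0 ≤ Z := (abs_nonneg _).trans hPb
      nlinarith
    · rw [Finset.sum_add_distrib, ← Finset.mul_sum, ← Finset.mul_sum]
      refine add_le_add (by linarith) (mul_le_mul_of_nonneg_left h3 (by positivity))
  have hq : wnorm (quad * X + Q) ≤ 8 * (2 * S) + 1 / 4 * S := by
    refine (wnorm_add_le _ _).trans (add_le_add ?_ hQS)
    exact (wnorm_mul_le _ _).trans (mul_le_mul wnorm_quad_le hX hX0 (by norm_num))
  have hq0 := wnorm_nonneg (quad * X + Q)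
  nlinarith

theorem box_initial {ε : ℝ} (hε : 0 < ε) (hr : 64 * ε ^ 2 ≤ 1 / 200) {α : ℝ} (hα : 0 ≤ α) (M : ℕ)
    {R N : WavePoly}
    (hR : R = (64 * ε ^ 2) • (AddMonoidAlgebra.single (3, 0) (α / 3) +
      AddMonoidAlgebra.single (0, 3) (α / 3) + N)) :
    ∑ i ∈ box M, |R.coeff (tgt i) / den ε i| ≤ wnorm N / 2 + 2 * (64 * ε ^ 2) * α := by
  have hr0 : 0 < 64 * ε ^ 2 := by positivity
  have hN0 := wnorm_nonneg N
  rw [← Finset.sum_filter_add_sum_filter_not (box M) fun i => i.1 = 0]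
  set P : WavePoly := AddMonoidAlgebra.single (3, 0) (α / 3) +
      AddMonoidAlgebra.single (0, 3) (α / 3) + N with hP
  have hPn : wnorm P ≤ α + wnorm N := by
    refine (wnorm_add_le _ _).trans ?_
    have := wnorm_add_le (AddMonoidAlgebra.single (3, 0) (α / 3))
      (AddMonoidAlgebra.single (0, 3) (α / 3))
    rw [wnorm_single, wnorm_single, abs_of_nonneg (by positivity)] at this
    linarith
  have hz : ∑ i ∈ (box M).filter (fun i => i.1 = 0), |R.coeff (tgt i) / den ε i| ≤
      1 / 4 * wnorm N := by
    refine le_trans ?_ (mul_le_mul_of_nonneg_left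
      (sum_abs_coeff_le N _ tgt (tgt_injOn_zero (box M))) (by norm_num))
    rw [Finset.mul_sum]
    refine Finset.sum_le_sum fun i hi => ?_
    obtain ⟨i1, b⟩ := i
    simp only [Finset.mem_filter] at hi
    obtain ⟨hi, rfl⟩ := hi
    have hd4 := four_le_abs_dg b
    have e : P.coeff (b + 2, b + 1) = N.coeff (b + 2, b + 1) := by
      rw [hP]
      simp
    simp only [tgt, den, if_true]
    rw [hR, AddMonoidAlgebra.coeff_smul, Finsupp.smul_apply, smul_eq_mul,
      mul_div_mul_left _ _ hr0.ne', e, abs_div, div_le_iff₀ (by linarith)]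
    nlinarith [abs_nonneg (N.coeff (b + 2, b + 1))]
  have hp : ∑ i ∈ (box M).filter (fun i => ¬ i.1 = 0), |R.coeff (tgt i) / den ε i| ≤
      8 / 7 * (64 * ε ^ 2) * wnorm P := by
    refine le_trans ?_ (mul_le_mul_of_nonneg_left
      (sum_abs_coeff_le P _ tgt (tgt_injOn_pos (box M))) (by positivity))
    rw [Finset.mul_sum]
    refine Finset.sum_le_sum fun i hi => ?_
    obtain ⟨j, b⟩ := i
    simp only [Finset.mem_filter] at hi
    obtain ⟨hi, hj⟩ := hi
    have h7 : 7 ≤ symb ε (b + 2 * j + 1, b) := seven_le_symb (by linarith) hj b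
    simp only [tgt, den, if_neg hj]
    rw [hR, AddMonoidAlgebra.coeff_smul, Finsupp.smul_apply, smul_eq_mul, abs_div, abs_neg,
      abs_mul, abs_of_pos hr0,
      abs_of_pos (by linarith : 0 < symb ε (b + 2 * j + 1, b) / 8), div_le_iff₀ (by linarith)]
    have := mul_nonneg hr0.le (abs_nonneg (P.coeff (b + 2 * j + 1, b)))
    nlinarith
  nlinarith

theorem resid_lead {ε r b α : ℝ} (h : b * α ^ 2 = 8 / 3) (J : Finset ℕ) (β : ℕ → ℝ) :
    resid ε r b J β (lead α) = r • (AddMonoidAlgebra.single (3, 0) (α / 3) +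
      AddMonoidAlgebra.single (0, 3) (α / 3) + ∑ j ∈ J, β j • lead α ^ j) := by
  have e1 : diag (symb ε) (lead α) = 0 := by
    refine AddMonoidAlgebra.coeff_injective (Finsupp.ext fun i => ?_)
    rw [coeff_diag, lead, AddMonoidAlgebra.coeff_add, Finsupp.add_apply,
      AddMonoidAlgebra.coeff_single, AddMonoidAlgebra.coeff_single, Finsupp.single_apply,
      Finsupp.single_apply]
    by_cases h1 : i = (1, 0)
    · subst h1
      simp [symb]
    · by_cases h2 : i = (0, 1)
      · subst h2
        simp [symb]
      · simp [Ne.symm h1, Ne.symm h2]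
  have e2 : diag raise (lead α) = (2 : ℝ) • lead α := by
    refine AddMonoidAlgebra.coeff_injective (Finsupp.ext fun i => ?_)
    rw [coeff_diag, lead, AddMonoidAlgebra.coeff_smul, Finsupp.smul_apply,
      AddMonoidAlgebra.coeff_add, Finsupp.add_apply,
      AddMonoidAlgebra.coeff_single, AddMonoidAlgebra.coeff_single, Finsupp.single_apply,
      Finsupp.single_apply]
    by_cases h1 : i = (1, 0)
    · subst h1
      norm_num [raise]
    · by_cases h2 : i = (0, 1)
      · subst h2
        norm_num [raise]
      · simp [Ne.symm h1, Ne.symm h2]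
  have e3 : b • lead α ^ 3 = AddMonoidAlgebra.single (3, 0) (α / 3) +
      AddMonoidAlgebra.single (0, 3) (α / 3) +
      AddMonoidAlgebra.single (1, 1) 1 * ((2 : ℝ) • lead α) := by
    have : b • lead α ^ 3 = (3 * b) • lead α ^ 2 * ((3 : ℝ)⁻¹ • lead α) := by
      rw [smul_mul_smul_comm]
      congr 1
      ring
    rw [this, smul_lead_sq h, quad, lead]
    simp only [smul_add, AddMonoidAlgebra.smul_single, add_mul, mul_add,
      AddMonoidAlgebra.single_mul_single, smul_eq_mul, Prod.mk_add_mk]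
    norm_num
    rw [show 2 * (α / 2) = 4 * (1 / 3 * (α / 2)) + 2 * (1 / 3 * (α / 2)) by ring,
      show α / 3 = 2 * (1 / 3 * (α / 2)) by ring, AddMonoidAlgebra.single_add,
      AddMonoidAlgebra.single_add]
    abel
  rw [resid, e1, e2, nonlin, e3, zero_sub]
  have e4 : (AddMonoidAlgebra.single (1, 1) r : WavePoly) =
      r • AddMonoidAlgebra.single (1, 1) 1 := by
    rw [AddMonoidAlgebra.smul_single, smul_eq_mul, mul_one]
  rw [e4, smul_mul_assoc]
  simp only [smul_add]
  abel

theorem exists_formal {b α : ℝ} (hb : 0 < b) (hα : 0 < α) (h : b * α ^ 2 = 8 / 3) :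
    ∃ κ > 0, ∀ ε > 0, 64 * ε ^ 2 ≤ κ → ∀ M : ℕ, (4 * (M : ℝ) + 1) ^ 2 * (64 * ε ^ 2) ≤ 1 →
      ∀ (J : Finset ℕ) (β : ℕ → ℝ) (δ : ℝ), (∀ j ∈ J, 5 ≤ j ∧ j % 2 = 1) → δ ≤ κ →
      ∑ j ∈ J, |β j| * (α + 1) ^ j ≤ δ → ∑ j ∈ J, j * |β j| * (α + 1) ^ (j - 1) ≤ δ →
      ∃ Y : WavePoly, swap Y = Y ∧ DegGe 1 Y ∧
        (∀ a c, Y.coeff (a, c) ≠ 0 → a + c ≤ 4 * M + 1) ∧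
        wnorm Y ≤ 2 * δ + 8 * (64 * ε ^ 2) * α ∧ wnorm Y ≤ 1 ∧
        ∀ a c, a + c ≤ 2 * M + 1 →
          (resid ε (64 * ε ^ 2) b J β (lead α + Y)).coeff (a, c) = 0 := by
  set ρ : ℝ := min 1 (1 / (16 * (b * (6 * α + 3)))) with hρ
  have hρ0 : 0 < ρ := lt_min one_pos (by positivity)
  have hρ1 : ρ ≤ 1 := min_le_left _ _
  have hρb : b * (6 * α * ρ + 3 * ρ ^ 2) ≤ 1 / 16 := by
    have h1 : ρ ≤ 1 / (16 * (b * (6 * α + 3))) := min_le_right _ _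
    rw [le_div_iff₀ (by positivity)] at h1
    have h2 : b * (3 * ρ ^ 2) ≤ b * (3 * ρ) := by
      refine mul_le_mul_of_nonneg_left ?_ hb.le
      nlinarith
    nlinarith
  set κ : ℝ := min (1 / 200) (ρ / (4 * (1 + 4 * α))) with hκ
  have hκ1 : κ ≤ 1 / 200 := min_le_left _ _
  have hκ2 : κ * (4 * (1 + 4 * α)) ≤ ρ := by
    rw [← le_div_iff₀ (by positivity)]
    exact min_le_right _ _
  refine ⟨κ, lt_min (by norm_num) (by positivity), ?_⟩
  intro ε hε hr M hM J β δ hJ hδκ hδ1 hδ2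
  have hr0 : 0 < 64 * ε ^ 2 := by positivity
  have hδ0 : 0 ≤ δ := le_trans (Finset.sum_nonneg fun j _ => by positivity) hδ1
  set R : (ℕ × ℕ → ℝ) → WavePoly := fun y =>
    resid ε (64 * ε ^ 2) b J β (lead α + toW (box M) y) with hR
  set Γ : (ℕ × ℕ → ℝ) → ℕ × ℕ → ℝ := fun y i => y i + (R y).coeff (tgt i) / den ε i with hΓ
  have h0 : ∑ i ∈ box M, |Γ 0 i| ≤ δ / 2 + 2 * (64 * ε ^ 2) * α := by
    have e0 : R 0 = resid ε (64 * ε ^ 2) b J β (lead α) := by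
      have : toW (box M) 0 = 0 := by simp [toW]
      rw [hR]
      simp only [this, add_zero]
    have hN : wnorm (∑ j ∈ J, β j • lead α ^ j) ≤ δ := by
      refine (wnorm_sum_le _ _).trans (le_trans ?_ hδ1)
      refine Finset.sum_le_sum fun j _ => ?_
      rw [wnorm_smul]
      refine mul_le_mul_of_nonneg_left ((wnorm_pow_le _ _).trans ?_) (abs_nonneg _)
      exact pow_le_pow_left₀ (wnorm_nonneg _) ((wnorm_lead_le hα.le).trans (by linarith)) _
    have := box_initial hε (hr.trans hκ1) hα.le M (e0.trans (resid_lead h J β))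
    simp only [hΓ, Pi.zero_apply, zero_add]
    linarith
  obtain ⟨y, hy1, hy2, hy3⟩ := exists_fixed_of_l1_contraction (box M) Γ (η := ρ / 2)
    (h0.trans (by nlinarith)) (by
      intro y y' hy hy'
      have n1 : wnorm (toW (box M) y) ≤ ρ := (wnorm_toW_le _ _).trans (by linarith)
      have n2 : wnorm (toW (box M) y') ≤ ρ := (wnorm_toW_le _ _).trans (by linarith)
      obtain ⟨Q, hQ1, hQ2⟩ := nonlin_sub hb.le hα.le h hρ1 hδ2 n1 n2
      rw [toW_sub] at hQ2
      refine le_trans (le_of_eq ?_) (box_contraction hε (κ := b * (6 * α * ρ + 3 * ρ ^ 2) + δ)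
        (by linarith) (hr.trans hκ1) hM (fun i => y i - y' i) hQ2)
      refine Finset.sum_congr rfl fun i _ => ?_
      have e : R y - R y' = _ := resid_sub (ε := ε) (r := 64 * ε ^ 2)
        (show nonlin b J β (lead α + toW (box M) y) - nonlin b J β (lead α + toW (box M) y') =
          quad * ((lead α + toW (box M) y) - (lead α + toW (box M) y')) + Q by
            rw [hQ1, add_sub_add_left_eq_sub])
      rw [add_sub_add_left_eq_sub, toW_sub] at e
      rw [← e, AddMonoidAlgebra.coeff_sub, Finsupp.sub_apply]
      simp only [hΓ]
      congr 1
      ring)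
  refine ⟨toW (box M) y, swap_toW _ _, degGe_toW _ _, fun a c => coeff_toW_box_ne,
    (wnorm_toW_le _ _).trans (by linarith), (wnorm_toW_le _ _).trans (by linarith), ?_⟩
  have hX : DegGe 1 (lead α + toW (box M) y) := (degGe_lead α).add (degGe_toW _ _)
  have hd := degGe_resid (ε := ε) (r := 64 * ε ^ 2) (b := b) (β := β) hJ hX
  have hs : swap (resid ε (64 * ε ^ 2) b J β (lead α + toW (box M) y)) = _ :=
    swap_resid (by rw [map_add, swap_lead, swap_toW])
  have hden : ∀ i, den ε i ≠ 0 := by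
    rintro ⟨j, c⟩
    rw [den]
    split_ifs with hj
    · have hd4 := four_le_abs_dg c
      have hd0 : dg c ≠ 0 := fun h => by rw [h, abs_zero] at hd4; norm_num at hd4
      exact mul_ne_zero hr0.ne' hd0
    · have h7 : 7 ≤ symb ε (c + 2 * j + 1, c) := seven_le_symb (by linarith) hj c
      simp only
      linarith
  have hfix : ∀ i ∈ box M, (R y).coeff (tgt i) = 0 := by
    intro i hi
    have := hy3 i hi
    simp only [hΓ, add_eq_left, div_eq_zero_iff] at this
    exact this.resolve_right (hden i)
  have key : ∀ a c, c < a → a + c ≤ 2 * M + 1 → (R y).coeff (a, c) = 0 := by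
    intro a c hac hle
    by_contra hne
    have hpar := hd a c hne
    obtain ⟨j, rfl⟩ : ∃ j, a = c + 2 * j + 1 := ⟨(a - c) / 2, by omega⟩
    rcases Nat.eq_zero_or_pos j with rfl | hj
    · rcases c with _ | c
      · refine hne ?_
        have hn : (nonlin b J β (lead α + toW (box M) y)).coeff (1, 0) = 0 := by
          by_contra h1
          have := degGe_nonlin hJ hX 1 0 h1
          omega
        simp only [hR, resid, AddMonoidAlgebra.coeff_smul, AddMonoidAlgebra.coeff_add,
          Finsupp.smul_apply, Finsupp.add_apply, AddMonoidAlgebra.coeff_sub, Finsupp.sub_apply]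
        rw [coeff_diag, coeff_shift_of_lt _ _ (by omega), hn]
        simp [symb]
      · refine hne ?_
        have := hfix (0, c) (by rw [mem_box]; omega)
        simp only [tgt, if_true] at this
        exact this
    · refine hne ?_
      have := hfix (j, c) (by rw [mem_box]; omega)
      simp only [tgt, if_neg hj.ne'] at this
      exact this
  intro a c hac
  rcases lt_trichotomy c a with h1 | h1 | h1
  · exact key a c h1 hac
  · by_contra hne
    have := hd a c hne
    omega
  · rw [← coeff_swap, hs]
    exact key c a h1 (by omega)

end WavePoly

namespace WavePoly

/-- Evaluation at `s e^{iτ}` and `s e^{-iτ}`. -/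
def evHom (s τ : ℝ) : WavePoly →ₐ[ℝ] ℂ :=
  AddMonoidAlgebra.lift ℝ ℂ (ℕ × ℕ)
    { toFun := fun i => ((s : ℂ) ^ (i.toAdd.1 + i.toAdd.2)) *
        Complex.exp (((i.toAdd.1 : ℂ) - i.toAdd.2) * (τ * Complex.I))
      map_one' := by simp
      map_mul' := fun i j => by
        simp only [toAdd_mul, Prod.fst_add, Prod.snd_add]
        rw [mul_mul_mul_comm, ← pow_add, ← Complex.exp_add]
        push_cast
        congr 2 <;> ring }

theorem evHom_single (s τ : ℝ) (i : ℕ × ℕ) (c : ℝ) :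
    evHom s τ (AddMonoidAlgebra.single i c) =
      c * ((s : ℂ) ^ (i.1 + i.2) * Complex.exp (((i.1 : ℂ) - i.2) * (τ * Complex.I))) := by
  rw [evHom, AddMonoidAlgebra.lift_single, Complex.real_smul]
  rfl

/-- The real part of the evaluation. -/
def ev (s τ : ℝ) (X : WavePoly) : ℝ :=
  ∑ i ∈ X.coeff.support, X.coeff i * (s ^ (i.1 + i.2) * cos (((i.1 : ℝ) - i.2) * τ))

theorem ev_eq_sum {X : WavePoly} {S : Finset (ℕ × ℕ)} (h : X.coeff.support ⊆ S) (s τ : ℝ) :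
    ev s τ X = ∑ i ∈ S, X.coeff i * (s ^ (i.1 + i.2) * cos (((i.1 : ℝ) - i.2) * τ)) :=
  Finset.sum_subset h fun i _ hi => by rw [Finsupp.notMem_support_iff.1 hi, zero_mul]

theorem evHom_re (s τ : ℝ) (X : WavePoly) : (evHom s τ X).re = ev s τ X := by
  have : X = ∑ i ∈ X.coeff.support, AddMonoidAlgebra.single i (X.coeff i) := by
    conv_lhs => rw [← AddMonoidAlgebra.sum_coeff_single X]
    rfl
  conv_lhs => rw [this]
  rw [map_sum, Complex.re_sum, ev]
  refine Finset.sum_congr rfl fun i _ => ?_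
  rw [evHom_single, Complex.re_ofReal_mul, ← Complex.ofReal_pow, Complex.re_ofReal_mul]
  have : ((i.1 : ℂ) - i.2) * (τ * Complex.I) = ((((i.1 : ℝ) - i.2) * τ : ℝ) : ℂ) * Complex.I := by
    push_cast
    ring
  rw [this, Complex.exp_ofReal_mul_I_re]

theorem conj_evHom (s τ : ℝ) (X : WavePoly) :
    (starRingEnd ℂ) (evHom s τ X) = evHom s τ (swap X) := by
  have : X = ∑ i ∈ X.coeff.support, AddMonoidAlgebra.single i (X.coeff i) := by
    conv_lhs => rw [← AddMonoidAlgebra.sum_coeff_single X]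
    rfl
  rw [this, map_sum, map_sum, map_sum, map_sum]
  refine Finset.sum_congr rfl fun i _ => ?_
  obtain ⟨a, b⟩ := i
  rw [swap_single, evHom_single, evHom_single, map_mul, map_mul, ← Complex.exp_conj]
  simp only [map_pow, map_mul, map_sub, Complex.conj_ofReal, Complex.conj_I, map_natCast]
  rw [add_comm b a]
  congr 3
  ring

theorem evHom_eq {X : WavePoly} (hX : swap X = X) (s τ : ℝ) : evHom s τ X = (ev s τ X : ℂ) := by
  have h := conj_evHom s τ X
  rw [hX, Complex.conj_eq_iff_re, evHom_re] at h
  exact h.symm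

theorem ev_add (s τ : ℝ) (X Y : WavePoly) : ev s τ (X + Y) = ev s τ X + ev s τ Y := by
  rw [← evHom_re, ← evHom_re, ← evHom_re, map_add, Complex.add_re]

theorem ev_sub (s τ : ℝ) (X Y : WavePoly) : ev s τ (X - Y) = ev s τ X - ev s τ Y := by
  rw [← evHom_re, ← evHom_re, ← evHom_re, map_sub, Complex.sub_re]

theorem ev_smul (s τ c : ℝ) (X : WavePoly) : ev s τ (c • X) = c * ev s τ X := by
  rw [← evHom_re, ← evHom_re, map_smul, Complex.real_smul, Complex.re_ofReal_mul]

theorem ev_nonlin {b : ℝ} {J : Finset ℕ} {β : ℕ → ℝ} {X : WavePoly} (hX : swap X = X) (s τ : ℝ) :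
    ev s τ (nonlin b J β X) = b * ev s τ X ^ 3 + ∑ j ∈ J, β j * ev s τ X ^ j := by
  rw [← evHom_re, nonlin, map_add, map_smul, map_pow, map_sum, evHom_eq hX]
  simp only [map_smul, map_pow, evHom_eq hX, Complex.real_smul]
  norm_cast

theorem ev_single_one_mul (s τ r : ℝ) (X : WavePoly) :
    ev s τ (AddMonoidAlgebra.single (1, 1) r * X) = r * s ^ 2 * ev s τ X := by
  rw [← evHom_re, ← evHom_re, map_mul, evHom_single]
  simp only [Nat.cast_one, sub_self, zero_mul, Complex.exp_zero, mul_one]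
  norm_cast
  rw [← Complex.re_ofReal_mul]

theorem ev_diag (w : ℕ × ℕ → ℝ) (s τ : ℝ) (X : WavePoly) :
    ev s τ (diag w X) = ∑ i ∈ X.coeff.support,
      X.coeff i * (w i * (s ^ (i.1 + i.2) * cos (((i.1 : ℝ) - i.2) * τ))) := by
  rw [ev_eq_sum (S := X.coeff.support)]
  · refine Finset.sum_congr rfl fun i _ => ?_
    rw [coeff_diag]
    ring
  · intro i hi
    rw [Finsupp.mem_support_iff, coeff_diag] at hi
    exact Finsupp.mem_support_iff.2 (right_ne_zero_of_mul hi)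

theorem ev_lead (s τ α : ℝ) : ev s τ (lead α) = α * s * cos τ := by
  rw [← evHom_re, lead, map_add, Complex.add_re, evHom_re, evHom_re,
    ev_eq_sum (S := {(1, 0)}) (by
      rw [AddMonoidAlgebra.coeff_single]; exact Finsupp.support_single_subset),
    ev_eq_sum (S := {(0, 1)}) (by
      rw [AddMonoidAlgebra.coeff_single]; exact Finsupp.support_single_subset)]
  simp
  ring

/-- Evaluations at small amplitudes. -/
theorem abs_ev_weight_le {X : WavePoly} {N : ℕ} (hX : ∀ i, X.coeff i ≠ 0 → N ≤ i.1 + i.2)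
    {s C : ℝ} {g : ℕ × ℕ → ℝ} (hs : 0 ≤ s)
    (hg : ∀ i, X.coeff i ≠ 0 → |g i| * s ^ (i.1 + i.2 - N) ≤ C) :
    |∑ i ∈ X.coeff.support, X.coeff i * (g i * s ^ (i.1 + i.2))| ≤ wnorm X * (C * s ^ N) := by
  refine (Finset.abs_sum_le_sum_abs _ _).trans ?_
  rw [wnorm, Finsupp.sum, Finset.sum_mul]
  refine Finset.sum_le_sum fun i hi => ?_
  have hi' := Finsupp.mem_support_iff.1 hi
  rw [abs_mul]
  refine mul_le_mul_of_nonneg_left ?_ (abs_nonneg _)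
  rw [abs_mul, abs_of_nonneg (by positivity : 0 ≤ s ^ (i.1 + i.2))]
  have e : s ^ (i.1 + i.2) = s ^ (i.1 + i.2 - N) * s ^ N := by
    rw [← pow_add, Nat.sub_add_cancel (hX i hi')]
  rw [e, ← mul_assoc]
  exact mul_le_mul_of_nonneg_right (hg i hi') (by positivity)

theorem abs_ev_le {X : WavePoly} {N : ℕ} (hX : ∀ i, X.coeff i ≠ 0 → N ≤ i.1 + i.2)
    {s : ℝ} (hs : 0 ≤ s) (hs1 : s ≤ 1) (τ : ℝ) : |ev s τ X| ≤ wnorm X * s ^ N := by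
  have := abs_ev_weight_le hX (g := fun i => cos (((i.1 : ℝ) - i.2) * τ)) hs (C := 1)
    fun i _ => mul_le_one₀ (abs_cos_le_one _) (by positivity) (pow_le_one₀ hs hs1)
  rw [one_mul] at this
  refine le_trans (le_of_eq ?_) this
  rw [ev]
  congr 1
  exact Finset.sum_congr rfl fun i _ => by ring

theorem wnorm_resid_le {ε r b α δ : ℝ} {J : Finset ℕ} {β : ℕ → ℝ} (hε : ε ^ 2 ≤ 1) (hr : 0 ≤ r)
    (hr1 : r ≤ 1) (hb : 0 ≤ b) (hδ : ∑ j ∈ J, |β j| * (α + 1) ^ j ≤ δ) {X : WavePoly}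
    (hX : wnorm X ≤ α + 1) {N : ℕ} (hN : ∀ i, X.coeff i ≠ 0 → i.1 + i.2 ≤ N) :
    wnorm (resid ε r b J β X) ≤
      (3 * (α + 1) + b * (α + 1) ^ 3 + δ) * ((N : ℝ) + 1) ^ 2 := by
  have hX0 := wnorm_nonneg X
  have h1 : wnorm (diag (symb ε) X) ≤ 2 * ((N : ℝ) + 1) ^ 2 * (α + 1) := by
    refine (wnorm_diag_le (C := 2 * ((N : ℝ) + 1) ^ 2) fun i hi => ?_).trans (by gcongr)
    have h2 : (i.1 : ℝ) + i.2 ≤ N := by exact_mod_cast hN i hi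
    have h3 : (0 : ℝ) ≤ i.1 := Nat.cast_nonneg _
    have h4 : (0 : ℝ) ≤ i.2 := Nat.cast_nonneg _
    have h5 : ((i.1 : ℝ) + i.2) ^ 2 ≤ N ^ 2 := by gcongr
    have h6 : ((i.1 : ℝ) - i.2) ^ 2 ≤ N ^ 2 := by nlinarith
    have h7 := sq_nonneg ((i.1 : ℝ) - i.2)
    have h8 := sq_nonneg ((i.1 : ℝ) + i.2)
    have h9 := sq_nonneg ε
    rw [symb, abs_le]
    constructor <;> nlinarith [mul_nonneg h8 h9, mul_nonneg h7 (sub_nonneg.2 hε),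
      mul_le_mul_of_nonneg_right h5 h9, mul_le_mul_of_nonneg_right h6 (sub_nonneg.2 hε)]
  have h2 : wnorm (AddMonoidAlgebra.single (1, 1) r * diag raise X) ≤
      ((N : ℝ) + 1) ^ 2 * (α + 1) := by
    refine (wnorm_mul_le _ _).trans ?_
    rw [wnorm_single, abs_of_nonneg hr]
    refine (mul_le_of_le_one_left (wnorm_nonneg _) hr1).trans ?_
    refine (wnorm_diag_le (C := ((N : ℝ) + 1) ^ 2) fun i hi => ?_).trans (by gcongr)
    have h2 : (i.1 : ℝ) + i.2 ≤ N := by exact_mod_cast hN i hi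
    rw [raise, abs_of_nonneg (by positivity), sq]
    exact mul_le_mul (by linarith) (by linarith) (by positivity) (by positivity)
  have h3 : wnorm (nonlin b J β X) ≤ b * (α + 1) ^ 3 + δ := by
    refine (wnorm_add_le _ _).trans (add_le_add ?_ ?_)
    · rw [wnorm_smul, abs_of_nonneg hb]
      exact mul_le_mul_of_nonneg_left ((wnorm_pow_le _ _).trans (by gcongr)) hb
    · refine (wnorm_sum_le _ _).trans (le_trans (Finset.sum_le_sum fun j _ => ?_) hδ)
      rw [wnorm_smul]
      exact mul_le_mul_of_nonneg_left ((wnorm_pow_le _ _).trans (by gcongr)) (abs_nonneg _)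
  have h3' := wnorm_nonneg (nonlin b J β X)
  have h4 : wnorm (r • nonlin b J β X) ≤ b * (α + 1) ^ 3 + δ := by
    rw [wnorm_smul, abs_of_nonneg hr]
    exact (mul_le_of_le_one_left h3' hr1).trans h3
  have h5 := wnorm_add_le (diag (symb ε) X - AddMonoidAlgebra.single (1, 1) r * diag raise X)
    (r • nonlin b J β X)
  have h6 := wnorm_sub_le (diag (symb ε) X) (AddMonoidAlgebra.single (1, 1) r * diag raise X)
  have h7 : (1 : ℝ) ≤ ((N : ℝ) + 1) ^ 2 := one_le_pow₀ (by linarith [Nat.cast_nonneg (α := ℝ) N])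
  rw [resid]
  have h8 : 0 ≤ b * (α + 1) ^ 3 + δ := h3'.trans h3
  nlinarith

end WavePoly

/-- Taylor coefficients of an odd analytic function with vanishing derivative at the origin. -/
theorem exists_odd_powerSeries {f : ℝ → ℝ} (hodd : ∀ x, f (-x) = -f x) (hf : AnalyticAt ℝ f 0)
    (hf1 : deriv f 0 = 0) : ∃ (b : ℕ → ℝ) (ρ K : ℝ), 0 < ρ ∧ 0 < K ∧ (∀ n, |b n| * ρ ^ n ≤ K) ∧
      (∀ z, |z| < ρ → HasSum (fun n => b n * z ^ n) (f z)) ∧ (∀ n, n % 2 = 0 → b n = 0) ∧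
      b 1 = 0 ∧ b 3 = iteratedDeriv 3 f 0 / 6 := by
  have h := hf.hasFPowerSeriesAt
  rw [hasFPowerSeriesAt_iff, Metric.eventually_nhds_iff] at h
  obtain ⟨R, hR, h⟩ := h
  simp only [dist_zero_right, Real.norm_eq_abs, zero_add, FormalMultilinearSeries.coeff_ofScalars,
    smul_eq_mul] at h
  have hs : ∀ z, |z| < R →
      HasSum (fun n => iteratedDeriv n f 0 / (n.factorial : ℝ) * z ^ n) (f z) := by
    intro z hz
    simpa only [mul_comm] using h hz
  obtain ⟨K, hK⟩ : ∃ K, ∀ n, |iteratedDeriv n f 0 / (n.factorial : ℝ) * (R / 2) ^ n| ≤ K := by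
    have h1 := (hs (R / 2) (by rw [abs_of_pos] <;> linarith)).summable.tendsto_atTop_zero
    obtain ⟨K, hK⟩ := h1.abs.bddAbove_range
    exact ⟨K, fun n => hK ⟨n, rfl⟩⟩
  refine ⟨fun n => iteratedDeriv n f 0 / (n.factorial : ℝ), R / 2, |K| + 1, by positivity,
    by positivity, fun n => ?_, fun z hz => hs z (by linarith), fun n hn => ?_, ?_, ?_⟩
  · have := hK n
    rw [abs_mul, abs_of_nonneg (by positivity : (0 : ℝ) ≤ (R / 2) ^ n)] at this
    linarith [le_abs_self K]
  · have h1 := iteratedDeriv_comp_neg n f 0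
    simp only [hodd] at h1
    rw [iteratedDeriv_fun_neg, (Nat.even_iff.2 hn).neg_one_pow, one_smul, neg_zero] at h1
    have : iteratedDeriv n f 0 = 0 := by linarith
    simp [this]
  · simp [iteratedDeriv_one, hf1]
  · norm_num [Nat.factorial]

/-- Truncation error of a power series. -/
theorem abs_sub_sum_le_of_hasSum {b : ℕ → ℝ} {ρ K z y : ℝ} (hρ : 0 < ρ)
    (hb : ∀ n, |b n| * ρ ^ n ≤ K) (hz : |z| ≤ ρ / 2) (h : HasSum (fun n => b n * z ^ n) y) (N : ℕ) :
    |y - ∑ n ∈ Finset.range N, b n * z ^ n| ≤ 2 * K * (|z| / ρ) ^ N := by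
  have hK : 0 ≤ K := le_trans (by positivity) (hb 0)
  have h1 := (hasSum_nat_add_iff' N).2 h
  have hq : |z| / ρ ≤ 1 / 2 := by rw [div_le_iff₀ hρ]; linarith
  have hq0 : 0 ≤ |z| / ρ := by positivity
  have hg : HasSum (fun n => K * (|z| / ρ) ^ N * (1 / 2 : ℝ) ^ n) (K * (|z| / ρ) ^ N * 2) :=
    hasSum_geometric_two.mul_left _
  have := tsum_of_norm_bounded hg (f := fun n => b (n + N) * z ^ (n + N)) fun n => ?_
  · rw [h1.tsum_eq, Real.norm_eq_abs] at this
    linarith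
  · have h2 : ‖b (n + N) * z ^ (n + N)‖ = |b (n + N)| * ρ ^ (n + N) * (|z| / ρ) ^ (n + N) := by
      rw [Real.norm_eq_abs, abs_mul, abs_pow, div_pow]
      field_simp
    rw [h2, pow_add (|z| / ρ)]
    have h3 : (|z| / ρ) ^ n ≤ (1 / 2) ^ n := pow_le_pow_left₀ hq0 hq n
    calc _ ≤ K * ((1 / 2) ^ n * (|z| / ρ) ^ N) := by
          refine mul_le_mul (hb _) ?_ (by positivity) hK
          gcongr
      _ = _ := by ring

/-- The sums of the rescaled higher Taylor coefficients are small. -/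
theorem exists_sum_rescaled_le {b : ℕ → ℝ} {ρ K R : ℝ} (hρ : 0 < ρ) (hR : 1 ≤ R)
    (hb : ∀ n, |b n| * ρ ^ n ≤ K) : ∃ C > 0, ∀ r, 0 ≤ r → r * R ≤ ρ / 2 → ∀ J : Finset ℕ,
      (∀ j ∈ J, 5 ≤ j) → ∑ j ∈ J, j * |b j * r ^ (j - 3)| * R ^ j ≤ C * r := by
  have hK : 0 ≤ K := le_trans (by positivity) (hb 0)
  have hsum : Summable fun j : ℕ => (j : ℝ) ^ 1 * (1 / 2 : ℝ) ^ j :=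
    summable_pow_mul_geometric_of_norm_lt_one 1 (by norm_num)
  have ht0 : 0 ≤ ∑' j : ℕ, (j : ℝ) ^ 1 * (1 / 2 : ℝ) ^ j := tsum_nonneg fun j => by positivity
  refine ⟨16 * K / ρ ^ 4 * R ^ 4 * (∑' j : ℕ, (j : ℝ) ^ 1 * (1 / 2 : ℝ) ^ j) + 1, by positivity,
    ?_⟩
  intro r hr hrR J hJ
  have : ∀ j ∈ J, j * |b j * r ^ (j - 3)| * R ^ j ≤
      16 * K / ρ ^ 4 * R ^ 4 * r * ((j : ℝ) ^ 1 * (1 / 2 : ℝ) ^ j) := by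
    intro j hj
    obtain ⟨k, rfl⟩ : ∃ k, j = k + 4 := ⟨j - 4, by have := hJ j hj; omega⟩
    rw [show k + 4 - 3 = k + 1 by omega, abs_mul, abs_of_nonneg (by positivity : 0 ≤ r ^ (k + 1))]
    have h1 : (r * R / ρ) ^ k ≤ (1 / 2) ^ k :=
      pow_le_pow_left₀ (by positivity) (by rw [div_le_iff₀ hρ]; linarith) k
    have h2 : ((k + 4 : ℕ) : ℝ) * (|b (k + 4)| * r ^ (k + 1)) * R ^ (k + 4) =
        ((k + 4 : ℕ) : ℝ) * (|b (k + 4)| * ρ ^ (k + 4)) * (1 / ρ ^ 4 * R ^ 4 * r) *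
          (r * R / ρ) ^ k := by
      rw [div_pow, mul_pow]
      field_simp
      ring
    rw [h2]
    calc _ ≤ ((k + 4 : ℕ) : ℝ) * K * (1 / ρ ^ 4 * R ^ 4 * r) * (1 / 2) ^ k := by
          have := hb (k + 4)
          gcongr
      _ = _ := by
        rw [pow_add (1 / 2 : ℝ) k 4]
        ring
  refine (Finset.sum_le_sum this).trans ?_
  rw [← Finset.mul_sum]
  have h3 := hsum.sum_le_tsum J fun j _ => by positivity
  have : 0 ≤ 16 * K / ρ ^ 4 * R ^ 4 * r := by positivity
  nlinarith

/-- Integration of a pointwise power bound for the derivative. -/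
theorem abs_le_of_deriv_le_pow {g g' : ℝ → ℝ} {K r : ℝ} {n : ℕ} (hg : ∀ x, HasDerivAt g (g' x) x)
    (h0 : g 0 = 0) (h : ∀ x, |x| ≤ r → |g' x| ≤ K * |x| ^ n) {x : ℝ} (hx : |x| ≤ r) :
    |g x| ≤ K * |x| ^ (n + 1) := by
  have h1 : ∀ y ∈ Set.uIcc 0 x, ‖g' y‖ ≤ K * |x| ^ n := by
    intro y hy
    have hK : 0 ≤ K * |x| ^ n := (abs_nonneg _).trans (h x hx)
    have hyx : |y| ≤ |x| := by
      have := Set.abs_sub_left_of_mem_uIcc hy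
      simpa using this
    rcases eq_or_ne x 0 with rfl | hx0
    · have : y = 0 := by simpa using hyx
      subst this
      exact h 0 hx
    · have hK' : 0 ≤ K := nonneg_of_mul_nonneg_left hK (by positivity)
      refine (h y (hyx.trans hx)).trans ?_
      gcongr
  have := (convex_uIcc 0 x).norm_image_sub_le_of_norm_hasDerivWithin_le
    (fun y _ => (hg y).hasDerivWithinAt) h1 left_mem_uIcc right_mem_uIcc
  rw [h0, sub_zero, sub_zero, Real.norm_eq_abs, Real.norm_eq_abs] at this
  rw [pow_succ]
  linarith

/-- Local bounds for an odd analytic nonlinearity. -/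
theorem exists_local_bounds {f : ℝ → ℝ} (hodd : ∀ x, f (-x) = -f x)
    (hanal : ∀ x : ℝ, AnalyticAt ℝ f x) (hf1 : deriv f 0 = 0) :
    ∃ f' f'' : ℝ → ℝ, ∃ K > 0, (∀ x, HasDerivAt f (f' x) x) ∧ (∀ x, HasDerivAt f' (f'' x) x) ∧
      Continuous f'' ∧ (∀ x, f' (-x) = f' x) ∧ (∀ x, |x| ≤ 1 → |f'' x| ≤ K * |x|) ∧
      ∀ x, |x| ≤ 1 → |f' x - iteratedDeriv 3 f 0 / 2 * x ^ 2| ≤ K * |x| ^ 3 := by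
  have hf : ContDiff ℝ ⊤ f := contDiff_iff_contDiffAt.2 fun x => (hanal x).contDiffAt
  have hd : ∀ n x, HasDerivAt (iteratedDeriv n f) (iteratedDeriv (n + 1) f x) x := by
    intro n x
    rw [iteratedDeriv_succ]
    exact (hf.differentiable_iteratedDeriv n (WithTop.coe_lt_top _) x).hasDerivAt
  have hc : ∀ n, Continuous (iteratedDeriv n f) := fun n =>
    continuous_iff_continuousAt.2 fun x => (hd n x).continuousAt
  have hz : iteratedDeriv 2 f 0 = 0 := by
    have h1 := iteratedDeriv_comp_neg 2 f 0
    simp only [hodd] at h1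
    rw [iteratedDeriv_fun_neg, even_two.neg_one_pow, one_smul, neg_zero] at h1
    linarith
  obtain ⟨K₁, hK₁⟩ := (isCompact_Icc (a := (-1 : ℝ)) (b := 1)).exists_bound_of_continuousOn
    (hc 3).continuousOn
  obtain ⟨K₂, hK₂⟩ := (isCompact_Icc (a := (-1 : ℝ)) (b := 1)).exists_bound_of_continuousOn
    (hc 4).continuousOn
  set K := max (max K₁ K₂) 1
  have hk1 : K₁ ≤ K := (le_max_left _ _).trans (le_max_left _ _)
  have hk2 : K₂ ≤ K := (le_max_right _ _).trans (le_max_left _ _)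
  have b2 : ∀ x : ℝ, |x| ≤ 1 → |iteratedDeriv 2 f x| ≤ K * |x| ^ 1 := fun x hx =>
    abs_le_of_deriv_le_pow (n := 0) (hd 2) hz
      (fun y hy => by simpa using (hK₁ y (abs_le.1 hy)).trans hk1) hx
  set a := iteratedDeriv 3 f 0
  have c3 : ∀ x : ℝ, |x| ≤ 1 → |iteratedDeriv 3 f x - a| ≤ K * |x| ^ 1 := fun x hx =>
    abs_le_of_deriv_le_pow (n := 0) (fun x => (hd 3 x).sub_const a) (sub_self _)
      (fun y hy => by simpa using (hK₂ y (abs_le.1 hy)).trans hk2) hx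
  have c2 : ∀ x : ℝ, |x| ≤ 1 → |iteratedDeriv 2 f x - a * x| ≤ K * |x| ^ 2 := fun x hx =>
    abs_le_of_deriv_le_pow (n := 1)
      (fun x => (hd 2 x).sub (((hasDerivAt_id x).const_mul a).congr_deriv (mul_one a)))
      (by simp [hz]) c3 hx
  refine ⟨iteratedDeriv 1 f, iteratedDeriv 2 f, K, lt_of_lt_of_le one_pos (le_max_right _ _),
    fun x => ?_, hd 1, hc 2, fun x => ?_, fun x hx => by simpa using b2 x hx, fun x hx => ?_⟩
  · have := hd 0 x
    rwa [iteratedDeriv_zero] at this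
  · have h1 := iteratedDeriv_comp_neg 1 f x
    simp only [hodd] at h1
    rw [iteratedDeriv_fun_neg] at h1
    simp only [pow_one, neg_smul, one_smul] at h1
    linarith
  · exact abs_le_of_deriv_le_pow (n := 2)
      (fun x => ((hd 1 x).sub (((hasDerivAt_id x).pow 2).const_mul (a / 2))).congr_deriv
        (by simp; ring)) (by simp [hf1, iteratedDeriv_one]) c2 hx

theorem hasDerivAt_tanh_mul (ε x : ℝ) :
    HasDerivAt (fun x => tanh (ε * x)) (ε * (1 - tanh (ε * x) ^ 2)) x := by
  have hl : HasDerivAt (fun x => ε * x) ε x := ((hasDerivAt_id x).const_mul ε).congr_deriv (mul_one ε)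
  have hc : cosh (ε * x) ≠ 0 := (cosh_pos _).ne'
  have := (hl.sinh).div (hl.cosh) hc
  simp only [tanh_eq_sinh_div_cosh]
  refine this.congr_deriv ?_
  field_simp

theorem tanh_sq_eq (x : ℝ) : tanh x ^ 2 = 1 - 1 / cosh x ^ 2 := by
  have hc : cosh x ≠ 0 := (cosh_pos _).ne'
  rw [tanh_eq_sinh_div_cosh]
  field_simp
  linarith [cosh_sq x]

theorem abs_tanh_le_one (x : ℝ) : |tanh x| ≤ 1 := by
  rw [← sq_le_one_iff_abs_le_one, tanh_sq_eq]
  have : 0 ≤ 1 / cosh x ^ 2 := by positivity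
  linarith

/-- The profile of the leading term. -/
def prof (ε x : ℝ) : ℝ := 1 / (8 * cosh (ε * x))

theorem prof_pos (ε x : ℝ) : 0 < prof ε x := by
  have := cosh_pos (ε * x)
  rw [prof]
  positivity

theorem prof_le (ε x : ℝ) : prof ε x ≤ 1 / 8 := by
  have := one_le_cosh (ε * x)
  rw [prof]
  exact one_div_le_one_div_of_le (by norm_num) (by linarith)

theorem prof_le_exp (ε x : ℝ) : prof ε x ≤ 1 / 4 * exp (-(ε * x)) := by
  have h1 := cosh_pos (ε * x)
  have h2 : exp (ε * x) ≤ 2 * cosh (ε * x) := by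
    rw [cosh_eq]
    linarith [exp_pos (-(ε * x))]
  rw [prof, exp_neg, div_le_iff₀ (by positivity)]
  have h3 := exp_pos (ε * x)
  field_simp
  linarith

theorem hasDerivAt_prof_pow (ε : ℝ) (m : ℕ) (x : ℝ) :
    HasDerivAt (fun x => prof ε x ^ m) (-(m * ε) * (prof ε x ^ m * tanh (ε * x))) x := by
  have hl : HasDerivAt (fun x => ε * x) ε x := ((hasDerivAt_id x).const_mul ε).congr_deriv (mul_one ε)
  have hc : cosh (ε * x) ≠ 0 := (cosh_pos _).ne'
  have h1 : HasDerivAt (fun x => prof ε x) (-ε * (prof ε x * tanh (ε * x))) x := by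
    have := (hasDerivAt_const x (1 : ℝ)).div (hl.cosh.const_mul 8) (by positivity)
    refine this.congr_deriv ?_
    rw [prof, tanh_eq_sinh_div_cosh]
    field_simp
    ring
  refine (h1.pow m).congr_deriv ?_
  rcases m with _ | m
  · simp
  · simp only [Nat.add_sub_cancel, pow_succ]
    ring

theorem hasDerivAt_prof_pow_deriv (ε : ℝ) (m : ℕ) (x : ℝ) :
    HasDerivAt (fun x => -(m * ε) * (prof ε x ^ m * tanh (ε * x)))
      ((m * ε) ^ 2 * prof ε x ^ m - m * (m + 1) * (64 * ε ^ 2) * prof ε x ^ (m + 2)) x := by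
  refine (((hasDerivAt_prof_pow ε m x).mul (hasDerivAt_tanh_mul ε x)).const_mul
    (-(m * ε))).congr_deriv ?_
  have h1 : tanh (ε * x) ^ 2 = 1 - 64 * prof ε x ^ 2 := by
    have hc : cosh (ε * x) ≠ 0 := (cosh_pos _).ne'
    rw [tanh_sq_eq, prof]
    field_simp
    ring
  have : ∀ P τ : ℝ, -(m * ε) * (-(m * ε) * (P * τ) * τ + P * (ε * (1 - τ ^ 2))) =
      (m * ε) ^ 2 * (P * τ ^ 2) - m * ε ^ 2 * (P * (1 - τ ^ 2)) := fun P τ => by ring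
  rw [this, h1, pow_add]
  ring

/-- Finite sums of products are twice continuously differentiable. -/
theorem IsC2.sum_mul {ι : Type*} (s : Finset ι) (c : ι → ℝ) {g g' g'' k k' k'' : ι → ℝ → ℝ}
    (hg : ∀ i x, HasDerivAt (g i) (g' i x) x) (hg' : ∀ i x, HasDerivAt (g' i) (g'' i x) x)
    (cg : ∀ i, Continuous (g'' i)) (hk : ∀ i x, HasDerivAt (k i) (k' i x) x)
    (hk' : ∀ i x, HasDerivAt (k' i) (k'' i x) x) (ck : ∀ i, Continuous (k'' i)) :
    IsC2 (fun x t => ∑ i ∈ s, c i * (g i x * k i t)) (fun x t => ∑ i ∈ s, c i * (g' i x * k i t))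
      (fun x t => ∑ i ∈ s, c i * (g i x * k' i t)) (fun x t => ∑ i ∈ s, c i * (g'' i x * k i t))
      (fun x t => ∑ i ∈ s, c i * (g' i x * k' i t))
      (fun x t => ∑ i ∈ s, c i * (g i x * k'' i t)) := by
  have c1 : ∀ i, Continuous (g i) := fun i => continuous_iff_continuousAt.2 fun x => (hg i x).continuousAt
  have c2 : ∀ i, Continuous (g' i) := fun i => continuous_iff_continuousAt.2 fun x => (hg' i x).continuousAt
  have c3 : ∀ i, Continuous (k i) := fun i => continuous_iff_continuousAt.2 fun x => (hk i x).continuousAt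
  have c4 : ∀ i, Continuous (k' i) := fun i => continuous_iff_continuousAt.2 fun x => (hk' i x).continuousAt
  have cc : ∀ {a d : ι → ℝ → ℝ}, (∀ i, Continuous (a i)) → (∀ i, Continuous (d i)) →
      Continuous (Function.uncurry fun x t => ∑ i ∈ s, c i * (a i x * d i t)) := by
    intro a d ha hd
    exact continuous_finsetSum _ fun i _ => continuous_const.mul
      (((ha i).comp continuous_fst).mul ((hd i).comp continuous_snd))
  have hx : ∀ {a a' d : ι → ℝ → ℝ}, (∀ i x, HasDerivAt (a i) (a' i x) x) → ∀ x t,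
      HasDerivAt (fun y => ∑ i ∈ s, c i * (a i y * d i t)) (∑ i ∈ s, c i * (a' i x * d i t)) x := by
    intro a a' d ha x t
    exact HasDerivAt.fun_sum fun i _ => ((ha i x).mul_const (d i t)).const_mul (c i)
  have ht : ∀ {a d d' : ι → ℝ → ℝ}, (∀ i x, HasDerivAt (d i) (d' i x) x) → ∀ x t,
      HasDerivAt (fun y => ∑ i ∈ s, c i * (a i x * d i y)) (∑ i ∈ s, c i * (a i x * d' i t)) t := by
    intro a d d' hd x t
    exact HasDerivAt.fun_sum fun i _ => ((hd i t).const_mul (a i x)).const_mul (c i)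
  exact ⟨hx hg, ht hk, hx hg', ht hk, hx hg, ht hk', cc cg c3, cc c2 c4, cc c1 ck⟩

namespace WavePoly

/-- The trigonometric polynomial in `t` with powers of the profile as coefficients. -/
theorem isC2_ev (ε ω r : ℝ) (X : WavePoly) :
    IsC2 (fun x t => ∑ i ∈ X.coeff.support, (r * X.coeff i) *
        (prof ε x ^ (i.1 + i.2) * cos (((i.1 : ℝ) - i.2) * (ω * t - π / 2))))
      (fun x t => ∑ i ∈ X.coeff.support, (r * X.coeff i) *
        ((-(((i.1 + i.2 : ℕ) : ℝ) * ε) * (prof ε x ^ (i.1 + i.2) * tanh (ε * x))) *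
          cos (((i.1 : ℝ) - i.2) * (ω * t - π / 2))))
      (fun x t => ∑ i ∈ X.coeff.support, (r * X.coeff i) * (prof ε x ^ (i.1 + i.2) *
        (-(((i.1 : ℝ) - i.2) * ω) * sin (((i.1 : ℝ) - i.2) * (ω * t - π / 2)))))
      (fun x t => ∑ i ∈ X.coeff.support, (r * X.coeff i) *
        (((((i.1 + i.2 : ℕ) : ℝ) * ε) ^ 2 * prof ε x ^ (i.1 + i.2) -
          ((i.1 + i.2 : ℕ) : ℝ) * (((i.1 + i.2 : ℕ) : ℝ) + 1) * (64 * ε ^ 2) *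
            prof ε x ^ (i.1 + i.2 + 2)) * cos (((i.1 : ℝ) - i.2) * (ω * t - π / 2))))
      (fun x t => ∑ i ∈ X.coeff.support, (r * X.coeff i) *
        ((-(((i.1 + i.2 : ℕ) : ℝ) * ε) * (prof ε x ^ (i.1 + i.2) * tanh (ε * x))) *
        (-(((i.1 : ℝ) - i.2) * ω) * sin (((i.1 : ℝ) - i.2) * (ω * t - π / 2)))))
      (fun x t => ∑ i ∈ X.coeff.support, (r * X.coeff i) * (prof ε x ^ (i.1 + i.2) *
        (-(((i.1 : ℝ) - i.2) * ω) ^ 2 * cos (((i.1 : ℝ) - i.2) * (ω * t - π / 2))))) := by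
  have hl : ∀ (i : ℕ × ℕ) (t : ℝ), HasDerivAt (fun t => ((i.1 : ℝ) - i.2) * (ω * t - π / 2))
      (((i.1 : ℝ) - i.2) * ω) t := by
    intro i t
    exact ((((hasDerivAt_id t).const_mul ω).sub_const (π / 2)).const_mul _).congr_deriv (by simp)
  have hcp : Continuous (prof ε) := continuous_iff_continuousAt.2 fun x => by
    simpa using (hasDerivAt_prof_pow ε 1 x).continuousAt
  refine IsC2.sum_mul (X.coeff.support) (fun i => r * X.coeff i)
    (g := fun i x => prof ε x ^ (i.1 + i.2))
    (g' := fun i x => -(((i.1 + i.2 : ℕ) : ℝ) * ε) * (prof ε x ^ (i.1 + i.2) * tanh (ε * x)))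
    (g'' := fun i x => (((i.1 + i.2 : ℕ) : ℝ) * ε) ^ 2 * prof ε x ^ (i.1 + i.2) -
          ((i.1 + i.2 : ℕ) : ℝ) * (((i.1 + i.2 : ℕ) : ℝ) + 1) * (64 * ε ^ 2) *
            prof ε x ^ (i.1 + i.2 + 2))
    (k := fun i t => cos (((i.1 : ℝ) - i.2) * (ω * t - π / 2)))
    (k' := fun i t => -(((i.1 : ℝ) - i.2) * ω) * sin (((i.1 : ℝ) - i.2) * (ω * t - π / 2)))
    (k'' := fun i t => -(((i.1 : ℝ) - i.2) * ω) ^ 2 * cos (((i.1 : ℝ) - i.2) * (ω * t - π / 2)))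
    (fun i x => hasDerivAt_prof_pow ε _ x) (fun i x => hasDerivAt_prof_pow_deriv ε _ x)
    (fun i => by fun_prop) (fun i t => (hl i t).cos.congr_deriv (by ring))
    (fun i t => ((hl i t).sin.const_mul _).congr_deriv (by ring)) (fun i => by fun_prop)

/-- The residual of the wave equation at a trigonometric polynomial. -/
theorem ev_linear {ε ω : ℝ} (hω : ω ^ 2 = 1 - ε ^ 2) (r : ℝ) (X : WavePoly) (x t : ℝ) :
    (∑ i ∈ X.coeff.support, (r * X.coeff i) *
        (((((i.1 + i.2 : ℕ) : ℝ) * ε) ^ 2 * prof ε x ^ (i.1 + i.2) -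
          ((i.1 + i.2 : ℕ) : ℝ) * (((i.1 + i.2 : ℕ) : ℝ) + 1) * (64 * ε ^ 2) *
            prof ε x ^ (i.1 + i.2 + 2)) * cos (((i.1 : ℝ) - i.2) * (ω * t - π / 2)))) -
      (∑ i ∈ X.coeff.support, (r * X.coeff i) * (prof ε x ^ (i.1 + i.2) *
        (-(((i.1 : ℝ) - i.2) * ω) ^ 2 * cos (((i.1 : ℝ) - i.2) * (ω * t - π / 2))))) -
      r * ev (prof ε x) (ω * t - π / 2) X =
    r * (ev (prof ε x) (ω * t - π / 2) (diag (symb ε) X -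
      AddMonoidAlgebra.single (1, 1) (64 * ε ^ 2) * diag raise X)) := by
  rw [ev_sub, ev_single_one_mul, ev_diag, ev_diag, ev, Finset.mul_sum, Finset.mul_sum,
    ← Finset.sum_sub_distrib, ← Finset.sum_sub_distrib, ← Finset.sum_sub_distrib, Finset.mul_sum]
  refine Finset.sum_congr rfl fun i _ => ?_
  simp only [symb, raise, ← hω]
  push_cast
  ring

end WavePoly

namespace WavePoly

theorem mul_pow_pred_le_one {s : ℝ} (hs : 0 ≤ s) (hs1 : s ≤ 1 / 8) {m : ℕ} (hm : 1 ≤ m) :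
    (m : ℝ) * s ^ (m - 1) ≤ 1 := by
  obtain ⟨n, rfl⟩ := Nat.exists_eq_add_of_le' hm
  rw [Nat.add_sub_cancel]
  have h1 : ((n + 1 : ℕ) : ℝ) ≤ 2 ^ n := by
    exact_mod_cast Nat.lt_two_pow_self
  calc ((n + 1 : ℕ) : ℝ) * s ^ n ≤ 2 ^ n * s ^ n := by gcongr
    _ = (2 * s) ^ n := (mul_pow _ _ _).symm
    _ ≤ 1 := pow_le_one₀ (by positivity) (by linarith)

theorem sin_odd_mul_half_pi {a c : ℕ} (h : (a + c) % 2 = 1) :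
    cos (((a : ℝ) - c) * (π / 2)) = 0 := by
  rw [Real.cos_eq_zero_iff]
  refine ⟨((a : ℤ) - c - 1) / 2, ?_⟩
  have : (((a : ℤ) - c - 1) / 2) * 2 = (a : ℤ) - c - 1 := by omega
  have h2 : ((((a : ℤ) - c - 1) / 2 : ℤ) : ℝ) * 2 = (a : ℝ) - c - 1 := by exact_mod_cast this
  linear_combination (-(π / 2)) * h2

theorem cos_odd_shift_neg {a c : ℕ} (h : (a + c) % 2 = 1) (y : ℝ) :
    cos (((a : ℝ) - c) * (-y - π / 2)) = -cos (((a : ℝ) - c) * (y - π / 2)) := by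
  have := sin_odd_mul_half_pi h
  have e1 : ((a : ℝ) - c) * (-y - π / 2) = -(((a : ℝ) - c) * y) - ((a : ℝ) - c) * (π / 2) := by ring
  have e2 : ((a : ℝ) - c) * (y - π / 2) = ((a : ℝ) - c) * y - ((a : ℝ) - c) * (π / 2) := by ring
  rw [e1, e2, cos_sub, cos_sub, this, sin_neg]
  ring

theorem cos_int_shift (a c : ℕ) (y z : ℝ) :
    cos (((a : ℝ) - c) * (y + 2 * π - z)) = cos (((a : ℝ) - c) * (y - z)) := by
  have := Real.cos_add_int_mul_two_pi (((a : ℝ) - c) * (y - z)) ((a : ℤ) - c)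
  rw [← this]
  push_cast
  congr 1
  ring

theorem exists_wave {ε ω A : ℝ} (hε : 0 < ε) (hω0 : 0 < ω) (hω : ω ^ 2 = 1 - ε ^ 2)
    {X : WavePoly} (hX : DegGe 1 X) (hA : wnorm X ≤ A) :
    ∃ q qx qt qxx qxt qtt : ℝ → ℝ → ℝ, IsC2 q qx qt qxx qxt qtt ∧
      (∀ t, qx 0 t = 0) ∧ (∀ x t, q x (-t) = -q x t) ∧
      (∀ x t, q x (t + 2 * π / ω) = q x t) ∧
      (∀ x t, q x t = 8 * ε * ev (prof ε x) (ω * t - π / 2) X) ∧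
      (∀ x t, |qx x t| ≤ 8 * ε * (A * (ε * prof ε x))) ∧
      (∀ x t, |qt x t| ≤ 8 * ε * (A * prof ε x)) ∧
      ∀ x t, qxx x t - qtt x t - q x t = 8 * ε *
        (ev (prof ε x) (ω * t - π / 2) (diag (symb ε) X -
          AddMonoidAlgebra.single (1, 1) (64 * ε ^ 2) * diag raise X)) := by
  have hq : ∀ x t, ∑ i ∈ X.coeff.support, (8 * ε * X.coeff i) *
        (prof ε x ^ (i.1 + i.2) * cos (((i.1 : ℝ) - i.2) * (ω * t - π / 2))) =
      8 * ε * ev (prof ε x) (ω * t - π / 2) X := fun x t => by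
    rw [ev, Finset.mul_sum]
    exact Finset.sum_congr rfl fun i _ => by ring
  have hX1 : ∀ i, X.coeff i ≠ 0 → 1 ≤ i.1 + i.2 := fun i hi => (hX i.1 i.2 hi).1
  have hX2 : ∀ i ∈ X.coeff.support, (i.1 + i.2) % 2 = 1 := fun i hi =>
    (hX i.1 i.2 (Finsupp.mem_support_iff.1 hi)).2
  have hω1 : ω ≤ 1 := by nlinarith
  refine ⟨_, _, _, _, _, _, isC2_ev ε ω (8 * ε) X, fun t => ?_, fun x t => ?_, fun x t => ?_, hq,
    fun x t => ?_, fun x t => ?_, fun x t => ?_⟩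
  · simp
  · rw [← Finset.sum_neg_distrib]
    refine Finset.sum_congr rfl fun i hi => ?_
    rw [mul_neg, cos_odd_shift_neg (hX2 i hi)]
    ring
  · refine Finset.sum_congr rfl fun i hi => ?_
    rw [mul_add, mul_div_cancel₀ _ hω0.ne', cos_int_shift]
  · have h := abs_ev_weight_le hX1 (prof_pos ε x).le (C := ε)
      (g := fun i => -(((i.1 + i.2 : ℕ) : ℝ) * ε) * tanh (ε * x) *
        cos (((i.1 : ℝ) - i.2) * (ω * t - π / 2))) fun i hi => by
          rw [abs_mul, abs_mul, abs_neg, abs_of_nonneg (by positivity : 0 ≤ ((i.1 + i.2 : ℕ) : ℝ) * ε)]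
          have h1 := mul_pow_pred_le_one (prof_pos ε x).le (prof_le ε x) (hX1 i hi)
          have h2 : |tanh (ε * x)| * |cos (((i.1 : ℝ) - i.2) * (ω * t - π / 2))| ≤ 1 :=
            mul_le_one₀ (abs_tanh_le_one _) (abs_nonneg _) (abs_cos_le_one _)
          have h3 : 0 ≤ ((i.1 + i.2 : ℕ) : ℝ) * prof ε x ^ (i.1 + i.2 - 1) :=
            mul_nonneg (Nat.cast_nonneg _) (pow_nonneg (prof_pos ε x).le _)
          calc _ = ε * ((((i.1 + i.2 : ℕ) : ℝ) * prof ε x ^ (i.1 + i.2 - 1)) *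
                (|tanh (ε * x)| * |cos (((i.1 : ℝ) - i.2) * (ω * t - π / 2))|)) := by ring
            _ ≤ ε * 1 := mul_le_mul_of_nonneg_left (mul_le_one₀ h1 (by positivity) h2) hε.le
            _ = ε := mul_one _
    have e : (∑ i ∈ X.coeff.support, (8 * ε * X.coeff i) *
        ((-(((i.1 + i.2 : ℕ) : ℝ) * ε) * (prof ε x ^ (i.1 + i.2) * tanh (ε * x))) *
          cos (((i.1 : ℝ) - i.2) * (ω * t - π / 2)))) = 8 * ε * ∑ i ∈ X.coeff.support,
          X.coeff i * ((-(((i.1 + i.2 : ℕ) : ℝ) * ε) * tanh (ε * x) *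
        cos (((i.1 : ℝ) - i.2) * (ω * t - π / 2))) * prof ε x ^ (i.1 + i.2)) := by
      rw [Finset.mul_sum]
      exact Finset.sum_congr rfl fun i _ => by ring
    rw [e, abs_mul, abs_of_pos (by positivity : 0 < 8 * ε)]
    rw [pow_one] at h
    refine mul_le_mul_of_nonneg_left (h.trans ?_) (by positivity)
    exact mul_le_mul_of_nonneg_right hA (mul_nonneg hε.le (prof_pos ε x).le)
  · have h := abs_ev_weight_le hX1 (prof_pos ε x).le (C := 1)
      (g := fun i => -(((i.1 : ℝ) - i.2) * ω) *
        sin (((i.1 : ℝ) - i.2) * (ω * t - π / 2))) fun i hi => by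
          have h1 := mul_pow_pred_le_one (prof_pos ε x).le (prof_le ε x) (hX1 i hi)
          have h2 : |((i.1 : ℝ) - i.2)| ≤ ((i.1 + i.2 : ℕ) : ℝ) := by
            push_cast
            exact abs_le.2 ⟨by linarith [Nat.cast_nonneg (α := ℝ) i.1], by
              linarith [Nat.cast_nonneg (α := ℝ) i.2]⟩
          refine le_trans (mul_le_mul_of_nonneg_right ?_ (pow_nonneg (prof_pos ε x).le _)) h1
          rw [abs_mul, abs_neg, abs_mul, abs_of_pos hω0]
          calc _ ≤ ((i.1 + i.2 : ℕ) : ℝ) * 1 * 1 := by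
                gcongr
                exact abs_sin_le_one _
            _ = _ := by ring
    have e : (∑ i ∈ X.coeff.support, (8 * ε * X.coeff i) * (prof ε x ^ (i.1 + i.2) *
        (-(((i.1 : ℝ) - i.2) * ω) * sin (((i.1 : ℝ) - i.2) * (ω * t - π / 2))))) =
        8 * ε * ∑ i ∈ X.coeff.support, X.coeff i * ((-(((i.1 : ℝ) - i.2) * ω) *
        sin (((i.1 : ℝ) - i.2) * (ω * t - π / 2))) * prof ε x ^ (i.1 + i.2)) := by
      rw [Finset.mul_sum]
      exact Finset.sum_congr rfl fun i _ => by ring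
    rw [e, abs_mul, abs_of_pos (by positivity : 0 < 8 * ε)]
    rw [pow_one, one_mul] at h
    refine mul_le_mul_of_nonneg_left (h.trans ?_) (by positivity)
    exact mul_le_mul_of_nonneg_right hA (prof_pos ε x).le
  · rw [hq]
    exact ev_linear hω (8 * ε) X x t

end WavePoly

theorem exp_small_bound {ε : ℝ} (hε : 0 < ε) {D K : ℝ} (hD : 0 ≤ D) (hK : 0 ≤ K) (hε1 : ε ≤ 1 / 16)
    {M : ℕ} (hM1 : (M : ℝ) ≤ 1 / (64 * ε)) (hM2 : 1 / (64 * ε) < M + 1) :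
    (1 / 8 : ℝ) ^ (2 * M + 1) * (8 * ε * (D * (4 * (M : ℝ) + 2) ^ 2) + 2 * K) ≤
      192 * (8 * D + 2 * K) * exp (-(1 / 64) / ε) := by
  have e1 : exp 1 < 3 := lt_trans exp_one_lt_d9 (by norm_num)
  have h1 : (1 / 8 : ℝ) ^ (2 * M + 1) ≤ 3 * exp (-(1 / 32) / ε) := by
    have h2 : (1 / 8 : ℝ) ≤ exp (-1) := by
      rw [exp_neg, one_div]
      exact inv_anti₀ (exp_pos _) (by linarith)
    calc (1 / 8 : ℝ) ^ (2 * M + 1) ≤ exp (-1) ^ (2 * M + 1) := by gcongr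
      _ = exp (((2 * M + 1 : ℕ) : ℝ) * -1) := (exp_nat_mul _ _).symm
      _ ≤ exp (1 + -(1 / 32) / ε) := by
        apply exp_le_exp.2
        have : -(1 / 32) / ε = -2 * (1 / (64 * ε)) := by field_simp; norm_num
        rw [this]
        push_cast
        linarith
      _ = exp 1 * exp (-(1 / 32) / ε) := exp_add _ _
      _ ≤ _ := by gcongr
  have h3 : 4 * (M : ℝ) + 2 ≤ 1 / ε := by
    have h4 : 1 / (64 * ε) = 1 / ε / 64 := by field_simp
    have h5 : 16 ≤ 1 / ε := by rw [le_div_iff₀ hε]; linarith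
    linarith
  have h6 : 8 * ε * (D * (4 * (M : ℝ) + 2) ^ 2) + 2 * K ≤ (8 * D + 2 * K) * (1 / ε) := by
    have h5 : 1 ≤ 1 / ε := by rw [le_div_iff₀ hε]; linarith
    have h7 : (4 * (M : ℝ) + 2) ^ 2 ≤ (1 / ε) ^ 2 := by gcongr
    have h8 : 8 * ε * (D * (1 / ε) ^ 2) = 8 * D * (1 / ε) := by field_simp
    have h9 : 8 * ε * (D * (4 * (M : ℝ) + 2) ^ 2) ≤ 8 * ε * (D * (1 / ε) ^ 2) := by gcongr
    nlinarith
  have h10 : 1 / ε ≤ 64 * exp (1 / 64 / ε) := by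
    have := add_one_le_exp (1 / 64 / ε)
    have h11 : 1 / ε = 64 * (1 / 64 / ε) := by field_simp
    linarith
  have h12 : exp (-(1 / 32) / ε) * exp (1 / 64 / ε) = exp (-(1 / 64) / ε) := by
    rw [← exp_add]; congr 1; field_simp; norm_num
  calc _ ≤ (3 * exp (-(1 / 32) / ε)) * ((8 * D + 2 * K) * (64 * exp (1 / 64 / ε))) := by
        refine mul_le_mul h1 (h6.trans ?_) (by positivity) (by positivity)
        gcongr
    _ = 192 * (8 * D + 2 * K) * (exp (-(1 / 32) / ε) * exp (1 / 64 / ε)) := by ring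
    _ = _ := by rw [h12]

open WavePoly in
set_option maxHeartbeats 1000000 in
theorem exists_approx {f : ℝ → ℝ} (hodd : ∀ x, f (-x) = -f x) (hanal : AnalyticAt ℝ f 0)
    (hf1 : deriv f 0 = 0) (hf3 : 0 < iteratedDeriv 3 f 0) :
    ∃ α > 0, iteratedDeriv 3 f 0 / 6 * α ^ 2 = 8 / 3 ∧ ∃ K > 0, ∃ c > 0, ∃ ε₁ > 0, ε₁ ≤ 1 / 16 ∧
    ∀ ε ω : ℝ, 0 < ε → ε < ε₁ → 0 < ω → ω ^ 2 = 1 - ε ^ 2 →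
    ∃ q qx qt qxx qxt qtt : ℝ → ℝ → ℝ, IsC2 q qx qt qxx qxt qtt ∧
      (∀ t, qx 0 t = 0) ∧ (∀ x t, q x (-t) = -q x t) ∧
      (∀ x t, q x (t + 2 * π / ω) = q x t) ∧
      (∀ x t, |q x t - α * (ε / cosh (ε * x)) * sin (ω * t)| ≤ K * ε ^ 2) ∧
      (∀ x t, |qx x t| ≤ K * ε ^ 2 * exp (-(ε * x))) ∧
      (∀ x t, |q x t| ≤ K * ε * exp (-(ε * x))) ∧
      (∀ x t, |q x t| ≤ K * ε) ∧
      (∀ x t, |qt x t| ≤ K * ε * exp (-(ε * x))) ∧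
      ∀ x t, |qxx x t - qtt x t - q x t + f (q x t)| ≤ K * exp (-c / ε) * exp (-(ε * x)) := by
  obtain ⟨b, ρ, K, hρ, hK, hb, hsum, hbe, hb1, hb3⟩ := exists_odd_powerSeries hodd hanal hf1
  have hb3p : 0 < b 3 := by rw [hb3]; positivity
  obtain ⟨α, hα, hα2⟩ : ∃ α > 0, b 3 * α ^ 2 = 8 / 3 := by
    refine ⟨√(8 / 3 / b 3), by positivity, ?_⟩
    rw [sq_sqrt (by positivity)]
    field_simp
  obtain ⟨κ, hκ, hform⟩ := exists_formal hb3p hα hα2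
  obtain ⟨C₁, hC₁, hresc⟩ := exists_sum_rescaled_le (R := α + 1) hρ (by linarith) hb
  obtain ⟨ε₁, hε₁, hε₁16, hε₁1, hε₁2, hε₁3⟩ : ∃ ε₁ > 0, ε₁ ≤ 1 / 16 ∧ 64 * ε₁ ≤ κ ∧
      8 * ε₁ * (α + 1) ≤ ρ / 2 ∧ C₁ * (8 * ε₁) ≤ κ := by
    refine ⟨min (1 / 16) (min (κ / 64) (min (ρ / (16 * (α + 1))) (κ / (8 * C₁)))), by positivity,
      min_le_left _ _, ?_, ?_, ?_⟩
    · have : min (1 / 16) (min (κ / 64) (min (ρ / (16 * (α + 1))) (κ / (8 * C₁)))) ≤ κ / 64 :=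
        (min_le_right _ _).trans (min_le_left _ _)
      linarith
    · have : min (1 / 16) (min (κ / 64) (min (ρ / (16 * (α + 1))) (κ / (8 * C₁)))) ≤
          ρ / (16 * (α + 1)) :=
        (min_le_right _ _).trans ((min_le_right _ _).trans (min_le_left _ _))
      rw [le_div_iff₀ (by positivity)] at this
      linarith
    · have : min (1 / 16) (min (κ / 64) (min (ρ / (16 * (α + 1))) (κ / (8 * C₁)))) ≤
          κ / (8 * C₁) :=
        (min_le_right _ _).trans ((min_le_right _ _).trans (min_le_right _ _))
      rw [le_div_iff₀ (by positivity)] at this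
      linarith
  set D : ℝ := 3 * (α + 1) + b 3 * (α + 1) ^ 3 + κ with hDdef
  have hD : 0 < D := by positivity
  set K₁ : ℝ := 8 * (α + 1) + 192 * (8 * D + 2 * K) + 16 * C₁ + 512 * α with hK₁
  have hDK : 0 ≤ 192 * (8 * D + 2 * K) := by positivity
  have hK₁0 : 0 < K₁ := by positivity
  have hK₁1 : 8 * (α + 1) ≤ K₁ := by linarith [mul_pos (by norm_num : (0 : ℝ) < 16) hC₁]
  have hK₁2 : 192 * (8 * D + 2 * K) ≤ K₁ := by linarith [mul_pos (by norm_num : (0 : ℝ) < 16) hC₁]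
  have hK₁3 : 16 * C₁ + 512 * α ≤ K₁ := by linarith
  refine ⟨α, hα, by rw [← hb3]; exact hα2, K₁, hK₁0, 1 / 64, by norm_num, ε₁, hε₁, hε₁16,
    fun ε ω hε hεε hω0 hω => ?_⟩
  have hε16 : ε ≤ 1 / 16 := by linarith
  have hr : 0 < 8 * ε := by positivity
  obtain ⟨M, hM1, hM2⟩ : ∃ M : ℕ, (M : ℝ) ≤ 1 / (64 * ε) ∧ 1 / (64 * ε) < M + 1 :=
    ⟨⌊1 / (64 * ε)⌋₊, Nat.floor_le (by positivity), Nat.lt_floor_add_one _⟩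
  have hε2 : ε ^ 2 ≤ 1 / 16 * ε := by rw [sq]; exact mul_le_mul_of_nonneg_right hε16 hε.le
  have hεκ : 64 * ε ^ 2 ≤ κ := by linarith
  have hMε : (4 * (M : ℝ) + 1) ^ 2 * (64 * ε ^ 2) ≤ 1 := by
    have h1 : (4 * (M : ℝ) + 1) * (8 * ε) ≤ 1 := by
      rw [le_div_iff₀ (by positivity)] at hM1
      linarith
    calc (4 * (M : ℝ) + 1) ^ 2 * (64 * ε ^ 2) = ((4 * (M : ℝ) + 1) * (8 * ε)) ^ 2 := by ring
      _ ≤ 1 := pow_le_one₀ (by positivity) h1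
  have hrR : 8 * ε * (α + 1) ≤ ρ / 2 := le_trans (by gcongr) hε₁2
  set J : Finset ℕ := (Finset.range (2 * M + 4)).filter fun j => 5 ≤ j ∧ j % 2 = 1 with hJ
  have hJ5 : ∀ j ∈ J, 5 ≤ j ∧ j % 2 = 1 := fun j hj => (Finset.mem_filter.1 hj).2
  set β : ℕ → ℝ := fun j => b j * (8 * ε) ^ (j - 3) with hβ
  set δ : ℝ := C₁ * (8 * ε) with hδ
  have hδκ : δ ≤ κ := le_trans (mul_le_mul_of_nonneg_left (by linarith) hC₁.le) hε₁3
  have hs0 := hresc (8 * ε) hr.le hrR J fun j hj => (hJ5 j hj).1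
  have hs1 : ∑ j ∈ J, |β j| * (α + 1) ^ j ≤ δ := by
    refine le_trans (Finset.sum_le_sum fun j hj => ?_) hs0
    have h5 : (1 : ℝ) ≤ j := by exact_mod_cast (by have := (hJ5 j hj).1; omega : 1 ≤ j)
    calc |β j| * (α + 1) ^ j = 1 * (|β j| * (α + 1) ^ j) := (one_mul _).symm
      _ ≤ j * (|β j| * (α + 1) ^ j) := by gcongr
      _ = _ := by rw [hβ]; ring
  have hs2 : ∑ j ∈ J, (j : ℝ) * |β j| * (α + 1) ^ (j - 1) ≤ δ := by
    refine le_trans (Finset.sum_le_sum fun j hj => ?_) hs0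
    rw [hβ]
    gcongr
    · linarith
    · omega
  obtain ⟨Y, hYs, hYd, hYN, hY1, hY2, hYr⟩ := hform ε hε hεκ M hMε J β δ hJ5 hδκ hs1 hs2
  set X : WavePoly := lead α + Y with hX
  have hleadd : ∀ a c, (lead α).coeff (a, c) ≠ 0 → a + c = 1 := by
    intro a c h
    by_contra hac
    apply h
    rw [lead, AddMonoidAlgebra.coeff_add, Finsupp.add_apply, AddMonoidAlgebra.coeff_single,
      AddMonoidAlgebra.coeff_single, Finsupp.single_apply, Finsupp.single_apply, if_neg, if_neg,
      add_zero]
    · rintro ⟨⟩; exact hac rfl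
    · rintro ⟨⟩; exact hac rfl
  have hXd : DegGe 1 X := DegGe.add (fun a c h => by rw [hleadd a c h]; simp) hYd
  have hXs : swap X = X := by rw [hX, map_add, hYs, swap_lead]
  have hlead : wnorm (lead α) ≤ α := wnorm_lead_le hα.le
  have hXn : wnorm X ≤ α + 1 := (wnorm_add_le _ _).trans (by linarith)
  have hXN : ∀ i, X.coeff i ≠ 0 → i.1 + i.2 ≤ 4 * M + 1 := by
    rintro ⟨a, c⟩ h
    rw [hX, AddMonoidAlgebra.coeff_add, Finsupp.add_apply] at h
    by_cases h1 : Y.coeff (a, c) = 0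
    · rw [h1, add_zero] at h
      have := hleadd a c h
      simp only
      omega
    · exact hYN a c h1
  obtain ⟨q, qx, qt, qxx, qxt, qtt, hC2, hqx0, hqo, hqp, hqe, hqxb, hqtb, hlin⟩ :=
    exists_wave hε hω0 hω hXd hXn
  have hsexp : ∀ x, prof ε x ≤ exp (-(ε * x)) := fun x =>
    (prof_le_exp ε x).trans (by linarith [exp_pos (-(ε * x))])
  have hev : ∀ x t, |ev (prof ε x) (ω * t - π / 2) X| ≤ (α + 1) * prof ε x := fun x t => by
    have := abs_ev_le (N := 1) (fun i hi => (hXd i.1 i.2 hi).1) (prof_pos ε x).le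
      ((prof_le ε x).trans (by norm_num)) (ω * t - π / 2)
    rw [pow_one] at this
    exact this.trans (mul_le_mul_of_nonneg_right hXn (prof_pos ε x).le)
  have hqb : ∀ x t, |q x t| ≤ 8 * ε * ((α + 1) * prof ε x) := fun x t => by
    rw [hqe, abs_mul, abs_of_pos hr]
    exact mul_le_mul_of_nonneg_left (hev x t) hr.le
  have hexp0 : ∀ x, 0 < exp (-(ε * x)) := fun x => exp_pos _
  have hfin : ∀ y : ℝ, 0 ≤ y → 8 * ε * ((α + 1) * y) ≤ K₁ * ε * y := fun y hy => by
    calc 8 * ε * ((α + 1) * y) = (8 * (α + 1)) * ε * y := by ring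
      _ ≤ _ := by gcongr
  refine ⟨q, qx, qt, qxx, qxt, qtt, hC2, hqx0, hqo, hqp, fun x t => ?_, fun x t => ?_,
    fun x t => ?_, fun x t => ?_, fun x t => ?_, fun x t => ?_⟩
  · rw [hqe, hX, ev_add, ev_lead, cos_sub_pi_div_two]
    have e1 : 8 * ε * (α * prof ε x * sin (ω * t) + ev (prof ε x) (ω * t - π / 2) Y) -
        α * (ε / cosh (ε * x)) * sin (ω * t) = 8 * ε * ev (prof ε x) (ω * t - π / 2) Y := by
      have := cosh_pos (ε * x)
      rw [prof]
      field_simp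
      ring
    rw [e1, abs_mul, abs_of_pos hr]
    have := abs_ev_le (N := 1) (fun i hi => (hYd i.1 i.2 hi).1) (prof_pos ε x).le
      ((prof_le ε x).trans (by norm_num)) (ω * t - π / 2)
    rw [pow_one] at this
    calc 8 * ε * |ev (prof ε x) (ω * t - π / 2) Y| ≤ 8 * ε * (wnorm Y * (1 / 8)) := by
          gcongr
          exact this.trans (mul_le_mul_of_nonneg_left (prof_le ε x) (wnorm_nonneg Y))
      _ ≤ 8 * ε * ((2 * δ + 8 * (64 * ε ^ 2) * α) * (1 / 8)) := by gcongr
      _ = (16 * C₁ + 512 * ε * α) * ε ^ 2 := by rw [hδ]; ring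
      _ ≤ (16 * C₁ + 512 * 1 * α) * ε ^ 2 := by gcongr; linarith
      _ ≤ K₁ * ε ^ 2 := by gcongr; linarith
  · refine (hqxb x t).trans ?_
    calc 8 * ε * ((α + 1) * (ε * prof ε x)) ≤ 8 * ε * ((α + 1) * (ε * exp (-(ε * x)))) := by
          gcongr
          exact hsexp x
      _ ≤ K₁ * ε * (ε * exp (-(ε * x))) := hfin _ (by positivity)
      _ = _ := by ring
  · exact (hqb x t).trans ((hfin _ (prof_pos ε x).le).trans (by gcongr; exact hsexp x))
  · refine (hqb x t).trans ((hfin _ (prof_pos ε x).le).trans ?_)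
    exact mul_le_of_le_one_right (mul_pos hK₁0 hε).le ((prof_le ε x).trans (by norm_num))
  · exact (hqtb x t).trans ((hfin _ (prof_pos ε x).le).trans (by gcongr; exact hsexp x))
  · set s := prof ε x with hs
    have hsp : 0 < s := prof_pos ε x
    have hs8 : s ≤ 1 / 8 := prof_le ε x
    set E := ev s (ω * t - π / 2) X with hE
    have hqs : |q x t| ≤ ρ / 2 * s := by
      refine (hqb x t).trans ?_
      rw [← mul_assoc]
      exact mul_le_mul_of_nonneg_right hrR hsp.le
    have hq2 : |q x t| ≤ ρ / 2 := hqs.trans (mul_le_of_le_one_right (by positivity) (by linarith))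
    have herr := abs_sub_sum_le_of_hasSum hρ hb hq2 (hsum _ (by linarith)) (2 * M + 4)
    have hsumeq : ∑ n ∈ Finset.range (2 * M + 4), b n * q x t ^ n =
        8 * ε * ((64 * ε ^ 2) * (b 3 * E ^ 3 + ∑ j ∈ J, β j * E ^ j)) := by
      have h1 : ∑ n ∈ Finset.range (2 * M + 4), b n * q x t ^ n =
          ∑ n ∈ insert 3 J, b n * q x t ^ n := by
        symm
        refine Finset.sum_subset ?_ ?_
        · refine Finset.insert_subset ?_ (Finset.filter_subset _ _)
          rw [Finset.mem_range]; omega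
        · intro n hn hn2
          have h0 : b n = 0 := by
            rw [Finset.mem_insert, hJ, Finset.mem_filter] at hn2
            by_cases h1 : n % 2 = 0
            · exact hbe n h1
            · have : n = 1 := by
                by_contra h
                exact hn2 (by
                  by_cases h3 : n = 3
                  · exact Or.inl h3
                  · exact Or.inr ⟨hn, by omega, by omega⟩)
              rw [this, hb1]
          rw [h0, zero_mul]
      have h3J : 3 ∉ J := fun h => by have := (hJ5 3 h).1; omega
      rw [h1, Finset.sum_insert h3J, hqe, ← hE, mul_add, mul_add, Finset.mul_sum, Finset.mul_sum]
      congr 1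
      · ring
      · refine Finset.sum_congr rfl fun j hj => ?_
        obtain ⟨k, rfl⟩ := Nat.exists_eq_add_of_le' ((by norm_num : 3 ≤ 5).trans (hJ5 j hj).1)
        rw [hβ]
        simp only [Nat.add_sub_cancel]
        ring
    have hres : qxx x t - qtt x t - q x t + f (q x t) =
        8 * ε * ev s (ω * t - π / 2) (resid ε (64 * ε ^ 2) (b 3) J β X) +
          (f (q x t) - ∑ n ∈ Finset.range (2 * M + 4), b n * q x t ^ n) := by
      rw [hlin, hsumeq, resid, ev_add, ev_smul, ev_nonlin hXs]
      ring
    have hR1 : |ev s (ω * t - π / 2) (resid ε (64 * ε ^ 2) (b 3) J β X)| ≤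
        (D * (4 * (M : ℝ) + 2) ^ 2) * s ^ (2 * M + 2) := by
      refine (abs_ev_le (N := 2 * M + 2) (fun i hi => ?_) hsp.le (by linarith) _).trans ?_
      · by_contra h
        exact hi (hYr i.1 i.2 (by omega))
      · refine mul_le_mul_of_nonneg_right ?_ (by positivity)
        refine (wnorm_resid_le (by linarith) (by positivity) (by linarith) hb3p.le hs1 hXn
          hXN).trans ?_
        push_cast
        rw [show 4 * (M : ℝ) + 1 + 1 = 4 * (M : ℝ) + 2 by ring]
        gcongr
        linarith
    have hR2 : |f (q x t) - ∑ n ∈ Finset.range (2 * M + 4), b n * q x t ^ n| ≤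
        2 * K * s ^ (2 * M + 2) := by
      refine herr.trans ?_
      have h1 : |q x t| / ρ ≤ s := by
        rw [div_le_iff₀ hρ]
        nlinarith
      have h2 : (|q x t| / ρ) ^ (2 * M + 4) ≤ s ^ (2 * M + 4) := by gcongr
      have h3 : s ^ (2 * M + 4) ≤ s ^ (2 * M + 2) :=
        pow_le_pow_of_le_one hsp.le (by linarith) (by omega)
      gcongr
      exact h2.trans h3
    have hs2M : s ^ (2 * M + 2) ≤ (1 / 8) ^ (2 * M + 1) * s := by
      rw [pow_succ]
      gcongr
    rw [hres]
    calc _ ≤ |8 * ε * ev s (ω * t - π / 2) (resid ε (64 * ε ^ 2) (b 3) J β X)| +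
          |f (q x t) - ∑ n ∈ Finset.range (2 * M + 4), b n * q x t ^ n| := abs_add_le _ _
      _ ≤ 8 * ε * ((D * (4 * (M : ℝ) + 2) ^ 2) * s ^ (2 * M + 2)) + 2 * K * s ^ (2 * M + 2) := by
        rw [abs_mul, abs_of_pos hr]
        gcongr
      _ = (8 * ε * (D * (4 * (M : ℝ) + 2) ^ 2) + 2 * K) * s ^ (2 * M + 2) := by ring
      _ ≤ (8 * ε * (D * (4 * (M : ℝ) + 2) ^ 2) + 2 * K) * ((1 / 8) ^ (2 * M + 1) * s) := by gcongr
      _ = (1 / 8 : ℝ) ^ (2 * M + 1) * (8 * ε * (D * (4 * (M : ℝ) + 2) ^ 2) + 2 * K) * s := by ring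
      _ ≤ 192 * (8 * D + 2 * K) * exp (-(1 / 64) / ε) * s := by
        exact mul_le_mul_of_nonneg_right (exp_small_bound hε hD.le hK.le hε16 hM1 hM2) hsp.le
      _ ≤ K₁ * exp (-(1 / 64) / ε) * exp (-(ε * x)) := by
        gcongr
        exact hsexp x

theorem integral_eq_zero_of_odd_periodic {φ : ℝ → ℝ} {T : ℝ} (hodd : ∀ t, φ (-t) = -φ t)
    (hper : ∀ t, φ (t + T) = φ t) : ∫ t in (0 : ℝ)..T, φ t = 0 := by
  have h1 := intervalIntegral.integral_comp_sub_left φ T (a := 0) (b := T)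
  rw [sub_self, sub_zero] at h1
  have h2 : ∀ t, φ (T - t) = -φ t := fun t => by
    rw [sub_eq_neg_add, hper, hodd]
  simp only [h2, intervalIntegral.integral_neg] at h1
  linarith

theorem fourierCoeffOn_ofReal_eq_zero {w : ℝ → ℝ} {T ω : ℝ} (hT : 0 < T) (hω : ω * T = 2 * π)
    (hw : Continuous w) (hodd : ∀ t, w (-t) = -w t) (hper : ∀ t, w (t + T) = w t)
    (hsin : ∫ t in (0 : ℝ)..T, w t * sin (ω * t) = 0) {n : ℤ} (hn : |n| ≤ 1) :
    fourierCoeffOn hT (fun t => (w t : ℂ)) n = 0 := by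
  rw [fourierCoeffOn_eq_integral]
  have hcos : ∫ t in (0 : ℝ)..T, w t * cos (n * ω * t) = 0 := by
    refine integral_eq_zero_of_odd_periodic (fun t => ?_) fun t => ?_
    · rw [hodd, mul_neg, cos_neg, neg_mul]
    · rw [hper, show n * ω * (t + T) = n * ω * t + n * (2 * π) by rw [← hω]; ring,
        cos_add_int_mul_two_pi]
  have hsin' : ∫ t in (0 : ℝ)..T, w t * sin (n * ω * t) = 0 := by
    obtain rfl | rfl | rfl : n = -1 ∨ n = 0 ∨ n = 1 := by
      rw [abs_le] at hn; omega
    · simp only [Int.cast_neg, Int.cast_one, neg_mul, one_mul, sin_neg, mul_neg,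
        intervalIntegral.integral_neg, hsin, neg_zero]
    · simp
    · simpa using hsin
  have key : ∀ t : ℝ, fourier (-n) (t : AddCircle (T - 0)) • (w t : ℂ) =
      ((w t * cos (n * ω * t) : ℝ) : ℂ) - ((w t * sin (n * ω * t) : ℝ) : ℂ) * Complex.I := by
    intro t
    rw [fourier_coe_apply, smul_eq_mul]
    have e : 2 * (π : ℂ) * Complex.I * ((-n : ℤ) : ℂ) * t / ((T - 0 : ℝ) : ℂ) =
        ((-(n * ω * t) : ℝ) : ℂ) * Complex.I := by
      have h : (T : ℂ) ≠ 0 := by exact_mod_cast hT.ne'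
      have h2 : (ω : ℂ) * T = 2 * π := by exact_mod_cast hω
      rw [sub_zero, div_eq_iff h]
      push_cast
      linear_combination (n * t * Complex.I) * h2
    rw [e, Complex.exp_mul_I, ← Complex.ofReal_cos, ← Complex.ofReal_sin, cos_neg, sin_neg]
    push_cast
    ring
  simp only [key]
  rw [intervalIntegral.integral_sub, intervalIntegral.integral_mul_const,
    intervalIntegral.integral_ofReal, intervalIntegral.integral_ofReal, hcos, hsin']
  · simp
  · exact Continuous.intervalIntegrable (by fun_prop) _ _
  · exact Continuous.intervalIntegrable (by fun_prop) _ _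

theorem memLp_two_ofReal {w : ℝ → ℝ} (hw : Continuous w) (a b : ℝ) :
    MeasureTheory.MemLp (fun t => (w t : ℂ)) 2 (MeasureTheory.volume.restrict (Ioc a b)) := by
  have hc : Continuous fun t => (w t : ℂ) := by fun_prop
  obtain ⟨C, hC⟩ := (isCompact_Icc (a := a) (b := b)).exists_bound_of_continuousOn hc.continuousOn
  refine MeasureTheory.MemLp.of_bound hc.aestronglyMeasurable C ?_
  filter_upwards [MeasureTheory.ae_restrict_mem measurableSet_Ioc] with t ht
  exact hC t (Ioc_subset_Icc_self ht)

theorem wirtinger_odd {w w' : ℝ → ℝ} {T ω : ℝ} (hT : 0 < T) (hω : ω * T = 2 * π)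
    (hd : ∀ t, HasDerivAt w (w' t) t) (hw' : Continuous w')
    (hodd : ∀ t, w (-t) = -w t) (hper : ∀ t, w (t + T) = w t)
    (hsin : ∫ t in (0 : ℝ)..T, w t * sin (ω * t) = 0) :
    4 * ω ^ 2 * ∫ t in (0 : ℝ)..T, w t ^ 2 ≤ ∫ t in (0 : ℝ)..T, w' t ^ 2 := by
  have hw : Continuous w := continuous_iff_continuousAt.2 fun t => (hd t).continuousAt
  have h1 := hasSum_sq_fourierCoeffOn hT (memLp_two_ofReal hw 0 T)
  have h2 := hasSum_sq_fourierCoeffOn hT (memLp_two_ofReal hw' 0 T)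
  have key : ∀ n : ℤ, 4 * ω ^ 2 * ‖fourierCoeffOn hT (fun t => (w t : ℂ)) n‖ ^ 2 ≤
      ‖fourierCoeffOn hT (fun t => (w' t : ℂ)) n‖ ^ 2 := by
    intro n
    by_cases hn : |n| ≤ 1
    · rw [fourierCoeffOn_ofReal_eq_zero hT hω hw hodd hper hsin hn]
      rw [norm_zero, zero_pow two_ne_zero, mul_zero]
      exact sq_nonneg _
    · have hn0 : n ≠ 0 := fun h => hn (by rw [h]; norm_num)
      have hT0 : w T = w 0 := by rw [← hper 0, zero_add]
      have h := fourierCoeffOn_of_hasDerivAt (n := n) hT (f := fun t => (w t : ℂ))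
        (f' := fun t => (w' t : ℂ)) hn0 (fun t _ => (hd t).ofReal_comp)
        (Continuous.intervalIntegrable (by fun_prop) _ _)
      rw [hT0, sub_self, mul_zero, zero_sub] at h
      have hωpos : ω ≠ 0 := fun h => by
        rw [h, zero_mul] at hω
        have := pi_pos
        linarith
      have hn2 : (4 : ℝ) ≤ (n : ℝ) ^ 2 := by
        have h3 : 2 ≤ |n| := by omega
        have h4 : (2 : ℤ) ^ 2 ≤ |n| ^ 2 := by gcongr
        rw [sq_abs] at h4
        exact_mod_cast h4
      have hnorm : ‖fourierCoeffOn hT (fun t => (w' t : ℂ)) n‖ ^ 2 =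
          ω ^ 2 * (n : ℝ) ^ 2 * ‖fourierCoeffOn hT (fun t => (w t : ℂ)) n‖ ^ 2 := by
        have e : fourierCoeffOn hT (fun t => (w' t : ℂ)) n =
            ((ω * n : ℝ) : ℂ) * (Complex.I * fourierCoeffOn hT (fun t => (w t : ℂ)) n) := by
          have hTc : (T : ℂ) ≠ 0 := by exact_mod_cast hT.ne'
          have hpc : (π : ℂ) ≠ 0 := by exact_mod_cast pi_ne_zero
          have hnc : (n : ℂ) ≠ 0 := by exact_mod_cast hn0
          have h2 : (ω : ℂ) * T = 2 * π := by exact_mod_cast hω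
          have h3 : (ω : ℂ) = 2 * π / T := by rw [eq_div_iff hTc, h2]
          rw [h]
          push_cast
          rw [h3, sub_zero]
          field_simp
        rw [e, norm_mul, norm_mul, Complex.norm_I, one_mul, Complex.norm_real, mul_pow,
          Real.norm_eq_abs, sq_abs, mul_pow]
      rw [hnorm]
      have : 0 ≤ ω ^ 2 * ‖fourierCoeffOn hT (fun t => (w t : ℂ)) n‖ ^ 2 := by positivity
      nlinarith
  have h3 := hasSum_le key (h1.mul_left (4 * ω ^ 2)) h2
  simp only [Complex.norm_real, Real.norm_eq_abs, sq_abs, sub_zero, smul_eq_mul] at h3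
  rw [mul_left_comm] at h3
  exact le_of_mul_le_mul_left h3 (by positivity)

theorem sq_integral_le {φ : ℝ → ℝ} (hφ : Continuous φ) {T : ℝ} (hT : 0 < T) :
    (∫ t in (0 : ℝ)..T, φ t) ^ 2 ≤ T * ∫ t in (0 : ℝ)..T, φ t ^ 2 := by
  set A := (∫ t in (0 : ℝ)..T, φ t) with hA
  have h0 : 0 ≤ ∫ t in (0 : ℝ)..T, (T * φ t - A) ^ 2 :=
    intervalIntegral.integral_nonneg hT.le fun t _ => sq_nonneg _
  have h1 : ∫ t in (0 : ℝ)..T, (T * φ t - A) ^ 2 =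
      T ^ 2 * (∫ t in (0 : ℝ)..T, φ t ^ 2) - 2 * T * A * A + A ^ 2 * T := by
    have : ∀ t, (T * φ t - A) ^ 2 = T ^ 2 * φ t ^ 2 - 2 * T * A * φ t + A ^ 2 := fun t => by ring
    simp only [this]
    rw [intervalIntegral.integral_add, intervalIntegral.integral_sub,
      intervalIntegral.integral_const_mul, intervalIntegral.integral_const_mul,
      intervalIntegral.integral_const, ← hA, smul_eq_mul]
    · ring
    all_goals exact Continuous.intervalIntegrable (by fun_prop) _ _
  rw [h1] at h0
  have h2 : 0 ≤ T * (T * (∫ t in (0 : ℝ)..T, φ t ^ 2) - A ^ 2) := by nlinarith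
  linarith [nonneg_of_mul_nonneg_right h2 hT]

theorem integral_sin_sq_period {ω T : ℝ} (hω0 : 0 < ω) (hω : ω * T = 2 * π) :
    ∫ t in (0 : ℝ)..T, sin (ω * t) ^ 2 = T / 2 := by
  rw [intervalIntegral.integral_comp_mul_left (fun y => sin y ^ 2) hω0.ne', hω, integral_sin_sq]
  simp
  field_simp
  linarith

theorem integral_cos_sq_period {ω T : ℝ} (hω0 : 0 < ω) (hω : ω * T = 2 * π) :
    ∫ t in (0 : ℝ)..T, cos (ω * t) ^ 2 = T / 2 := by
  rw [intervalIntegral.integral_comp_mul_left (fun y => cos y ^ 2) hω0.ne', hω, integral_cos_sq]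
  simp
  field_simp
  linarith

theorem integral_sin_pow_four_period {ω T : ℝ} (hω0 : 0 < ω) (hω : ω * T = 2 * π) :
    ∫ t in (0 : ℝ)..T, sin (ω * t) ^ 4 = 3 * T / 8 := by
  rw [intervalIntegral.integral_comp_mul_left (fun y => sin y ^ 4) hω0.ne', hω,
    integral_sin_pow (n := 2), integral_sin_sq]
  simp
  field_simp
  linarith

/-- The coefficient of `sin (ω t)` in a function of period `T`. -/
def sinCoeff (T ω : ℝ) (w : ℝ → ℝ) : ℝ := 2 / T * ∫ t in (0 : ℝ)..T, w t * sin (ω * t)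

section Slice

variable {w w' : ℝ → ℝ} {T ω : ℝ}

theorem hasDerivAt_sin_const_mul (ω t : ℝ) :
    HasDerivAt (fun t => sin (ω * t)) (ω * cos (ω * t)) t :=
  ((hasDerivAt_sin _).comp t ((hasDerivAt_id t).const_mul ω)).congr_deriv (by simp [mul_comm])

theorem hasDerivAt_cos_const_mul (ω t : ℝ) :
    HasDerivAt (fun t => cos (ω * t)) (-(ω * sin (ω * t))) t :=
  ((hasDerivAt_cos _).comp t ((hasDerivAt_id t).const_mul ω)).congr_deriv (by simp [mul_comm])

theorem integral_deriv_mul_cos (hω : ω * T = 2 * π)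
    (hd : ∀ t, HasDerivAt w (w' t) t) (hw' : Continuous w') (hper : ∀ t, w (t + T) = w t) :
    ∫ t in (0 : ℝ)..T, w' t * cos (ω * t) = ω * ∫ t in (0 : ℝ)..T, w t * sin (ω * t) := by
  have hw : Continuous w := continuous_iff_continuousAt.2 fun t => (hd t).continuousAt
  have h := intervalIntegral.integral_deriv_mul_eq_sub (a := 0) (b := T) (fun t _ => hd t)
    (fun t _ => hasDerivAt_cos_const_mul ω t) (Continuous.intervalIntegrable (by fun_prop) _ _)
    (Continuous.intervalIntegrable (by fun_prop) _ _)
  have hT0 : w T = w 0 := by rw [← hper 0, zero_add]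
  rw [hω, hT0, cos_two_pi, mul_zero, cos_zero, sub_self, intervalIntegral.integral_add] at h
  · rw [← intervalIntegral.integral_const_mul]
    have e : ∀ t, w t * -(ω * sin (ω * t)) = -(ω * (w t * sin (ω * t))) := fun t => by ring
    simp only [e, intervalIntegral.integral_neg] at h
    linarith
  all_goals exact Continuous.intervalIntegrable (by fun_prop) _ _

theorem slice_bounds (hT : 0 < T) (hω0 : 0 < ω) (hω : ω * T = 2 * π)
    (hd : ∀ t, HasDerivAt w (w' t) t) (hw' : Continuous w')
    (hodd : ∀ t, w (-t) = -w t) (hper : ∀ t, w (t + T) = w t) :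
    4 * ω ^ 2 * (∫ t in (0 : ℝ)..T, w t ^ 2) ≤ 4 * ω ^ 2 * (sinCoeff T ω w ^ 2 * (T / 2)) +
      (∫ t in (0 : ℝ)..T, (w' t - sinCoeff T ω w * (ω * cos (ω * t))) ^ 2) ∧
    (∫ t in (0 : ℝ)..T, w' t ^ 2) = ω ^ 2 * sinCoeff T ω w ^ 2 * (T / 2) +
      (∫ t in (0 : ℝ)..T, (w' t - sinCoeff T ω w * (ω * cos (ω * t))) ^ 2) ∧
    ∀ t, (w t - sinCoeff T ω w * sin (ω * t)) ^ 2 ≤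
      T * ∫ t in (0 : ℝ)..T, (w' t - sinCoeff T ω w * (ω * cos (ω * t))) ^ 2 := by
  have hw : Continuous w := continuous_iff_continuousAt.2 fun t => (hd t).continuousAt
  set c := sinCoeff T ω w with hc
  have hcw : ∫ t in (0 : ℝ)..T, w t * sin (ω * t) = c * (T / 2) := by
    rw [hc, sinCoeff]; field_simp
  have hhd : ∀ t, HasDerivAt (fun t => w t - c * sin (ω * t)) (w' t - c * (ω * cos (ω * t))) t :=
    fun t => (hd t).sub ((hasDerivAt_sin_const_mul ω t).const_mul c)
  have hh' : Continuous fun t => w' t - c * (ω * cos (ω * t)) := by fun_prop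
  have hhodd : ∀ t, w (-t) - c * sin (ω * -t) = -(w t - c * sin (ω * t)) := fun t => by
    rw [hodd, mul_neg, sin_neg]; ring
  have hhper : ∀ t, w (t + T) - c * sin (ω * (t + T)) = w t - c * sin (ω * t) := fun t => by
    rw [hper, mul_add, hω, sin_add_two_pi]
  have hperp : ∫ t in (0 : ℝ)..T, (w t - c * sin (ω * t)) * sin (ω * t) = 0 := by
    have e : ∀ t, (w t - c * sin (ω * t)) * sin (ω * t) =
        w t * sin (ω * t) - c * sin (ω * t) ^ 2 := fun t => by ring
    simp only [e]
    rw [intervalIntegral.integral_sub, intervalIntegral.integral_const_mul, hcw,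
      integral_sin_sq_period hω0 hω, sub_self]
    all_goals exact Continuous.intervalIntegrable (by fun_prop) _ _
  refine ⟨?_, ?_, ?_⟩
  · have h := wirtinger_odd hT hω hhd hh' hhodd hhper hperp
    have e : ∀ t, (w t - c * sin (ω * t)) ^ 2 =
        w t ^ 2 - 2 * c * (w t * sin (ω * t)) + c ^ 2 * sin (ω * t) ^ 2 := fun t => by ring
    have h2 : ∫ t in (0 : ℝ)..T, (w t - c * sin (ω * t)) ^ 2 =
        (∫ t in (0 : ℝ)..T, w t ^ 2) - c ^ 2 * (T / 2) := by
      simp only [e]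
      rw [intervalIntegral.integral_add, intervalIntegral.integral_sub,
        intervalIntegral.integral_const_mul, intervalIntegral.integral_const_mul, hcw,
        integral_sin_sq_period hω0 hω]
      · ring
      all_goals exact Continuous.intervalIntegrable (by fun_prop) _ _
    rw [h2] at h
    linarith
  · have e : ∀ t, (w' t - c * (ω * cos (ω * t))) ^ 2 =
        w' t ^ 2 - 2 * c * ω * (w' t * cos (ω * t)) + c ^ 2 * ω ^ 2 * cos (ω * t) ^ 2 :=
      fun t => by ring
    simp only [e]
    rw [intervalIntegral.integral_add, intervalIntegral.integral_sub,
        intervalIntegral.integral_const_mul, intervalIntegral.integral_const_mul,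
        integral_deriv_mul_cos hω hd hw' hper, hcw, integral_cos_sq_period hω0 hω]
    · ring
    all_goals exact Continuous.intervalIntegrable (by fun_prop) _ _
  · have main : ∀ t ∈ Icc 0 T, (w t - c * sin (ω * t)) ^ 2 ≤
        T * ∫ t in (0 : ℝ)..T, (w' t - c * (ω * cos (ω * t))) ^ 2 := by
      intro t ht
      have h0 : w 0 = 0 := by have := hodd 0; rw [neg_zero] at this; linarith
      have hF := intervalIntegral.integral_eq_sub_of_hasDerivAt (a := 0) (b := t)
        (fun s _ => hhd s) (hh'.intervalIntegrable _ _)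
      simp only [mul_zero, sin_zero, h0, sub_zero] at hF
      have h1 : |w t - c * sin (ω * t)| ≤ ∫ s in (0 : ℝ)..T, |w' s - c * (ω * cos (ω * s))| := by
        rw [← hF]
        refine (intervalIntegral.abs_integral_le_integral_abs ht.1).trans ?_
        exact intervalIntegral.integral_mono_interval le_rfl ht.1 ht.2
          (Eventually.of_forall fun _ => abs_nonneg _) (hh'.abs.intervalIntegrable _ _)
      rw [← sq_abs]
      refine (pow_le_pow_left₀ (abs_nonneg _) h1 2).trans ?_
      refine (sq_integral_le hh'.abs hT).trans (le_of_eq ?_)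
      simp only [sq_abs]
    intro t
    obtain ⟨y, hy, hyt⟩ := (show Function.Periodic (fun t => w t - c * sin (ω * t)) T from
      hhper).exists_mem_Ico₀ hT t
    have := main y (Ico_subset_Icc_self hy)
    rwa [hyt]

end Slice

section Energy

variable {v vx vt vxx vxt vtt : ℝ → ℝ → ℝ} {T ω : ℝ}

theorem deriv_periodic {w w' : ℝ → ℝ} {T : ℝ} (hd : ∀ t, HasDerivAt w (w' t) t)
    (hper : ∀ t, w (t + T) = w t) (t : ℝ) : w' (t + T) = w' t := by
  have h := (hd (t + T)).comp_add_const t T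
  simp only [hper] at h
  exact h.unique (hd t)

namespace IsC2

theorem slice_continuous (h : IsC2 v vx vt vxx vxt vtt) (x : ℝ) : Continuous (v x) :=
  h.continuous.comp (by fun_prop : Continuous fun t : ℝ => (x, t))

theorem slice_continuous_x (h : IsC2 v vx vt vxx vxt vtt) (x : ℝ) : Continuous (vx x) :=
  h.cx.comp (by fun_prop : Continuous fun t : ℝ => (x, t))

theorem slice_continuous_t (h : IsC2 v vx vt vxx vxt vtt) (x : ℝ) : Continuous (vt x) :=
  h.ct.comp (by fun_prop : Continuous fun t : ℝ => (x, t))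

theorem slice_continuous_xx (h : IsC2 v vx vt vxx vxt vtt) (x : ℝ) : Continuous (vxx x) :=
  h.cxx.comp (by fun_prop : Continuous fun t : ℝ => (x, t))

theorem slice_continuous_xt (h : IsC2 v vx vt vxx vxt vtt) (x : ℝ) : Continuous (vxt x) :=
  h.cxt.comp (by fun_prop : Continuous fun t : ℝ => (x, t))

theorem slice_continuous_tt (h : IsC2 v vx vt vxx vxt vtt) (x : ℝ) : Continuous (vtt x) :=
  h.ctt.comp (by fun_prop : Continuous fun t : ℝ => (x, t))

theorem x_periodic (h : IsC2 v vx vt vxx vxt vtt) (hper : ∀ x t, v x (t + T) = v x t) (x t : ℝ) :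
    vx x (t + T) = vx x t := by
  have h1 := h.hx x (t + T)
  simp only [hper] at h1
  exact h1.unique (h.hx x t)

theorem hasDerivAt_energy (h : IsC2 v vx vt vxx vxt vtt) {g G : ℝ → ℝ}
    (hg : Continuous g) (hG : ∀ s, HasDerivAt G (g s) s)
    (hper : ∀ x t, v x (t + T) = v x t) (x : ℝ) :
    HasDerivAt (fun x => ∫ t in (0 : ℝ)..T,
        (1 / 2 * vx x t ^ 2 + 1 / 2 * (vt x t ^ 2 - v x t ^ 2) + G (v x t)))
      (∫ t in (0 : ℝ)..T, vx x t * (vxx x t - vtt x t - v x t + g (v x t))) x := by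
  have hGc : Continuous G := continuous_iff_continuousAt.2 fun s => (hG s).continuousAt
  have c0 := h.continuous
  have c1 := h.cx
  have c2 := h.ct
  have c3 := h.cxx
  have c4 := h.cxt
  have hd := hasDerivAt_intervalIntegral_param (a := 0) (b := T)
    (k := fun x t => 1 / 2 * vx x t ^ 2 + 1 / 2 * (vt x t ^ 2 - v x t ^ 2) + G (v x t))
    (k' := fun x t => (vx x t * (vxx x t - v x t + g (v x t)) + vt x t * vxt x t))
    (fun x => by
      have d0 := h.slice_continuous x
      have d1 := h.slice_continuous_x x
      have d2 := h.slice_continuous_t x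
      fun_prop)
    (by
      have e : (Function.uncurry fun x t =>
          (vx x t * (vxx x t - v x t + g (v x t)) + vt x t * vxt x t)) = fun p =>
          (Function.uncurry vx p * (Function.uncurry vxx p - Function.uncurry v p +
            g (Function.uncurry v p)) + Function.uncurry vt p * Function.uncurry vxt p) := rfl
      rw [e]
      fun_prop)
    (fun x t => by
      have e1 := ((h.hxx x t).pow 2).const_mul (1 / 2)
      have e2 := (((h.htx x t).pow 2).sub ((h.hx x t).pow 2)).const_mul (1 / 2)
      have e3 := (hG (v x t)).comp x (h.hx x t)
      refine ((e1.add e2).add e3).congr_deriv ?_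
      simp
      ring) x
  refine hd.congr_deriv ?_
  have hvx := h.x_periodic hper x 0
  have hvt := deriv_periodic (h.ht x) (hper x) 0
  rw [zero_add] at hvx hvt
  have d0 := h.slice_continuous x
  have d1 := h.slice_continuous_x x
  have d2 := h.slice_continuous_t x
  have d3 := h.slice_continuous_xx x
  have d4 := h.slice_continuous_xt x
  have d5 := h.slice_continuous_tt x
  have hp := intervalIntegral.integral_deriv_mul_eq_sub (a := 0) (b := T) (fun t _ => h.htt x t)
    (fun t _ => h.hxt x t) (d5.intervalIntegrable _ _) (d4.intervalIntegrable _ _)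
  rw [hvx, hvt, sub_self] at hp
  rw [← sub_eq_zero, ← intervalIntegral.integral_sub]
  · refine Eq.trans (intervalIntegral.integral_congr fun t _ => ?_) hp
    ring
  all_goals exact Continuous.intervalIntegrable (by fun_prop) _ _

end IsC2

/-- The part of the energy orthogonal to `sin (ω t)`. -/
def remEnergy (T ω : ℝ) (v vx vt : ℝ → ℝ → ℝ) (x : ℝ) : ℝ :=
  (∫ t in (0 : ℝ)..T, vx x t ^ 2) +
    ∫ t in (0 : ℝ)..T, (vt x t - sinCoeff T ω (v x) * (ω * cos (ω * t))) ^ 2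

theorem IsC2.continuous_sinCoeff (h : IsC2 v vx vt vxx vxt vtt) :
    Continuous fun x => sinCoeff T ω (v x) := by
  have c0 := h.continuous
  refine continuous_const.mul ?_
  refine intervalIntegral.continuous_parametric_intervalIntegral_of_continuous'
    (f := fun x t => v x t * sin (ω * t)) ?_ _ _
  have e : (Function.uncurry fun x t => v x t * sin (ω * t)) =
    fun p : ℝ × ℝ => Function.uncurry v p * sin (ω * p.2) := rfl
  rw [e]
  fun_prop

theorem IsC2.continuous_remEnergy (h : IsC2 v vx vt vxx vxt vtt) :
    Continuous (remEnergy T ω v vx vt) := by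
  have c1 := h.cx
  have c2 := h.ct
  have cs := h.continuous_sinCoeff (T := T) (ω := ω)
  refine Continuous.add ?_ ?_
  · refine intervalIntegral.continuous_parametric_intervalIntegral_of_continuous'
      (f := fun x t => vx x t ^ 2) ?_ _ _
    exact c1.pow 2
  · refine intervalIntegral.continuous_parametric_intervalIntegral_of_continuous'
      (f := fun x t => (vt x t - sinCoeff T ω (v x) * (ω * cos (ω * t))) ^ 2) ?_ _ _
    have e : (Function.uncurry fun x t => (vt x t - sinCoeff T ω (v x) * (ω * cos (ω * t))) ^ 2) =
      fun p : ℝ × ℝ => (Function.uncurry vt p -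
        (fun x => sinCoeff T ω (v x)) p.1 * (ω * cos (ω * p.2))) ^ 2 := rfl
    rw [e]
    have cs' : Continuous fun p : ℝ × ℝ => (fun x => sinCoeff T ω (v x)) p.1 :=
      cs.comp continuous_fst
    exact (c2.sub (cs'.mul (by fun_prop))).pow 2

theorem integral_sq_nonneg' {φ : ℝ → ℝ} {T : ℝ} (hT : 0 < T) : 0 ≤ ∫ t in (0 : ℝ)..T, φ t ^ 2 :=
  intervalIntegral.integral_nonneg hT.le fun _ _ => sq_nonneg _

/-- Coercivity of the energy away from `sin (ω t)`. -/
theorem energy_lower {w w' z : ℝ → ℝ} {G : ℝ → ℝ} {ε k : ℝ} (hT : 0 < T) (hω0 : 0 < ω)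
    (hω : ω * T = 2 * π) (hωε : ω ^ 2 = 1 - ε ^ 2) (hε : ε ^ 2 ≤ 1 / 2)
    (hd : ∀ t, HasDerivAt w (w' t) t) (hw' : Continuous w') (hz : Continuous z)
    (hodd : ∀ t, w (-t) = -w t) (hper : ∀ t, w (t + T) = w t)
    (hG : Continuous G) (hk : 0 ≤ k) (hGb : ∀ s, |G s| ≤ k * s ^ 2) :
    1 / 2 * (∫ t in (0 : ℝ)..T, z t ^ 2) +
      (1 / 4 - k / 2) *
        (∫ t in (0 : ℝ)..T, (w' t - sinCoeff T ω w * (ω * cos (ω * t))) ^ 2) -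
      (ε ^ 2 + k) * (T / 2) * sinCoeff T ω w ^ 2 ≤
    ∫ t in (0 : ℝ)..T, (1 / 2 * z t ^ 2 + 1 / 2 * (w' t ^ 2 - w t ^ 2) + G (w t)) := by
  have hw : Continuous w := continuous_iff_continuousAt.2 fun t => (hd t).continuousAt
  obtain ⟨h1, h2, -⟩ := slice_bounds hT hω0 hω hd hw' hodd hper
  set c := sinCoeff T ω w
  set H := ∫ t in (0 : ℝ)..T, (w' t - c * (ω * cos (ω * t))) ^ 2 with hH
  have hH0 : 0 ≤ H := integral_sq_nonneg' hT
  have h3 : (∫ t in (0 : ℝ)..T, w t ^ 2) ≤ c ^ 2 * (T / 2) + H / 2 := by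
    have h4 : 2 ≤ 4 * ω ^ 2 := by linarith
    have h5 : 4 * ω ^ 2 * ((∫ t in (0 : ℝ)..T, w t ^ 2) - c ^ 2 * (T / 2)) ≤ H := by linarith
    by_contra hc
    push Not at hc
    have : 4 * ω ^ 2 * (H / 2) < 4 * ω ^ 2 * ((∫ t in (0 : ℝ)..T, w t ^ 2) - c ^ 2 * (T / 2)) := by
      apply mul_lt_mul_of_pos_left _ (by positivity)
      linarith
    nlinarith
  have h4 : ∫ t in (0 : ℝ)..T, (1 / 2 * z t ^ 2 + 1 / 2 * (w' t ^ 2 - w t ^ 2) - k * w t ^ 2) ≤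
      ∫ t in (0 : ℝ)..T, (1 / 2 * z t ^ 2 + 1 / 2 * (w' t ^ 2 - w t ^ 2) + G (w t)) := by
    refine intervalIntegral.integral_mono_on hT.le ?_ ?_ fun t _ => ?_
    · exact Continuous.intervalIntegrable (by fun_prop) _ _
    · exact Continuous.intervalIntegrable (by fun_prop) _ _
    · linarith [(abs_le.1 (hGb (w t))).1]
  have h5 : ∫ t in (0 : ℝ)..T, (1 / 2 * z t ^ 2 + 1 / 2 * (w' t ^ 2 - w t ^ 2) - k * w t ^ 2) =
      1 / 2 * (∫ t in (0 : ℝ)..T, z t ^ 2) + 1 / 2 * ((∫ t in (0 : ℝ)..T, w' t ^ 2) -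
        ∫ t in (0 : ℝ)..T, w t ^ 2) - k * ∫ t in (0 : ℝ)..T, w t ^ 2 := by
    rw [intervalIntegral.integral_sub, intervalIntegral.integral_add,
      intervalIntegral.integral_const_mul, intervalIntegral.integral_const_mul,
      intervalIntegral.integral_sub, intervalIntegral.integral_const_mul]
    all_goals exact Continuous.intervalIntegrable (by fun_prop) _ _
  rw [h5, h2, hωε] at h4
  refine le_trans ?_ h4
  have h6 := mul_le_mul_of_nonneg_left h3 hk
  have h7 : 0 ≤ ε ^ 2 * c ^ 2 * T := by positivity
  linarith

end Energy

theorem exists_potential {g : ℝ → ℝ} (hg : Continuous g) {k : ℝ}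
    (hgb : ∀ s, |g s| ≤ k * |s|) (hk : 0 ≤ k) :
    ∃ G : ℝ → ℝ, (∀ s, HasDerivAt G (g s) s) ∧ ∀ s, |G s| ≤ k * s ^ 2 := by
  refine ⟨fun s => ∫ y in (0 : ℝ)..s, g y, fun s => ?_, fun s => ?_⟩
  · exact intervalIntegral.integral_hasDerivAt_right (hg.intervalIntegrable _ _)
      (hg.stronglyMeasurableAtFilter _ _) hg.continuousAt
  · have h := intervalIntegral.norm_integral_le_of_norm_le_const (a := 0) (b := s) (f := g)
      (C := k * |s|) fun y hy => by
        rw [Real.norm_eq_abs]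
        refine (hgb y).trans (mul_le_mul_of_nonneg_left ?_ hk)
        rcases le_total 0 s with hs | hs
        · rw [uIoc_of_le hs] at hy
          rw [abs_of_pos hy.1, abs_of_nonneg hs]
          exact hy.2
        · rw [uIoc_of_ge hs] at hy
          rw [abs_of_nonpos hy.2, abs_of_nonpos hs]
          linarith [hy.1]
    rw [Real.norm_eq_abs, sub_zero, mul_assoc, ← sq, sq_abs] at h
    exact h

section EnergyBound

variable {v vx vt vxx vxt vtt : ℝ → ℝ → ℝ} {T ω ε δ m n K : ℝ} {g G : ℝ → ℝ}

theorem abs_energy_deriv_le (h : IsC2 v vx vt vxx vxt vtt) (hT : 0 < T) (hε : 0 < ε)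
    (hK : 1 ≤ K) (hg : Continuous g) {x : ℝ}
    (hP : ∀ t, |vxx x t - vtt x t - v x t + g (v x t)| ≤
      ε ^ 2 * K * exp (-(ε * x)) * (|v x t| + ε * δ))
    (hA : ∫ t in (0 : ℝ)..T, vx x t ^ 2 ≤ n)
    (hB : ∫ t in (0 : ℝ)..T, v x t ^ 2 ≤ m ^ 2 * (T / 2) + n / 2) :
    |∫ t in (0 : ℝ)..T, vx x t * (vxx x t - vtt x t - v x t + g (v x t))| ≤
      ε * exp (-(ε * x)) * (n / 32 + 16 * K ^ 2 * ε ^ 2 *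
        (m ^ 2 * (T / 2) + n / 2 + ε ^ 2 * δ ^ 2 * T)) := by
  have d0 := h.slice_continuous x
  have d1 := h.slice_continuous_x x
  have d3 := h.slice_continuous_xx x
  have d5 := h.slice_continuous_tt x
  have hE := exp_pos (-(ε * x))
  set E := exp (-(ε * x))
  have hpt : ∀ t, |vx x t * (vxx x t - vtt x t - v x t + g (v x t))| ≤
      ε * E * (1 / 32 * vx x t ^ 2 + 16 * K ^ 2 * ε ^ 2 * (v x t ^ 2 + ε ^ 2 * δ ^ 2)) := by
    intro t
    rw [abs_mul]
    calc |vx x t| * |vxx x t - vtt x t - v x t + g (v x t)| ≤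
        |vx x t| * (ε ^ 2 * K * E * (|v x t| + ε * δ)) := by
          gcongr
          exact hP t
      _ = ε * E * ((ε * K * |vx x t|) * |v x t| + (ε * K * |vx x t|) * (ε * δ)) := by ring
      _ ≤ ε * E * (1 / 32 * |vx x t| ^ 2 + 16 * K ^ 2 * ε ^ 2 * (|v x t| ^ 2 + ε ^ 2 * δ ^ 2)) := by
          refine mul_le_mul_of_nonneg_left ?_ (by positivity)
          nlinarith [sq_nonneg (|vx x t| / 8 - 4 * K * ε * |v x t|),
            sq_nonneg (|vx x t| / 8 - 4 * K * ε * (ε * δ))]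
      _ = _ := by rw [sq_abs, sq_abs]
  refine (intervalIntegral.abs_integral_le_integral_abs hT.le).trans ?_
  refine (intervalIntegral.integral_mono_on hT.le ?_ ?_ fun t _ => hpt t).trans ?_
  · exact Continuous.intervalIntegrable (by fun_prop) _ _
  · exact Continuous.intervalIntegrable (by fun_prop) _ _
  · rw [intervalIntegral.integral_const_mul, intervalIntegral.integral_add,
      intervalIntegral.integral_const_mul, intervalIntegral.integral_const_mul,
      intervalIntegral.integral_add, intervalIntegral.integral_const, smul_eq_mul, sub_zero]
    · have h1 : 1 / 32 * ∫ t in (0 : ℝ)..T, vx x t ^ 2 ≤ n / 32 := by linarith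
      have h2 : T * (ε ^ 2 * δ ^ 2) = ε ^ 2 * δ ^ 2 * T := by ring
      rw [h2]
      gcongr
    all_goals exact Continuous.intervalIntegrable (by fun_prop) _ _

theorem energy_zero_le (hT : 0 < T) (hω0 : 0 < ω) (hω : ω * T = 2 * π) (hωε : ω ^ 2 = 1 - ε ^ 2)
    {a k : ℝ} (ha : |a| ≤ δ) (hk : 0 ≤ k) (hG : Continuous G) (hGb : ∀ s, |G s| ≤ k * s ^ 2)
    {z w w' : ℝ → ℝ} (hz : ∀ t, z t = 0) (hw : ∀ t, w t = a * sin (ω * t))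
    (hw' : ∀ t, w' t = a * (ω * cos (ω * t))) :
    ∫ t in (0 : ℝ)..T, (1 / 2 * z t ^ 2 + 1 / 2 * (w' t ^ 2 - w t ^ 2) + G (w t)) ≤
      k * δ ^ 2 * (T / 2) := by
  have ha2 : a ^ 2 ≤ δ ^ 2 := by
    rw [← sq_abs]
    exact pow_le_pow_left₀ (abs_nonneg _) ha 2
  have hle : ∫ t in (0 : ℝ)..T, (1 / 2 * z t ^ 2 + 1 / 2 * (w' t ^ 2 - w t ^ 2) + G (w t)) ≤
      ∫ t in (0 : ℝ)..T, (1 / 2 * a ^ 2 * ω ^ 2 * cos (ω * t) ^ 2 +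
        (k - 1 / 2) * a ^ 2 * sin (ω * t) ^ 2) := by
    simp only [hz, hw, hw']
    refine intervalIntegral.integral_mono_on hT.le ?_ ?_ fun t _ => ?_
    · exact Continuous.intervalIntegrable (by fun_prop) _ _
    · exact Continuous.intervalIntegrable (by fun_prop) _ _
    · have := (abs_le.1 (hGb (a * sin (ω * t)))).2
      nlinarith
  refine hle.trans ?_
  rw [intervalIntegral.integral_add, intervalIntegral.integral_const_mul,
    intervalIntegral.integral_const_mul, integral_cos_sq_period hω0 hω,
    integral_sin_sq_period hω0 hω, hωε]
  · have h1 : k * a ^ 2 * (T / 2) ≤ k * δ ^ 2 * (T / 2) := by gcongr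
    have h2 : 0 ≤ ε ^ 2 * a ^ 2 * (T / 2) := by positivity
    linarith
  all_goals exact Continuous.intervalIntegrable (by fun_prop) _ _

set_option maxHeartbeats 1000000 in
theorem remEnergy_le (h : IsC2 v vx vt vxx vxt vtt) (hT : 0 < T) (hω0 : 0 < ω)
    (hω : ω * T = 2 * π) (hωε : ω ^ 2 = 1 - ε ^ 2) (hε : 0 < ε) (hK : 1 ≤ K)
    (hεK : 32 * K * ε ≤ 1) (hg : Continuous g) (hgb : ∀ s, |g s| ≤ K * ε ^ 2 * |s|)
    (hodd : ∀ x t, v x (-t) = -v x t) (hper : ∀ x t, v x (t + T) = v x t)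
    (hvx0 : ∀ t, vx 0 t = 0) {a : ℝ} (ha : |a| ≤ δ) (hv0 : ∀ t, v 0 t = a * sin (ω * t))
    (hP : ∀ x t, 0 ≤ x → |vxx x t - vtt x t - v x t + g (v x t)| ≤
      ε ^ 2 * K * exp (-(ε * x)) * (|v x t| + ε * δ))
    {X : ℝ} (hX : 0 ≤ X) (hm : ∀ x ∈ Icc 0 X, |sinCoeff T ω (v x)| ≤ m) :
    ∀ x ∈ Icc 0 X, remEnergy T ω v vx vt x ≤ 200 * K ^ 2 * T * ε ^ 2 * (m ^ 2 + δ ^ 2) := by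
  have hε1 : ε ≤ 1 / 32 := by nlinarith
  have hε2 : ε ^ 2 ≤ 1 / 2 := by nlinarith
  have hk : 0 ≤ K * ε ^ 2 := by positivity
  have hK2 : K * ε ^ 2 ≤ 1 / 32 := by nlinarith
  have hK3 : K ^ 2 * ε ^ 2 ≤ 1 / 1024 := by
    have : (K * ε) ^ 2 ≤ (1 / 32) ^ 2 := pow_le_pow_left₀ (by positivity) (by linarith) 2
    rw [mul_pow] at this
    linarith
  obtain ⟨G, hG, hGb⟩ := exists_potential hg hgb hk
  have hGc : Continuous G := continuous_iff_continuousAt.2 fun s => (hG s).continuousAt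
  have hrc := h.continuous_remEnergy (T := T) (ω := ω)
  obtain ⟨x₀, hx₀, hmax⟩ := (isCompact_Icc (a := 0) (b := X)).exists_isMaxOn
    (nonempty_Icc.2 hX) hrc.continuousOn
  set n := remEnergy T ω v vx vt x₀ with hn
  have hmax' : ∀ x ∈ Icc 0 X, remEnergy T ω v vx vt x ≤ n := fun x hx => hmax hx
  have hn0 : 0 ≤ n := add_nonneg (integral_sq_nonneg' hT) (integral_sq_nonneg' hT)
  have hm2 : ∀ x ∈ Icc 0 X, sinCoeff T ω (v x) ^ 2 ≤ m ^ 2 := fun x hx => by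
    rw [← sq_abs]
    exact pow_le_pow_left₀ (abs_nonneg _) (hm x hx) 2
  set V := fun x => ∫ t in (0 : ℝ)..T,
        (1 / 2 * vx x t ^ 2 + 1 / 2 * (vt x t ^ 2 - v x t ^ 2) + G (v x t)) with hV
  set Q := n / 32 + 16 * K ^ 2 * ε ^ 2 * (m ^ 2 * (T / 2) + n / 2 + ε ^ 2 * δ ^ 2 * T) with hQ
  have hQ0 : 0 ≤ Q := by positivity
  have hVd : ∀ x, HasDerivAt V _ x := fun x => h.hasDerivAt_energy hg hG hper x
  have hVle : ∀ x ∈ Icc 0 X, V x ≤ V 0 + Q := by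
    intro x hx
    have hWd : ∀ y, HasDerivAt (fun y => V y + Q * exp (-(ε * y))) _ y := fun y =>
      (hVd y).add ((((hasDerivAt_id y).const_mul ε).neg.exp).const_mul Q)
    have hanti : AntitoneOn (fun y => V y + Q * exp (-(ε * y))) (Icc 0 X) := by
      refine antitoneOn_of_hasDerivWithinAt_nonpos (convex_Icc 0 X)
        (fun y _ => (hWd y).continuousAt.continuousWithinAt)
        (fun y _ => (hWd y).hasDerivWithinAt) fun y hy => ?_
      rw [interior_Icc] at hy
      have hy' : y ∈ Icc 0 X := Ioo_subset_Icc_self hy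
      have hr := hmax' y hy'
      have hA : ∫ t in (0 : ℝ)..T, vx y t ^ 2 ≤ n :=
        le_trans (le_add_of_nonneg_right (integral_sq_nonneg' hT)) hr
      have hH : ∫ t in (0 : ℝ)..T, (vt y t - sinCoeff T ω (v y) * (ω * cos (ω * t))) ^ 2 ≤ n :=
        le_trans (le_add_of_nonneg_left (integral_sq_nonneg' hT)) hr
      have hB : ∫ t in (0 : ℝ)..T, v y t ^ 2 ≤ m ^ 2 * (T / 2) + n / 2 := by
        obtain ⟨h1, -, -⟩ := slice_bounds hT hω0 hω (h.ht y) (h.slice_continuous_t y)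
          (hodd y) (hper y)
        have h2 : 2 ≤ 4 * ω ^ 2 := by linarith
        have h3 : sinCoeff T ω (v y) ^ 2 * (T / 2) ≤ m ^ 2 * (T / 2) := by
          have := hm2 y hy'
          gcongr
        have h4 : n ≤ 4 * ω ^ 2 * (n / 2) := by nlinarith
        refine le_of_mul_le_mul_left (a := 4 * ω ^ 2) ?_ (by positivity)
        have h5 := mul_le_mul_of_nonneg_left h3 (by positivity : 0 ≤ 4 * ω ^ 2)
        rw [mul_add]
        linarith
      have := (abs_le.1 (abs_energy_deriv_le h hT hε hK hg (fun t => hP y t hy.1.le) hA hB)).2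
      rw [← hQ] at this
      simp only [Pi.neg_apply, id_eq, mul_one]
      linarith
    have h1 := hanti (left_mem_Icc.2 hX) hx hx.1
    simp only [mul_zero, neg_zero, exp_zero, mul_one] at h1
    have h2 : 0 ≤ Q * exp (-(ε * x)) := mul_nonneg hQ0 (exp_pos _).le
    linarith
  have hV0 : V 0 ≤ K * ε ^ 2 * δ ^ 2 * (T / 2) := by
    refine energy_zero_le hT hω0 hω hωε ha hk hGc hGb hvx0 hv0 fun t => ?_
    have h1 : v 0 = fun t => a * sin (ω * t) := funext hv0
    have h2 := h.ht 0 t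
    rw [h1] at h2
    exact h2.unique ((hasDerivAt_sin_const_mul ω t).const_mul a)
  have hlow := energy_lower hT hω0 hω hωε hε2 (h.ht x₀) (h.slice_continuous_t x₀)
    (h.slice_continuous_x x₀) (hodd x₀) (hper x₀) hGc hk hGb
  have hup := hVle x₀ hx₀
  intro x hx
  refine (hmax' x hx).trans ?_
  have hA0 : 0 ≤ ∫ t in (0 : ℝ)..T, vx x₀ t ^ 2 := integral_sq_nonneg' hT
  have hH0 : 0 ≤ ∫ t in (0 : ℝ)..T,
    (vt x₀ t - sinCoeff T ω (v x₀) * (ω * cos (ω * t))) ^ 2 := integral_sq_nonneg' hT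
  have hnn : n = (∫ t in (0 : ℝ)..T, vx x₀ t ^ 2) + ∫ t in (0 : ℝ)..T,
    (vt x₀ t - sinCoeff T ω (v x₀) * (ω * cos (ω * t))) ^ 2 := hn
  set A := ∫ t in (0 : ℝ)..T, vx x₀ t ^ 2
  set H := ∫ t in (0 : ℝ)..T, (vt x₀ t - sinCoeff T ω (v x₀) * (ω * cos (ω * t))) ^ 2
  have k1 : (1 / 4 - 1 / 64) * n ≤ 1 / 2 * A + (1 / 4 - K * ε ^ 2 / 2) * H := by
    rw [hnn]
    have := mul_le_mul_of_nonneg_right hK2 hH0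
    linarith
  have k2 : (ε ^ 2 + K * ε ^ 2) * (T / 2) * sinCoeff T ω (v x₀) ^ 2 ≤ K * ε ^ 2 * T * m ^ 2 := by
    calc (ε ^ 2 + K * ε ^ 2) * (T / 2) * sinCoeff T ω (v x₀) ^ 2 ≤
        (K * ε ^ 2 + K * ε ^ 2) * (T / 2) * m ^ 2 := by
          refine mul_le_mul ?_ (hm2 x₀ hx₀) (sq_nonneg _) (by positivity)
          have := le_mul_of_one_le_left (sq_nonneg ε) hK
          gcongr
      _ = _ := by ring
  have k3 : Q ≤ n / 32 + n / 128 + 8 * K ^ 2 * ε ^ 2 * T * m ^ 2 + 1 / 64 * ε ^ 2 * δ ^ 2 * T := by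
    have e1 : K ^ 2 * ε ^ 2 * n ≤ 1 / 1024 * n := mul_le_mul_of_nonneg_right hK3 hn0
    have e2 : K ^ 2 * ε ^ 2 * (ε ^ 2 * δ ^ 2 * T) ≤ 1 / 1024 * (ε ^ 2 * δ ^ 2 * T) :=
      mul_le_mul_of_nonneg_right hK3 (by positivity)
    rw [hQ]
    linarith
  have hKK : K ≤ K ^ 2 := le_self_pow₀ hK two_ne_zero
  have k4 : K * (ε ^ 2 * T * m ^ 2) ≤ K ^ 2 * (ε ^ 2 * T * m ^ 2) :=
    mul_le_mul_of_nonneg_right hKK (by positivity)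
  have k5 : K * (ε ^ 2 * T * δ ^ 2) ≤ K ^ 2 * (ε ^ 2 * T * δ ^ 2) :=
    mul_le_mul_of_nonneg_right hKK (by positivity)
  have k6 : 1 * (ε ^ 2 * T * δ ^ 2) ≤ K ^ 2 * (ε ^ 2 * T * δ ^ 2) :=
    mul_le_mul_of_nonneg_right (hK.trans hKK) (by positivity)
  have k7 : 0 ≤ K ^ 2 * (ε ^ 2 * T * m ^ 2) := by positivity
  have k8 : 0 ≤ K ^ 2 * (ε ^ 2 * T * δ ^ 2) := by positivity
  have hup' := hlow.trans hup
  clear_value n A H Q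
  clear hVle hmax' hmax hVd hm2 hm
  linarith

end EnergyBound

theorem abs_sub_le_of_hasDerivAt {φ φ' : ℝ → ℝ} {C : ℝ} (hd : ∀ x, HasDerivAt φ (φ' x) x)
    {a b : ℝ} (hC : ∀ x ∈ uIcc a b, |φ' x| ≤ C) : |φ b - φ a| ≤ C * |b - a| :=
  (convex_uIcc a b).norm_image_sub_le_of_norm_hasDerivWithin_le
    (fun x _ => (hd x).hasDerivWithinAt) hC left_mem_uIcc right_mem_uIcc

/-- A globally Lipschitz modification of `f` outside `[-M, M]`. -/
theorem exists_cutoff {f f' f'' : ℝ → ℝ} (hodd : ∀ x, f (-x) = -f x)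
    (hf : ∀ x, HasDerivAt f (f' x) x) (hf' : ∀ x, HasDerivAt f' (f'' x) x)
    (heven : ∀ x, f' (-x) = f' x) (hf'0 : f' 0 = 0) {K M : ℝ}
    (hf'' : ∀ x, |x| ≤ 1 → |f'' x| ≤ K * |x|) (hK : 0 ≤ K) (hM : 0 < M) (hM1 : M ≤ 1) :
    ∃ g g' : ℝ → ℝ, (∀ s, HasDerivAt g (g' s) s) ∧ Continuous g' ∧ (∀ s, g (-s) = -g s) ∧
      (∀ s, |s| ≤ M → g s = f s ∧ g' s = f' s) ∧ (∀ s, |g' s| ≤ K * M ^ 2) ∧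
      (∀ s r, |g' s - g' r| ≤ K * M * |s - r|) := by
  have hLip : ∀ s r, |s| ≤ M → |r| ≤ M → |f' s - f' r| ≤ K * M * |s - r| := by
    intro s r hs hr
    refine abs_sub_le_of_hasDerivAt hf' fun x hx => ?_
    have hx' : |x| ≤ M := by
      rw [abs_le] at hs hr ⊢
      exact uIcc_subset_Icc hr hs hx
    exact (hf'' x (hx'.trans hM1)).trans (mul_le_mul_of_nonneg_left hx' hK)
  set cl : ℝ → ℝ := fun s => max (-M) (min M s) with hcl
  have hclM : ∀ s, |cl s| ≤ M := fun s =>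
    abs_le.2 ⟨le_max_left _ _, max_le (by linarith) (min_le_left _ _)⟩
  have hcls : ∀ s, |s| ≤ M → cl s = s := fun s hs => by
    obtain ⟨h1, h2⟩ := abs_le.1 hs
    rw [hcl]
    simp only
    rw [min_eq_right h2, max_eq_right h1]
  have hcln : ∀ s, cl (-s) = -cl s := fun s => by
    simp only [hcl, max_def, min_def]
    split_ifs <;> linarith
  have hclL : ∀ s r, |cl s - cl r| ≤ |s - r| := fun s r => by
    have h1 := abs_max_sub_max_le_abs (min M s) (min M r) (-M)
    have h2 := abs_min_sub_min_le_max M s M r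
    rw [sub_self, abs_zero, max_eq_right (abs_nonneg _)] at h2
    simp only [hcl]
    rw [max_comm (-M), max_comm (-M)]
    exact h1.trans h2
  have hfc : Continuous f' := continuous_iff_continuousAt.2 fun s => (hf' s).continuousAt
  have hclc : Continuous cl := by fun_prop
  have hc : Continuous fun s => f' (cl s) := hfc.comp hclc
  set g : ℝ → ℝ := fun s => ∫ y in (0 : ℝ)..s, f' (cl y) with hg
  have hgd : ∀ s, HasDerivAt g (f' (cl s)) s := fun s =>
    intervalIntegral.integral_hasDerivAt_right (hc.intervalIntegrable _ _)
      (hc.stronglyMeasurableAtFilter _ _) hc.continuousAt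
  refine ⟨g, fun s => f' (cl s), hgd, hc, fun s => ?_, fun s hs => ⟨?_, by simp only [hcls s hs]⟩,
    fun s => ?_, fun s r => ?_⟩
  · have h1 := intervalIntegral.integral_comp_neg (fun y => f' (cl y)) (a := 0) (b := s)
    simp only [hcln, heven, neg_zero] at h1
    simp only [hg]
    rw [h1, intervalIntegral.integral_symm]
  · have hf0 : f 0 = 0 := by
      have := hodd 0
      rw [neg_zero] at this
      linarith
    have h1 : ∫ y in (0 : ℝ)..s, f' y = f s - f 0 :=
      intervalIntegral.integral_eq_sub_of_hasDerivAt (fun x _ => hf x)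
        (hfc.intervalIntegrable _ _)
    rw [hf0, sub_zero] at h1
    rw [← h1]
    refine intervalIntegral.integral_congr fun y hy => ?_
    rw [hcls]
    rw [abs_le] at hs ⊢
    exact uIcc_subset_Icc (by constructor <;> linarith) hs hy
  · have h1 := hLip (cl s) 0 (hclM s) (by rw [abs_zero]; exact hM.le)
    rw [hf'0, sub_zero, sub_zero] at h1
    refine h1.trans ?_
    rw [sq, ← mul_assoc]
    exact mul_le_mul_of_nonneg_left (hclM s) (by positivity)
  · exact (hLip _ _ (hclM s) (hclM r)).trans (mul_le_mul_of_nonneg_left (hclL s r) (by positivity))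

section Remainder

variable {g g' : ℝ → ℝ} {k : ℝ}

theorem abs_le_of_odd_hasDerivAt (hg : ∀ s, HasDerivAt g (g' s) s) (hodd : ∀ s, g (-s) = -g s)
    (hb : ∀ s, |g' s| ≤ k) (s : ℝ) : |g s| ≤ k * |s| := by
  have h0 : g 0 = 0 := by
    have := hodd 0
    rw [neg_zero] at this
    linarith
  have := abs_sub_le_of_hasDerivAt (a := 0) (b := s) hg fun x _ => hb x
  rwa [h0, sub_zero, sub_zero] at this

theorem abs_add_sub_sub_le (hg : ∀ s, HasDerivAt g (g' s) s) (hodd : ∀ s, g (-s) = -g s)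
    (hl : ∀ s r, |g' s - g' r| ≤ k * |s - r|) (q v : ℝ) :
    |g (q + v) - g q - g v| ≤ k * |v| * |q| := by
  have h0 : g 0 = 0 := by
    have := hodd 0
    rw [neg_zero] at this
    linarith
  have := abs_sub_le_of_hasDerivAt (φ := fun q => g (q + v) - g q) (a := 0) (b := q) (C := k * |v|)
    (fun x => ((hg (x + v)).comp_add_const x v).sub (hg x)) fun x _ => by
      have := hl (x + v) x
      rwa [add_sub_cancel_left] at this
  simp only [zero_add, h0, sub_zero] at this
  exact this

theorem abs_add_sub_sub_mul_le (hg : ∀ s, HasDerivAt g (g' s) s) (hk : 0 ≤ k)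
    (hl : ∀ s r, |g' s - g' r| ≤ k * |s - r|) (q v : ℝ) :
    |g (q + v) - g q - g' q * v| ≤ k * v ^ 2 := by
  have := abs_sub_le_of_hasDerivAt (φ := fun v => g (q + v) - g' q * v) (a := 0) (b := v)
    (C := k * |v|)
    (fun x => ((hg (q + x)).comp_const_add q x).sub ((hasDerivAt_id x).const_mul (g' q)))
    fun x hx => by
      have h1 := hl (q + x) q
      rw [add_sub_cancel_left] at h1
      rw [mul_one]
      refine h1.trans (mul_le_mul_of_nonneg_left ?_ hk)
      have := abs_sub_left_of_mem_uIcc hx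
      simpa using this
  simp only [add_zero, mul_zero, sub_zero, mul_assoc, ← sq, sq_abs] at this
  rwa [sub_right_comm] at this

end Remainder

section SinCoeff

variable {T ω : ℝ} {w w₁ w₂ : ℝ → ℝ}

theorem sinCoeff_add (h1 : Continuous w₁) (h2 : Continuous w₂) :
    sinCoeff T ω (fun t => w₁ t + w₂ t) = sinCoeff T ω w₁ + sinCoeff T ω w₂ := by
  simp only [sinCoeff, add_mul]
  rw [intervalIntegral.integral_add, mul_add]
  all_goals exact Continuous.intervalIntegrable (by fun_prop) _ _

theorem sinCoeff_sub (h1 : Continuous w₁) (h2 : Continuous w₂) :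
    sinCoeff T ω (fun t => w₁ t - w₂ t) = sinCoeff T ω w₁ - sinCoeff T ω w₂ := by
  simp only [sinCoeff, sub_mul]
  rw [intervalIntegral.integral_sub, mul_sub]
  all_goals exact Continuous.intervalIntegrable (by fun_prop) _ _

theorem sinCoeff_mul_sin (hT : 0 < T) (hω0 : 0 < ω) (hω : ω * T = 2 * π) (A : ℝ) :
    sinCoeff T ω (fun t => A * sin (ω * t)) = A := by
  have e : ∀ t, A * sin (ω * t) * sin (ω * t) = A * sin (ω * t) ^ 2 := fun t => by ring
  simp only [sinCoeff, e]
  rw [intervalIntegral.integral_const_mul, integral_sin_sq_period hω0 hω]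
  field_simp

theorem sinCoeff_mul_sin_cube (hT : 0 < T) (hω0 : 0 < ω) (hω : ω * T = 2 * π) (A : ℝ) :
    sinCoeff T ω (fun t => A * sin (ω * t) ^ 3) = 3 / 4 * A := by
  have e : ∀ t, A * sin (ω * t) ^ 3 * sin (ω * t) = A * sin (ω * t) ^ 4 := fun t => by ring
  simp only [sinCoeff, e]
  rw [intervalIntegral.integral_const_mul, integral_sin_pow_four_period hω0 hω]
  field_simp
  ring

theorem abs_sinCoeff_le (hT : 0 < T) {B : ℝ} (hB : ∀ t, |w t| ≤ B) :
    |sinCoeff T ω w| ≤ 2 * B := by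
  have h := intervalIntegral.norm_integral_le_of_norm_le_const (a := 0) (b := T)
    (f := fun t => w t * sin (ω * t)) (C := B) fun t _ => by
      rw [Real.norm_eq_abs, abs_mul]
      exact (mul_le_of_le_one_right (abs_nonneg _) (abs_sin_le_one _)).trans (hB t)
  rw [Real.norm_eq_abs, sub_zero, abs_of_pos hT] at h
  rw [sinCoeff, abs_mul, abs_of_pos (by positivity : 0 < 2 / T)]
  calc 2 / T * |∫ t in (0 : ℝ)..T, w t * sin (ω * t)| ≤ 2 / T * (B * T) := by gcongr
    _ = 2 * B := by field_simp

theorem sinCoeff_deriv_deriv (hω : ω * T = 2 * π) {w' w'' : ℝ → ℝ}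
    (hd : ∀ t, HasDerivAt w (w' t) t) (hd' : ∀ t, HasDerivAt w' (w'' t) t)
    (hw'' : Continuous w'') (hper : ∀ t, w (t + T) = w t) :
    sinCoeff T ω w'' = -ω ^ 2 * sinCoeff T ω w := by
  have hw' : Continuous w' := continuous_iff_continuousAt.2 fun t => (hd' t).continuousAt
  have h1 := integral_deriv_mul_cos hω hd hw' hper
  have h2 := intervalIntegral.integral_deriv_mul_eq_sub (a := 0) (b := T) (fun t _ => hd' t)
    (fun t _ => hasDerivAt_sin_const_mul ω t) (Continuous.intervalIntegrable (by fun_prop) _ _)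
    (Continuous.intervalIntegrable (by fun_prop) _ _)
  rw [hω, sin_two_pi, mul_zero, mul_zero, sin_zero, mul_zero, sub_self,
    intervalIntegral.integral_add] at h2
  · have e : ∀ t, w' t * (ω * cos (ω * t)) = ω * (w' t * cos (ω * t)) := fun t => by ring
    simp only [e] at h2
    rw [intervalIntegral.integral_const_mul, h1] at h2
    rw [sinCoeff, sinCoeff, eq_neg_of_add_eq_zero_left h2]
    ring
  all_goals exact Continuous.intervalIntegrable (by fun_prop) _ _

theorem hasDerivAt_sinCoeff {k k' : ℝ → ℝ → ℝ} (hk : ∀ x, Continuous (k x))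
    (hk' : Continuous (Function.uncurry k')) (hd : ∀ x t, HasDerivAt (fun y => k y t) (k' x t) x)
    (x : ℝ) : HasDerivAt (fun x => sinCoeff T ω (k x)) (sinCoeff T ω (k' x)) x := by
  refine (hasDerivAt_intervalIntegral_param (k := fun x t => k x t * sin (ω * t))
    (k' := fun x t => k' x t * sin (ω * t)) (fun x => ?_) ?_ (fun x t => ?_) x).const_mul (2 / T)
  · have := hk x
    fun_prop
  · have e : (Function.uncurry fun x t => k' x t * sin (ω * t)) =
      fun p : ℝ × ℝ => Function.uncurry k' p * sin (ω * p.2) := rfl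
    rw [e]
    fun_prop
  · exact (hd x t).mul_const _

theorem continuous_sinCoeff_param {X : Type*} [TopologicalSpace X] {F : X → ℝ → ℝ}
    (hF : Continuous (Function.uncurry F)) : Continuous fun x => sinCoeff T ω (F x) := by
  refine continuous_const.mul ?_
  refine intervalIntegral.continuous_parametric_intervalIntegral_of_continuous'
    (f := fun x t => F x t * sin (ω * t)) ?_ _ _
  have e : (Function.uncurry fun x t => F x t * sin (ω * t)) =
    fun p : X × ℝ => Function.uncurry F p * sin (ω * p.2) := rfl
  rw [e]
  fun_prop

/-- The `sin (ω t)` component of the linearised nonlinearity. -/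
theorem abs_sinCoeff_resid_le (hT : 0 < T) (hω0 : 0 < ω) (hω : ω * T = 2 * π)
    {g g' q v R : ℝ → ℝ} (hg : Continuous g) (hq : Continuous q) (hv : Continuous v)
    (hR : Continuous R) {α b σ ε K c μ : ℝ} (hα : 0 ≤ α) (hαK : α ≤ K) (hb : 0 ≤ b) (hbK : b ≤ K)
    (hbα : b * α ^ 2 = 8) (hσ : 0 ≤ σ) (hσε : σ ≤ ε) (hε : 0 < ε) (hK : 1 ≤ K) (hKε : K * ε ≤ 1)
    (hμ0 : 0 ≤ μ) (hμ : μ ≤ 2 * ε ^ 2)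
    (hqs : ∀ t, |q t - α * σ * sin (ω * t)| ≤ K * ε ^ 2) (hqb : ∀ t, |q t| ≤ K * ε)
    (hRb : ∀ t, |R t| ≤ ε ^ 3 * μ) (hc : |c| ≤ μ)
    (hvb : ∀ t, |v t - c * sin (ω * t)| ≤ K * ε * μ)
    (h1 : ∀ q v, |g (q + v) - g q - g' q * v| ≤ K * ε * v ^ 2)
    (h2 : ∀ t, |g' (q t) - b * q t ^ 2| ≤ K * |q t| ^ 3) :
    |sinCoeff T ω (fun t => g (q t + v t) - g (q t) + R t) - 6 * σ ^ 2 * c| ≤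
      46 * K ^ 4 * ε ^ 3 * μ := by
  have hK0 : 0 ≤ K := by linarith
  have e6 : 6 * σ ^ 2 * c = sinCoeff T ω (fun t => 8 * σ ^ 2 * c * sin (ω * t) ^ 3) := by
    rw [sinCoeff_mul_sin_cube hT hω0 hω]
    ring
  rw [e6, ← sinCoeff_sub (by fun_prop) (by fun_prop)]
  have e46 : 46 * K ^ 4 * ε ^ 3 * μ = 2 * (23 * K ^ 4 * ε ^ 3 * μ) := by ring
  rw [e46]
  refine abs_sinCoeff_le hT fun t => ?_
  have hv2 : |v t| ≤ 2 * μ := by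
    have e : v t = (v t - c * sin (ω * t)) + c * sin (ω * t) := by ring
    rw [e]
    refine (abs_add_le _ _).trans ?_
    have k1 : |c * sin (ω * t)| ≤ μ := by
      rw [abs_mul]
      exact (mul_le_of_le_one_right (abs_nonneg _) (abs_sin_le_one _)).trans hc
    have k2 : K * ε * μ ≤ 1 * μ := mul_le_mul_of_nonneg_right hKε hμ0
    linarith [hvb t]
  set s := sin (ω * t) with hs
  have hs1 : |s| ≤ 1 := abs_sin_le_one _
  have t1 : |g (q t + v t) - g (q t) - g' (q t) * v t| ≤ 8 * (K * ε ^ 3 * μ) := by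
    refine (h1 _ _).trans ?_
    calc K * ε * v t ^ 2 = K * ε * (|v t| * |v t|) := by rw [← sq, sq_abs]
      _ ≤ K * ε * ((2 * (2 * ε ^ 2)) * (2 * μ)) := by
          refine mul_le_mul_of_nonneg_left ?_ (by positivity)
          exact mul_le_mul (hv2.trans (by linarith)) hv2 (abs_nonneg _) (by positivity)
      _ = _ := by ring
  have t2 : |(g' (q t) - b * q t ^ 2) * v t| ≤ 2 * (K ^ 4 * ε ^ 3 * μ) := by
    rw [abs_mul]
    calc |g' (q t) - b * q t ^ 2| * |v t| ≤ (K * (K * ε) ^ 3) * (2 * μ) := by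
          refine mul_le_mul ((h2 t).trans ?_) hv2 (abs_nonneg _) (by positivity)
          exact mul_le_mul_of_nonneg_left (pow_le_pow_left₀ (abs_nonneg _) (hqb t) 3) hK0
      _ = _ := by ring
  have t3 : |b * (q t - α * σ * s) * (q t + α * σ * s) * v t| ≤ 4 * (K ^ 3 * ε ^ 3 * μ) := by
    rw [abs_mul, abs_mul, abs_mul, abs_of_nonneg hb]
    have k1 : |q t + α * σ * s| ≤ 2 * (K * ε) := by
      refine (abs_add_le _ _).trans ?_
      have : |α * σ * s| ≤ K * ε := by
        rw [abs_mul, abs_of_nonneg (mul_nonneg hα hσ)]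
        refine (mul_le_of_le_one_right (mul_nonneg hα hσ) hs1).trans ?_
        exact mul_le_mul hαK hσε hσ hK0
      linarith [hqb t]
    calc b * |q t - α * σ * s| * |q t + α * σ * s| * |v t| ≤
        K * (K * ε ^ 2) * (2 * (K * ε)) * (2 * μ) := by
          have := hqs t
          gcongr
      _ = _ := by ring
  have t4 : |8 * σ ^ 2 * s ^ 2 * (v t - c * s)| ≤ 8 * (K * ε ^ 3 * μ) := by
    rw [abs_mul, abs_of_nonneg (by positivity : 0 ≤ 8 * σ ^ 2 * s ^ 2)]
    have k1 : s ^ 2 ≤ 1 := (sq_le_one_iff_abs_le_one s).2 hs1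
    calc 8 * σ ^ 2 * s ^ 2 * |v t - c * s| ≤ 8 * ε ^ 2 * 1 * (K * ε * μ) := by
          have := hvb t
          gcongr
      _ = _ := by ring
  have e : g (q t + v t) - g (q t) + R t - 8 * σ ^ 2 * c * s ^ 3 =
      (g (q t + v t) - g (q t) - g' (q t) * v t) + (g' (q t) - b * q t ^ 2) * v t +
      b * (q t - α * σ * s) * (q t + α * σ * s) * v t + 8 * σ ^ 2 * s ^ 2 * (v t - c * s) + R t := by
    rw [← hbα]
    ring
  rw [e]
  have a1 := abs_add_le ((g (q t + v t) - g (q t) - g' (q t) * v t) +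
      (g' (q t) - b * q t ^ 2) * v t + b * (q t - α * σ * s) * (q t + α * σ * s) * v t +
      8 * σ ^ 2 * s ^ 2 * (v t - c * s)) (R t)
  have a2 := abs_add_le ((g (q t + v t) - g (q t) - g' (q t) * v t) +
      (g' (q t) - b * q t ^ 2) * v t + b * (q t - α * σ * s) * (q t + α * σ * s) * v t)
      (8 * σ ^ 2 * s ^ 2 * (v t - c * s))
  have a3 := abs_add_le ((g (q t + v t) - g (q t) - g' (q t) * v t) +
      (g' (q t) - b * q t ^ 2) * v t) (b * (q t - α * σ * s) * (q t + α * σ * s) * v t)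
  have a4 := abs_add_le (g (q t + v t) - g (q t) - g' (q t) * v t)
      ((g' (q t) - b * q t ^ 2) * v t)
  have hP : 0 ≤ ε ^ 3 * μ := by positivity
  have p1 : K * (ε ^ 3 * μ) ≤ K ^ 4 * (ε ^ 3 * μ) :=
    mul_le_mul_of_nonneg_right (le_self_pow₀ hK (by norm_num)) hP
  have p3 : K ^ 3 * (ε ^ 3 * μ) ≤ K ^ 4 * (ε ^ 3 * μ) :=
    mul_le_mul_of_nonneg_right (pow_le_pow_right₀ hK (by norm_num)) hP
  have p0 : 1 * (ε ^ 3 * μ) ≤ K ^ 4 * (ε ^ 3 * μ) :=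
    mul_le_mul_of_nonneg_right (one_le_pow₀ hK) hP
  have hRt := hRb t
  have q1 : K * ε ^ 3 * μ = K * (ε ^ 3 * μ) := by ring
  have q3 : K ^ 3 * ε ^ 3 * μ = K ^ 3 * (ε ^ 3 * μ) := by ring
  have q4 : K ^ 4 * ε ^ 3 * μ = K ^ 4 * (ε ^ 3 * μ) := by ring
  have q5 : 23 * K ^ 4 * ε ^ 3 * μ = 23 * (K ^ 4 * (ε ^ 3 * μ)) := by ring
  rw [q1] at t1 t4
  rw [q4] at t2
  rw [q3] at t3
  rw [q5]
  generalize K ^ 4 * (ε ^ 3 * μ) = A4 at *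
  generalize K ^ 3 * (ε ^ 3 * μ) = A3 at *
  generalize K * (ε ^ 3 * μ) = A1 at *
  linarith

end SinCoeff

section Galerkin

variable {v vx vt vxx vxt vtt q R : ℝ → ℝ → ℝ} {T ω ε δ K α b a : ℝ} {g g' : ℝ → ℝ}

/-- A perturbation of the approximate solution is controlled by its `sin (ω t)` component, which
satisfies the linearised profile equation up to a small residual. -/
theorem perturbation_bounds (h : IsC2 v vx vt vxx vxt vtt) (hT : 0 < T) (hT9 : T ≤ 9)
    (hω0 : 0 < ω) (hω : ω * T = 2 * π) (hωε : ω ^ 2 = 1 - ε ^ 2) (hε : 0 < ε) (hK : 1 ≤ K)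
    (hKε : 128 * K ^ 2 * ε ≤ 1) (hg : ∀ s, HasDerivAt g (g' s) s) (hgodd : ∀ s, g (-s) = -g s)
    (hgb : ∀ s, |g' s| ≤ K * ε ^ 2) (hgl : ∀ s r, |g' s - g' r| ≤ K * ε * |s - r|)
    (hα : 0 ≤ α) (hαK : α ≤ K) (hb : 0 ≤ b) (hbK : b ≤ K) (hbα : b * α ^ 2 = 8)
    (hgq : ∀ x t, |g' (q x t) - b * q x t ^ 2| ≤ K * |q x t| ^ 3) (hq : ∀ x, Continuous (q x))
    (hqs : ∀ x t, |q x t - α * (ε / cosh (ε * x)) * sin (ω * t)| ≤ K * ε ^ 2)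
    (hqe : ∀ x t, |q x t| ≤ K * ε * exp (-(ε * x))) (hqb : ∀ x t, |q x t| ≤ K * ε)
    (hR : ∀ x, Continuous (R x)) (hRb : ∀ x t, |R x t| ≤ ε ^ 3 * δ * exp (-(ε * x)))
    (hodd : ∀ x t, v x (-t) = -v x t) (hper : ∀ x t, v x (t + T) = v x t)
    (hvx0 : ∀ t, vx 0 t = 0) (ha : |a| ≤ δ) (hv0 : ∀ t, v 0 t = a * sin (ω * t))
    (heq : ∀ x t, vxx x t = vtt x t + v x t - (g (q x t + v x t) - g (q x t)) - R x t)
    (hδε : δ ≤ ε ^ 2) {m X : ℝ} (hm0 : 0 ≤ m) (hmε : m ≤ ε ^ 2)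
    (hm : ∀ x ∈ Icc 0 X, |sinCoeff T ω (v x)| ≤ m) :
    ∀ x ∈ Icc 0 X, remEnergy T ω v vx vt x ≤ 200 * (K ^ 2) ^ 2 * T * ε ^ 2 * (m ^ 2 + δ ^ 2) ∧
      (∀ t, |v x t - sinCoeff T ω (v x) * sin (ω * t)| ≤ 128 * K ^ 2 * ε * (m + δ)) ∧
      |sinCoeff T ω (vxx x) - (ε ^ 2 - 6 * (ε / cosh (ε * x)) ^ 2) * sinCoeff T ω (v x)| ≤
        46 * (128 * K ^ 2) ^ 4 * ε ^ 3 * (m + δ) := by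
  intro x hx
  have hX : 0 ≤ X := hx.1.trans hx.2
  have hδ : 0 ≤ δ := (abs_nonneg _).trans ha
  have hK2 : 1 ≤ K ^ 2 := one_le_pow₀ hK
  have hKK : K ≤ K ^ 2 := le_self_pow₀ hK two_ne_zero
  have hK0 : 0 ≤ K := by linarith
  have hK128 : K ≤ 128 * K ^ 2 := by linarith
  have hgc : Continuous g := continuous_iff_continuousAt.2 fun s => (hg s).continuousAt
  have hrem := remEnergy_le h hT hω0 hω hωε hε hK2 (by nlinarith) hgc (fun s => by
      refine (abs_le_of_odd_hasDerivAt hg hgodd hgb s).trans ?_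
      gcongr) hodd hper hvx0 ha hv0 (fun x t hx => by
      have e : vxx x t - vtt x t - v x t + g (v x t) =
        -((g (q x t + v x t) - g (q x t) - g (v x t)) + R x t) := by
        rw [heq]
        ring
      rw [e, abs_neg]
      refine (abs_add_le _ _).trans ?_
      have k1 := abs_add_sub_sub_le hg hgodd hgl (q x t) (v x t)
      have k2 : K * ε * |v x t| * |q x t| ≤ K * ε * |v x t| * (K * ε * exp (-(ε * x))) :=
        mul_le_mul_of_nonneg_left (hqe x t) (by positivity)
      have k3 : 1 * (ε ^ 3 * δ * exp (-(ε * x))) ≤ K ^ 2 * (ε ^ 3 * δ * exp (-(ε * x))) :=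
        mul_le_mul_of_nonneg_right hK2 (by positivity)
      have e2 : ε ^ 2 * K ^ 2 * exp (-(ε * x)) * (|v x t| + ε * δ) =
        K * ε * |v x t| * (K * ε * exp (-(ε * x))) + K ^ 2 * (ε ^ 3 * δ * exp (-(ε * x))) := by ring
      rw [e2]
      linarith [hRb x t]) hX hm x hx
  obtain ⟨-, -, hs⟩ := slice_bounds hT hω0 hω (h.ht x) (h.slice_continuous_t x) (hodd x) (hper x)
  have hdev : ∀ t, |v x t - sinCoeff T ω (v x) * sin (ω * t)| ≤ 128 * K ^ 2 * ε * (m + δ) := by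
    intro t
    refine abs_le_of_sq_le_sq ?_ (by positivity)
    refine (hs t).trans ?_
    have k1 : (∫ t in (0 : ℝ)..T, (vt x t - sinCoeff T ω (v x) * (ω * cos (ω * t))) ^ 2) ≤
        200 * (K ^ 2) ^ 2 * T * ε ^ 2 * (m ^ 2 + δ ^ 2) :=
      le_trans (le_add_of_nonneg_left (integral_sq_nonneg' hT)) hrem
    have k2 : m ^ 2 + δ ^ 2 ≤ (m + δ) ^ 2 := by
      have := mul_nonneg hm0 hδ
      linarith [add_sq m δ]
    have k3 : T * T ≤ 9 * 9 := mul_le_mul hT9 hT9 hT.le (by norm_num)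
    calc _ ≤ T * (200 * (K ^ 2) ^ 2 * T * ε ^ 2 * (m ^ 2 + δ ^ 2)) :=
          mul_le_mul_of_nonneg_left k1 hT.le
      _ = (200 * (T * T)) * ((K ^ 2) ^ 2 * ε ^ 2 * (m ^ 2 + δ ^ 2)) := by ring
      _ ≤ 128 ^ 2 * ((K ^ 2) ^ 2 * ε ^ 2 * (m + δ) ^ 2) := by
          refine mul_le_mul (by linarith) ?_ (by positivity) (by positivity)
          exact mul_le_mul_of_nonneg_left k2 (by positivity)
      _ = _ := by ring
  refine ⟨hrem, hdev, ?_⟩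
  have hcosh := one_le_cosh (ε * x)
  have hexp : exp (-(ε * x)) ≤ 1 := exp_le_one_iff.2 (by have := mul_nonneg hε.le hx.1; linarith)
  have hvc := h.slice_continuous x
  have hqc := hq x
  have hRc := hR x
  have hres := abs_sinCoeff_resid_le hT hω0 hω (g := g) (g' := g') (q := q x) (v := v x) (R := R x)
    hgc hqc hvc hRc (α := α) (b := b) (σ := ε / cosh (ε * x)) (ε := ε) (K := 128 * K ^ 2)
    (c := sinCoeff T ω (v x)) (μ := m + δ) hα (hαK.trans hK128) hb (hbK.trans hK128) hbα
    (by positivity) (div_le_self hε.le hcosh) hε (by linarith) hKε (by positivity) (by linarith)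
    (fun t => (hqs x t).trans (by gcongr)) (fun t => (hqb x t).trans (by gcongr))
    (fun t => by
      refine (hRb x t).trans ?_
      calc ε ^ 3 * δ * exp (-(ε * x)) ≤ ε ^ 3 * δ * 1 := by gcongr
        _ ≤ _ := by
          rw [mul_one]
          gcongr
          linarith)
    ((hm x hx).trans (by linarith)) hdev
    (fun q v => (abs_add_sub_sub_mul_le hg (by positivity) hgl q v).trans (by gcongr))
    (fun t => (hgq x t).trans (by gcongr))
  have hvtt := sinCoeff_deriv_deriv hω (h.ht x) (h.htt x) (h.slice_continuous_tt x) (hper x)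
  have e1 : vxx x = fun t => (vtt x t + v x t) - (g (q x t + v x t) - g (q x t) + R x t) := by
    funext t
    rw [heq]
    ring
  have hvttc := h.slice_continuous_tt x
  rw [e1, sinCoeff_sub (by fun_prop) (by fun_prop), sinCoeff_add hvttc hvc, hvtt, hωε, ← abs_neg]
  refine le_of_eq_of_le (congrArg _ ?_) hres
  ring

end Galerkin

/-- The bounded odd solution `sech y tanh y` of `C'' = (1 - 6 sech² y) C`. -/
def zeroMode (y : ℝ) : ℝ := sinh y / cosh y ^ 2

/-- The derivative of `zeroMode`. -/
def zeroModeDeriv (y : ℝ) : ℝ := 2 / cosh y ^ 3 - 1 / cosh y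

theorem hasDerivAt_inv_cosh (y : ℝ) : HasDerivAt (fun y => 1 / cosh y) (-zeroMode y) y := by
  have := (hasDerivAt_const y (1 : ℝ)).div (hasDerivAt_cosh y) (cosh_pos y).ne'
  refine this.congr_deriv ?_
  rw [zeroMode]
  ring

theorem hasDerivAt_zeroMode (y : ℝ) : HasDerivAt zeroMode (zeroModeDeriv y) y := by
  have hc := (cosh_pos y).ne'
  have := (hasDerivAt_sinh y).div ((hasDerivAt_cosh y).pow 2) (pow_ne_zero 2 hc)
  refine this.congr_deriv ?_
  rw [zeroModeDeriv]
  have h := cosh_sq y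
  have h2 : sinh y ^ 2 = cosh y ^ 2 - 1 := by linarith
  simp only [Pi.pow_apply]
  field_simp
  push_cast
  ring_nf
  rw [h2]
  ring

theorem hasDerivAt_zeroModeDeriv (y : ℝ) :
    HasDerivAt zeroModeDeriv ((1 - 6 / cosh y ^ 2) * zeroMode y) y := by
  have hc := (cosh_pos y).ne'
  have := ((hasDerivAt_const y (2 : ℝ)).div ((hasDerivAt_cosh y).pow 3) (pow_ne_zero 3 hc)).sub
    (hasDerivAt_inv_cosh y)
  refine this.congr_deriv ?_
  rw [zeroMode]
  simp only [Pi.pow_apply]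
  field_simp
  push_cast
  ring

theorem zeroMode_pos {y : ℝ} (hy : 0 < y) : 0 < zeroMode y :=
  div_pos (sinh_pos_iff.2 hy) (pow_pos (cosh_pos y) 2)

/-- The Wronskian with `zeroMode`. -/
def wronskian (C C' : ℝ → ℝ) (y : ℝ) : ℝ := C' y * zeroMode y - C y * zeroModeDeriv y

theorem hasDerivAt_wronskian {C C' C'' : ℝ → ℝ} (h1 : ∀ y, HasDerivAt C (C' y) y)
    (h2 : ∀ y, HasDerivAt C' (C'' y) y) (y : ℝ) :
    HasDerivAt (wronskian C C') (zeroMode y * (C'' y - (1 - 6 / cosh y ^ 2) * C y)) y := by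
  refine (((h2 y).mul (hasDerivAt_zeroMode y)).sub
    ((h1 y).mul (hasDerivAt_zeroModeDeriv y))).congr_deriv ?_
  ring

theorem abs_one_sub_six_le (y : ℝ) : |1 - 6 / cosh y ^ 2| ≤ 5 := by
  have h1 : 1 ≤ cosh y ^ 2 := one_le_pow₀ (one_le_cosh y)
  have h2 : 6 / cosh y ^ 2 ≤ 6 := div_le_self (by norm_num) h1
  have h3 : 0 ≤ 6 / cosh y ^ 2 := by positivity
  rw [abs_le]
  constructor <;> linarith

section Bound

variable {C C' C'' : ℝ → ℝ} {δ θ Y : ℝ}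

theorem abs_le_near_zero (h1 : ∀ y, HasDerivAt C (C' y) y) (h2 : ∀ y, HasDerivAt C' (C'' y) y)
    (hC0 : |C 0| ≤ δ) (hC'0 : C' 0 = 0) (hY : 0 ≤ Y) (hY1 : Y ≤ 1 / 4) (hθ : 0 ≤ θ)
    (hη : ∀ y ∈ Icc 0 Y, |C'' y - (1 - 6 / cosh y ^ 2) * C y| ≤ θ) :
    ∀ y ∈ Icc 0 Y, |C y| ≤ 2 * δ + θ := by
  have hc : Continuous C := continuous_iff_continuousAt.2 fun s => (h1 s).continuousAt
  obtain ⟨y₀, hy₀, hmax⟩ := (isCompact_Icc (a := 0) (b := Y)).exists_isMaxOn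
    (nonempty_Icc.2 hY) hc.abs.continuousOn
  set μ := |C y₀| with hμ
  have hμ0 : 0 ≤ μ := abs_nonneg _
  have hmax' : ∀ x ∈ Icc 0 Y, |C x| ≤ μ := fun x hx => hmax hx
  have hC'' : ∀ y ∈ Icc 0 Y, |C'' y| ≤ 5 * μ + θ := fun y hy => by
    have e : C'' y = (1 - 6 / cosh y ^ 2) * C y + (C'' y - (1 - 6 / cosh y ^ 2) * C y) := by ring
    rw [e]
    refine (abs_add_le _ _).trans (add_le_add ?_ (hη y hy))
    rw [abs_mul]
    exact mul_le_mul (abs_one_sub_six_le y) (hmax' y hy) (abs_nonneg _) (by norm_num)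
  have hC' : ∀ y ∈ Icc 0 Y, |C' y| ≤ (5 * μ + θ) * (1 / 4) := fun y hy => by
    have := (convex_Icc 0 Y).norm_image_sub_le_of_norm_hasDerivWithin_le
      (fun x _ => (h2 x).hasDerivWithinAt) hC'' (left_mem_Icc.2 hY) hy
    rw [hC'0, sub_zero, sub_zero, Real.norm_eq_abs, Real.norm_eq_abs, abs_of_nonneg hy.1] at this
    exact this.trans (mul_le_mul_of_nonneg_left (hy.2.trans hY1) (by positivity))
  have hC := (convex_Icc 0 Y).norm_image_sub_le_of_norm_hasDerivWithin_le
      (fun x _ => (h1 x).hasDerivWithinAt) hC' (left_mem_Icc.2 hY) hy₀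
  rw [sub_zero, Real.norm_eq_abs, Real.norm_eq_abs, abs_of_nonneg hy₀.1] at hC
  have h3 := hC.trans (mul_le_mul_of_nonneg_left (hy₀.2.trans hY1) (by positivity))
  have h4 := abs_sub_abs_le_abs_sub (C y₀) (C 0)
  have hδ : 0 ≤ δ := (abs_nonneg _).trans hC0
  intro y hy
  refine (hmax' y hy).trans ?_
  linarith

/-- Boundedness of a solution whose Wronskian with `zeroMode` stays small. -/
theorem exists_slow_bound : ∃ K : ℝ, 1 ≤ K ∧ ∀ {C C' C'' : ℝ → ℝ} {δ θ Y : ℝ},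
    (∀ y, HasDerivAt C (C' y) y) → (∀ y, HasDerivAt C' (C'' y) y) →
    |C 0| ≤ δ → C' 0 = 0 → 0 ≤ θ →
    (∀ y ∈ Icc 0 Y, |C'' y - (1 - 6 / cosh y ^ 2) * C y| ≤ θ) →
    (∀ y ∈ Icc 0 Y, |wronskian C C' y| ≤ δ / cosh y) →
    ∀ y ∈ Icc 0 Y, |C y| ≤ K * (δ + θ) := by
  have hr : (0 : ℝ) < 1 / 4 := by norm_num
  have hz := zeroMode_pos hr
  refine ⟨2 + 2 / zeroMode (1 / 4) + 17, by have : 0 ≤ 2 / zeroMode (1 / 4) := by positivity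
                                            linarith, ?_⟩
  intro C C' C'' δ θ Y h1 h2 hC0 hC'0 hθ hη hw y hy
  have hδ : 0 ≤ δ := (abs_nonneg _).trans hC0
  rcases le_total y (1 / 4) with hy4 | hy4
  · have := abs_le_near_zero h1 h2 hC0 hC'0 hy.1 hy4 hθ
      (fun z hz => hη z ⟨hz.1, hz.2.trans hy.2⟩) y (right_mem_Icc.2 hy.1)
    refine this.trans ?_
    have h3 : 0 ≤ 2 / zeroMode (1 / 4) * (δ + θ) := by positivity
    linarith
  · have hr1 := abs_le_near_zero h1 h2 hC0 hC'0 hr.le le_rfl hθ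
      (fun z hz => hη z ⟨hz.1, hz.2.trans (hy4.trans hy.2)⟩) (1 / 4) (right_mem_Icc.2 hr.le)
    have hpos : ∀ z, 1 / 4 ≤ z → 0 < zeroMode z := fun z hz => zeroMode_pos (hr.trans_le hz)
    have hd : ∀ z, 1 / 4 ≤ z → HasDerivAt (fun z => C z / zeroMode z)
        (wronskian C C' z / zeroMode z ^ 2) z := fun z hz =>
      (h1 z).div (hasDerivAt_zeroMode z) (hpos z hz).ne'
    have hb : ∀ z ∈ Icc (1 / 4) y, |wronskian C C' z / zeroMode z ^ 2| ≤ 17 * δ * cosh z := by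
      intro z hz
      have hz0 := hpos z hz.1
      have hsinh : 1 / 4 ≤ sinh z := hz.1.trans (self_le_sinh_iff.2 (hr.le.trans hz.1))
      have hc := cosh_pos z
      rw [abs_div, abs_of_pos (pow_pos hz0 2), div_le_iff₀ (pow_pos hz0 2)]
      refine (hw z ⟨hr.le.trans hz.1, hz.2.trans hy.2⟩).trans ?_
      rw [zeroMode, div_pow, div_le_iff₀ hc]
      have e : 17 * δ * cosh z * (sinh z ^ 2 / (cosh z ^ 2) ^ 2) * cosh z =
        δ * (17 * sinh z ^ 2 / cosh z ^ 2) := by field_simp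
      rw [e]
      refine le_mul_of_one_le_right hδ ?_
      rw [one_le_div (by positivity), cosh_sq]
      nlinarith
    have hF : |C y / zeroMode y - C (1 / 4) / zeroMode (1 / 4)| ≤
        17 * δ * sinh y - 17 * δ * sinh (1 / 4) := by
      have hm1 : MonotoneOn (fun z => 17 * δ * sinh z - C z / zeroMode z) (Icc (1 / 4) y) := by
        refine monotoneOn_of_hasDerivWithinAt_nonneg (convex_Icc _ _)
          (f' := fun z => 17 * δ * cosh z - wronskian C C' z / zeroMode z ^ 2)
          (fun z hz => ?_) (fun z hz => ?_) fun z hz => ?_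
        · exact (((hasDerivAt_sinh z).const_mul _).sub (hd z hz.1)).continuousAt.continuousWithinAt
        · rw [interior_Icc] at hz
          exact (((hasDerivAt_sinh z).const_mul _).sub (hd z hz.1.le)).hasDerivWithinAt
        · rw [interior_Icc] at hz
          linarith [(abs_le.1 (hb z (Ioo_subset_Icc_self hz))).2]
      have hm2 : MonotoneOn (fun z => 17 * δ * sinh z + C z / zeroMode z) (Icc (1 / 4) y) := by
        refine monotoneOn_of_hasDerivWithinAt_nonneg (convex_Icc _ _)
          (f' := fun z => 17 * δ * cosh z + wronskian C C' z / zeroMode z ^ 2)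
          (fun z hz => ?_) (fun z hz => ?_) fun z hz => ?_
        · exact (((hasDerivAt_sinh z).const_mul _).add (hd z hz.1)).continuousAt.continuousWithinAt
        · rw [interior_Icc] at hz
          exact (((hasDerivAt_sinh z).const_mul _).add (hd z hz.1.le)).hasDerivWithinAt
        · rw [interior_Icc] at hz
          linarith [(abs_le.1 (hb z (Ioo_subset_Icc_self hz))).1]
      have e1 := hm1 (left_mem_Icc.2 hy4) (right_mem_Icc.2 hy4) hy4
      have e2 := hm2 (left_mem_Icc.2 hy4) (right_mem_Icc.2 hy4) hy4
      simp only at e1 e2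
      rw [abs_le]
      constructor <;> linarith
    have hs0 : 0 ≤ sinh (1 / 4) := sinh_nonneg_iff.2 hr.le
    have hy0 := hpos y hy4
    have hCy : |C y / zeroMode y| ≤ (2 * δ + θ) / zeroMode (1 / 4) + 17 * δ * sinh y := by
      have e1 := abs_sub_abs_le_abs_sub (C y / zeroMode y) (C (1 / 4) / zeroMode (1 / 4))
      have e2 : |C (1 / 4) / zeroMode (1 / 4)| ≤ (2 * δ + θ) / zeroMode (1 / 4) := by
        rw [abs_div, abs_of_pos hz]
        gcongr
      have e3 : 0 ≤ 17 * δ * sinh (1 / 4) := by positivity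
      linarith
    rw [abs_div, abs_of_pos hy0, div_le_iff₀ hy0, add_mul] at hCy
    have hcosh := cosh_pos y
    have hsy : 0 < sinh y := sinh_pos_iff.2 (hr.trans_le hy4)
    have z1 : zeroMode y ≤ 1 := by
      rw [zeroMode, div_le_one (by positivity), cosh_sq]
      nlinarith [sq_nonneg (sinh y - 1)]
    have z2 : sinh y * zeroMode y ≤ 1 := by
      rw [zeroMode, ← mul_div_assoc, div_le_one (by positivity), cosh_sq]
      nlinarith
    have k1 : (2 * δ + θ) / zeroMode (1 / 4) * zeroMode y ≤ 2 / zeroMode (1 / 4) * (δ + θ) := by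
      calc (2 * δ + θ) / zeroMode (1 / 4) * zeroMode y ≤ (2 * δ + θ) / zeroMode (1 / 4) * 1 :=
            mul_le_mul_of_nonneg_left z1 (by positivity)
        _ ≤ (2 * (δ + θ)) / zeroMode (1 / 4) := by
            rw [mul_one]
            gcongr
            linarith
        _ = _ := by ring
    have k2 : 17 * δ * sinh y * zeroMode y ≤ 17 * δ := by
      have := mul_le_mul_of_nonneg_left z2 (by positivity : 0 ≤ 17 * δ)
      linarith
    linarith

end Bound

section Shooting

/-- The parameters `a` for which `P a` becomes negative while `N a` is still positive. -/
def exitSet (P N : ℝ → ℝ → ℝ) : Set ℝ :=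
  {a | ∃ y, 0 ≤ y ∧ P a y < 0 ∧ ∀ z ∈ Icc 0 y, 0 < N a z}

theorem isOpen_exitSet {P N : ℝ → ℝ → ℝ} (hPc : Continuous (Function.uncurry P))
    (hNc : Continuous (Function.uncurry N)) : IsOpen (exitSet P N) := by
  rw [isOpen_iff_mem_nhds]
  rintro a ⟨y, hy, hP, hN⟩
  have h1 : ∀ᶠ b in nhds a, P b y < 0 := by
    have hc : Continuous fun b => P b y := hPc.comp (by fun_prop : Continuous fun b : ℝ => (b, y))
    exact hc.continuousAt.eventually_lt continuousAt_const hP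
  have h2 : ∀ᶠ b in nhds a, ∀ z ∈ Icc 0 y, 0 < N b z := by
    refine isCompact_Icc.eventually_forall_of_forall_eventually fun z hz => ?_
    have hc : ContinuousAt (fun p : ℝ × ℝ => N p.1 p.2) (a, z) := hNc.continuousAt
    exact continuousAt_const.eventually_lt hc (hN z hz)
  filter_upwards [h1, h2] with b hb1 hb2
  exact ⟨y, hy, hb1, hb2⟩

theorem not_mem_exitSet_of_mem {P N : ℝ → ℝ → ℝ} {a : ℝ} (h : a ∈ exitSet P N) :
    a ∉ exitSet N P := by
  rintro ⟨y', hy', hN', hP'⟩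
  obtain ⟨y, hy, hP, hN⟩ := h
  rcases le_total y y' with hyy | hyy
  · exact lt_asymm hP (hP' y ⟨hy, hyy⟩)
  · exact lt_asymm hN' (hN y' ⟨hy', hyy⟩)

theorem mem_exitSet_of_eq_zero {P N : ℝ → ℝ → ℝ} {a y : ℝ}
    (hNc : Continuous (N a)) (hPN : ∀ y, 0 < P a y + N a y) (hy : 0 ≤ y)
    (htrap : ∀ z ∈ Icc 0 y, 0 ≤ P a z ∧ 0 ≤ N a z)
    (hP : ∀ᶠ z in nhdsWithin y (Ioi y), P a z < 0)
    (hN : ∀ z, 0 ≤ z → z ≤ y → N a z = 0 → ∀ᶠ w in nhdsWithin z (Ioi z), N a w < 0)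
    (hPy : P a y = 0) : a ∈ exitSet P N := by
  have hNpos : ∀ z ∈ Icc 0 y, 0 < N a z := by
    intro z hz
    refine lt_of_le_of_ne (htrap z hz).2 fun h0 => ?_
    rcases hz.2.eq_or_lt with rfl | hzy
    · have := hPN z
      rw [hPy, ← h0] at this
      linarith
    · have h1 := hN z hz.1 hz.2 h0.symm
      obtain ⟨w, hw1, hw2⟩ := (h1.and (Ioo_mem_nhdsGT hzy)).exists
      exact absurd (htrap w ⟨hz.1.trans hw2.1.le, hw2.2.le⟩).2 (not_le.2 hw1)
  have hNe : ∀ᶠ z in nhdsWithin y (Ioi y), 0 < N a z :=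
    (continuousAt_const.eventually_lt hNc.continuousAt
      (hNpos y (right_mem_Icc.2 hy))).filter_mono nhdsWithin_le_nhds
  obtain ⟨u, hu, hsub⟩ := (mem_nhdsGT_iff_exists_Ioo_subset).1 (hP.and hNe)
  rw [mem_Ioi] at hu
  have hmid : ∀ z ∈ Ioo y u, P a z < 0 ∧ 0 < N a z := fun z hz => hsub hz
  refine ⟨(y + u) / 2, by linarith, (hmid _ ⟨by linarith, by linarith⟩).1, fun z hz => ?_⟩
  rcases le_or_gt z y with hzy | hzy
  · exact hNpos z ⟨hz.1, hzy⟩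
  · exact (hmid z ⟨hzy, by linarith [hz.2]⟩).2

theorem exists_first_exit {μ : ℝ → ℝ} (hμ : Continuous μ) (h0 : 0 ≤ μ 0)
    (h : ∃ y, 0 ≤ y ∧ μ y < 0) : ∃ y, 0 ≤ y ∧ (∀ z ∈ Icc 0 y, 0 ≤ μ z) ∧ μ y = 0 := by
  set S := {y | 0 ≤ y ∧ μ y < 0} with hS
  have hSb : BddBelow S := ⟨0, fun y hy => hy.1⟩
  have hy0 : 0 ≤ sInf S := le_csInf h fun y hy => hy.1
  have hlt : ∀ z, 0 ≤ z → z < sInf S → 0 ≤ μ z := fun z hz hzy => by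
    by_contra hc
    exact absurd (csInf_le hSb ⟨hz, not_le.1 hc⟩) (not_le.2 hzy)
  have hge : 0 ≤ μ (sInf S) := by
    rcases hy0.eq_or_lt with he | hpos
    · rw [← he]
      exact h0
    · by_contra hc
      have h1 : ∀ᶠ z in nhdsWithin (sInf S) (Iio (sInf S)), μ z < 0 :=
        (hμ.continuousAt.eventually_lt continuousAt_const (not_le.1 hc)).filter_mono
          nhdsWithin_le_nhds
      obtain ⟨z, hz1, hz2⟩ := (h1.and (Ioo_mem_nhdsLT hpos)).exists
      exact absurd (hlt z hz2.1.le hz2.2) (not_le.2 hz1)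
  have hle : μ (sInf S) ≤ 0 := by
    by_contra hc
    have h1 : ∀ᶠ z in nhds (sInf S), 0 < μ z :=
      continuousAt_const.eventually_lt hμ.continuousAt (not_le.1 hc)
    obtain ⟨z, hz1, hz2⟩ := ((mem_closure_iff_frequently.1 (csInf_mem_closure h hSb)).and_eventually
      h1).exists
    exact lt_asymm hz2 hz1.2
  refine ⟨sInf S, hy0, fun z hz => ?_, le_antisymm hle hge⟩
  rcases hz.2.eq_or_lt with rfl | hlt'
  · exact hge
  · exact hlt z hz.1 hlt'

/-- A two-sided shooting argument. -/
theorem exists_trapped {P N : ℝ → ℝ → ℝ} {δ : ℝ} (hδ : 0 ≤ δ)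
    (hPc : Continuous (Function.uncurry P)) (hNc : Continuous (Function.uncurry N))
    (hPN : ∀ a y, 0 < P a y + N a y)
    (h0 : ∀ a ∈ Icc (-δ) δ, 0 ≤ P a 0 ∧ 0 ≤ N a 0)
    (hP : ∀ a ∈ Icc (-δ) δ, ∀ y, 0 ≤ y → (∀ z ∈ Icc 0 y, 0 ≤ P a z ∧ 0 ≤ N a z) →
      P a y = 0 → ∀ᶠ z in nhdsWithin y (Ioi y), P a z < 0)
    (hN : ∀ a ∈ Icc (-δ) δ, ∀ y, 0 ≤ y → (∀ z ∈ Icc 0 y, 0 ≤ P a z ∧ 0 ≤ N a z) →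
      N a y = 0 → ∀ᶠ z in nhdsWithin y (Ioi y), N a z < 0)
    (hP0 : P (-δ) 0 = 0) (hN0 : N δ 0 = 0) :
    ∃ a ∈ Icc (-δ) δ, ∀ y, 0 ≤ y → 0 ≤ P a y ∧ 0 ≤ N a y := by
  by_contra hno
  push Not at hno
  have hPa : ∀ a, Continuous (P a) := fun a => hPc.comp (by fun_prop : Continuous fun y : ℝ => (a, y))
  have hNa : ∀ a, Continuous (N a) := fun a => hNc.comp (by fun_prop : Continuous fun y : ℝ => (a, y))
  have hsubset : Icc (-δ) δ ⊆ exitSet P N ∪ exitSet N P := by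
    intro a ha
    obtain ⟨y, hy, hbad⟩ := hno a ha
    obtain ⟨y', hy', htrap, hzero⟩ := exists_first_exit (μ := fun y => min (P a y) (N a y))
      ((hPa a).min (hNa a)) (le_min (h0 a ha).1 (h0 a ha).2) ⟨y, hy, by
        by_contra hc
        rw [not_lt, le_min_iff] at hc
        exact absurd hc.2 (not_le.2 (hbad hc.1))⟩
    have htrap' : ∀ z ∈ Icc 0 y', 0 ≤ P a z ∧ 0 ≤ N a z := fun z hz => le_min_iff.1 (htrap z hz)
    have hsub : ∀ z, z ≤ y' → ∀ w ∈ Icc 0 z, 0 ≤ P a w ∧ 0 ≤ N a w := fun z hz w hw =>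
      htrap' w ⟨hw.1, hw.2.trans hz⟩
    rcases min_choice (P a y') (N a y') with hm | hm
    · have hz : P a y' = 0 := hm.symm.trans hzero
      exact Or.inl (mem_exitSet_of_eq_zero (hNa a) (hPN a) hy' htrap' (hP a ha y' hy' htrap' hz)
        (fun z hz1 hz2 hz3 => hN a ha z hz1 (hsub z hz2) hz3) hz)
    · have hz : N a y' = 0 := hm.symm.trans hzero
      exact Or.inr (mem_exitSet_of_eq_zero (hPa a) (fun y => by rw [add_comm]; exact hPN a y) hy'
        (fun z hz => (htrap' z hz).symm) (hN a ha y' hy' htrap' hz)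
        (fun z hz1 hz2 hz3 => hP a ha z hz1 (hsub z hz2) hz3) hz)
  have hzero : ∀ a ∈ Icc (-δ) δ, ∀ z ∈ Icc (0 : ℝ) 0, 0 ≤ P a z ∧ 0 ≤ N a z := by
    intro a ha z hz
    rw [Icc_self, mem_singleton_iff] at hz
    rw [hz]
    exact h0 a ha
  have hl : -δ ∈ Icc (-δ) δ := ⟨le_rfl, by linarith⟩
  have hr : δ ∈ Icc (-δ) δ := ⟨by linarith, le_rfl⟩
  have hU : -δ ∈ exitSet P N := by
    refine mem_exitSet_of_eq_zero (hNa _) (hPN _) le_rfl (hzero _ hl)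
      (hP _ hl 0 le_rfl (hzero _ hl) hP0) (fun z hz1 hz2 hz3 => ?_) hP0
    obtain rfl := le_antisymm hz2 hz1
    exact hN _ hl 0 le_rfl (hzero _ hl) hz3
  have hV : δ ∈ exitSet N P := by
    refine mem_exitSet_of_eq_zero (hPa _) (fun y => by rw [add_comm]; exact hPN _ y) le_rfl
      (fun z hz => (hzero _ hr z hz).symm)
      (hN _ hr 0 le_rfl (hzero _ hr) hN0) (fun z hz1 hz2 hz3 => ?_) hN0
    obtain rfl := le_antisymm hz2 hz1
    exact hP _ hr 0 le_rfl (hzero _ hr) hz3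
  obtain ⟨a, -, h1, h2⟩ := isPreconnected_Icc _ _ (isOpen_exitSet hPc hNc) (isOpen_exitSet hNc hPc)
    hsubset ⟨-δ, hl, hU⟩ ⟨δ, hr, hV⟩
  exact not_mem_exitSet_of_mem h1 h2

end Shooting

/-- Bootstrap: a small residual forces boundedness as long as the Wronskian is trapped. -/
theorem abs_le_of_wronskian_trapped {K : ℝ} (hK : 1 ≤ K)
    (hslow : ∀ {C C' C'' : ℝ → ℝ} {δ θ Y : ℝ},
      (∀ y, HasDerivAt C (C' y) y) → (∀ y, HasDerivAt C' (C'' y) y) →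
      |C 0| ≤ δ → C' 0 = 0 → 0 ≤ θ →
      (∀ y ∈ Icc 0 Y, |C'' y - (1 - 6 / cosh y ^ 2) * C y| ≤ θ) →
      (∀ y ∈ Icc 0 Y, |wronskian C C' y| ≤ δ / cosh y) →
      ∀ y ∈ Icc 0 Y, |C y| ≤ K * (δ + θ))
    {C C' C'' : ℝ → ℝ} {δ κ m₀ Y : ℝ} (hδ : 0 < δ) (hκ : 0 ≤ κ) (hκK : 4 * K * κ ≤ 1)
    (hm₀ : 2 * K * δ < m₀)
    (h1 : ∀ y, HasDerivAt C (C' y) y) (h2 : ∀ y, HasDerivAt C' (C'' y) y)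
    (hC0 : |C 0| ≤ δ) (hC'0 : C' 0 = 0)
    (hη : ∀ Y m, 0 ≤ m → m ≤ m₀ → (∀ y ∈ Icc 0 Y, |C y| ≤ m) →
      ∀ y ∈ Icc 0 Y, |C'' y - (1 - 6 / cosh y ^ 2) * C y| ≤ κ * (m + δ))
    (hw : ∀ y ∈ Icc 0 Y, |wronskian C C' y| ≤ δ / cosh y) :
    ∀ y ∈ Icc 0 Y, |C y| ≤ 2 * K * δ := by
  have hc : Continuous C := continuous_iff_continuousAt.2 fun s => (h1 s).continuousAt
  have key : ∀ Z, 0 ≤ Z → Z ≤ Y → (∀ y ∈ Icc 0 Z, |C y| ≤ m₀) →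
      ∀ y ∈ Icc 0 Z, |C y| ≤ 2 * K * δ := by
    intro Z hZ hZY hb
    obtain ⟨y₀, hy₀, hmax⟩ := (isCompact_Icc (a := 0) (b := Z)).exists_isMaxOn
      (nonempty_Icc.2 hZ) hc.abs.continuousOn
    have hmax' : ∀ x ∈ Icc 0 Z, |C x| ≤ |C y₀| := fun x hx => hmax hx
    have h3 := hslow h1 h2 hC0 hC'0 (by positivity) (hη Z _ (abs_nonneg _) (hb y₀ hy₀) hmax')
      (fun y hy => hw y ⟨hy.1, hy.2.trans hZY⟩) y₀ hy₀
    have h4 : 0 ≤ |C y₀| := abs_nonneg _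
    have h5 := mul_le_mul_of_nonneg_right hκK h4
    have h6 := mul_le_mul_of_nonneg_right hκK hδ.le
    have h7 := mul_le_mul_of_nonneg_right hK hδ.le
    intro y hy
    refine (hmax' y hy).trans ?_
    linarith
  by_cases hbad : ∃ y, 0 ≤ y ∧ y ≤ Y ∧ m₀ < |C y|
  · exfalso
    obtain ⟨y, hy0, hyY, hy⟩ := hbad
    have hδm : δ ≤ m₀ := by nlinarith
    obtain ⟨y', hy'0, hy', hy'z⟩ := exists_first_exit (μ := fun y => m₀ - |C y|)
      (continuous_const.sub hc.abs) (sub_nonneg.2 (hC0.trans hδm)) ⟨y, hy0, sub_neg.2 hy⟩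
    have hle : y' ≤ Y := by
      by_contra hlt
      exact absurd (sub_nonneg.1 (hy' y ⟨hy0, hyY.trans (not_le.1 hlt).le⟩)) (not_le.2 hy)
    have := key y' hy'0 hle (fun z hz => sub_nonneg.1 (hy' z hz)) y' (right_mem_Icc.2 hy'0)
    linarith
  · push Not at hbad
    intro y hy
    exact key Y (hy.1.trans hy.2) le_rfl (fun z hz => hbad z hz.1 hz.2) y hy

theorem eventually_neg_of_deriv_neg {P P' : ℝ → ℝ} {y : ℝ} (hd : ∀ z, HasDerivAt P (P' z) z)
    (hPy : P y = 0) (hneg : ∀ᶠ z in nhdsWithin y (Ioi y), P' z < 0) :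
    ∀ᶠ z in nhdsWithin y (Ioi y), P z < 0 := by
  obtain ⟨u, hu, hsub⟩ := (mem_nhdsGT_iff_exists_Ioo_subset).1 hneg
  rw [mem_Ioi] at hu
  filter_upwards [Ioo_mem_nhdsGT hu] with z hz
  have := strictAntiOn_of_hasDerivWithinAt_neg (convex_Icc y z) (f := P) (f' := P')
    (fun w _ => (hd w).continuousAt.continuousWithinAt) (fun w _ => (hd w).hasDerivWithinAt)
    (fun w hw => by
      rw [interior_Icc] at hw
      exact hsub ⟨hw.1, hw.2.trans hz.2⟩)
  rw [← hPy]
  exact this (left_mem_Icc.2 hz.1.le) (right_mem_Icc.2 hz.1.le) hz.1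

/-- In a family of perturbed solutions of the linearised profile equation, one is bounded. -/
theorem exists_bounded_solution : ∃ K : ℝ, 1 ≤ K ∧ ∀ {C C' C'' : ℝ → ℝ → ℝ} {δ κ m₀ : ℝ},
    0 < δ → 0 ≤ κ → 4 * K * κ ≤ 1 → 2 * K * δ < m₀ →
    (∀ a y, HasDerivAt (C a) (C' a y) y) → (∀ a y, HasDerivAt (C' a) (C'' a y) y) →
    Continuous (Function.uncurry C) → Continuous (Function.uncurry C') →
    (∀ a, Continuous (C'' a)) →
    (∀ a ∈ Icc (-δ) δ, C a 0 = a) → (∀ a ∈ Icc (-δ) δ, C' a 0 = 0) →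
    (∀ a ∈ Icc (-δ) δ, ∀ Y m, 0 ≤ m → m ≤ m₀ → (∀ y ∈ Icc 0 Y, |C a y| ≤ m) →
      ∀ y ∈ Icc 0 Y, |C'' a y - (1 - 6 / cosh y ^ 2) * C a y| ≤ κ * (m + δ)) →
    ∃ a ∈ Icc (-δ) δ, ∀ y, 0 ≤ y → |C a y| ≤ 2 * K * δ := by
  obtain ⟨K, hK, hslow⟩ := exists_slow_bound
  refine ⟨K, hK, ?_⟩
  intro C C' C'' δ κ m₀ hδ hκ hκK hm₀ h1 h2 hCc hC'c hC''c hC0 hC'0 hη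
  have hboot : ∀ a ∈ Icc (-δ) δ, ∀ Y, (∀ y ∈ Icc 0 Y,
      |wronskian (C a) (C' a) y| ≤ δ / cosh y) → ∀ y ∈ Icc 0 Y, |C a y| ≤ 2 * K * δ :=
    fun a ha Y => abs_le_of_wronskian_trapped hK hslow hδ hκ hκK hm₀ (h1 a) (h2 a)
      (by rw [hC0 a ha]; exact abs_le.2 ha) (hC'0 a ha) (hη a ha)
  have hres : ∀ a ∈ Icc (-δ) δ, ∀ Y, 0 ≤ Y → (∀ y ∈ Icc 0 Y,
      |wronskian (C a) (C' a) y| ≤ δ / cosh y) →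
      ∀ᶠ z in nhdsWithin Y (Ioi Y), |C'' a z - (1 - 6 / cosh z ^ 2) * C a z| < δ := by
    intro a ha Y hY hw
    have h3 := hη a ha Y (2 * K * δ) (by positivity) hm₀.le (hboot a ha Y hw) Y (right_mem_Icc.2 hY)
    have h4 : κ * (2 * K * δ + δ) < δ := by
      have := mul_le_mul_of_nonneg_right hκK hδ.le
      have := mul_le_mul_of_nonneg_left hK (by positivity : 0 ≤ κ * δ)
      linarith
    have hca : Continuous (C a) := continuous_iff_continuousAt.2 fun s => (h1 a s).continuousAt
    have hcont : Continuous fun z => |C'' a z - (1 - 6 / cosh z ^ 2) * C a z| := by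
      have := hC''c a
      have hch : ∀ z, cosh z ^ 2 ≠ 0 := fun z => (pow_pos (cosh_pos z) 2).ne'
      fun_prop (disch := exact hch _)
    exact (hcont.continuousAt.eventually_lt continuousAt_const (h3.trans_lt h4)).filter_mono
      nhdsWithin_le_nhds
  have hWc : Continuous fun p : ℝ × ℝ => wronskian (C p.1) (C' p.1) p.2 := by
    have e : (fun p : ℝ × ℝ => wronskian (C p.1) (C' p.1) p.2) = fun p =>
      Function.uncurry C' p * zeroMode p.2 - Function.uncurry C p * zeroModeDeriv p.2 := rfl
    have hz : Continuous zeroMode :=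
      continuous_iff_continuousAt.2 fun s => (hasDerivAt_zeroMode s).continuousAt
    have hz' : Continuous zeroModeDeriv :=
      continuous_iff_continuousAt.2 fun s => (hasDerivAt_zeroModeDeriv s).continuousAt
    rw [e]
    fun_prop
  have hSc : Continuous fun p : ℝ × ℝ => δ / cosh p.2 := by
    have hch : ∀ z : ℝ × ℝ, cosh z.2 ≠ 0 := fun z => (cosh_pos z.2).ne'
    fun_prop (disch := exact hch _)
  have hw0 : ∀ a ∈ Icc (-δ) δ, wronskian (C a) (C' a) 0 = -a := by
    intro a ha
    rw [wronskian, hC0 a ha, hC'0 a ha, zeroModeDeriv, cosh_zero]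
    ring
  have hSd : ∀ y, HasDerivAt (fun y => δ / cosh y) (-(δ * zeroMode y)) y := fun y => by
    have := (hasDerivAt_inv_cosh y).const_mul δ
    simp only [mul_one_div, mul_neg] at this
    exact this
  have htrap : ∀ {a Y}, (∀ z ∈ Icc 0 Y, 0 ≤ δ / cosh z - wronskian (C a) (C' a) z ∧
      0 ≤ δ / cosh z + wronskian (C a) (C' a) z) →
      ∀ y ∈ Icc 0 Y, |wronskian (C a) (C' a) y| ≤ δ / cosh y := fun h y hy => by
    obtain ⟨e1, e2⟩ := h y hy
    rw [abs_le]
    constructor <;> linarith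
  obtain ⟨a, ha, hall⟩ := exists_trapped (δ := δ)
    (P := fun a y => δ / cosh y - wronskian (C a) (C' a) y)
    (N := fun a y => δ / cosh y + wronskian (C a) (C' a) y)
    hδ.le (hSc.sub hWc) (hSc.add hWc)
    (fun a y => by
      have : 0 < δ / cosh y := div_pos hδ (cosh_pos y)
      linarith)
    (fun a ha => by
      rw [hw0 a ha, cosh_zero, div_one]
      constructor <;> linarith [ha.1, ha.2])
    (fun a ha y hy ht h0 => by
      refine eventually_neg_of_deriv_neg
        (fun z => (hSd z).sub (hasDerivAt_wronskian (h1 a) (h2 a) z)) h0 ?_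
      filter_upwards [hres a ha y hy (htrap ht), self_mem_nhdsWithin] with z hz1 hz2
      have hz3 := zeroMode_pos (hy.trans_lt hz2)
      have := mul_pos hz3 (by linarith [(abs_lt.1 hz1).1] :
        0 < δ + (C'' a z - (1 - 6 / cosh z ^ 2) * C a z))
      linarith)
    (fun a ha y hy ht h0 => by
      refine eventually_neg_of_deriv_neg
        (fun z => (hSd z).add (hasDerivAt_wronskian (h1 a) (h2 a) z)) h0 ?_
      filter_upwards [hres a ha y hy (htrap ht), self_mem_nhdsWithin] with z hz1 hz2
      have hz3 := zeroMode_pos (hy.trans_lt hz2)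
      have := mul_pos hz3 (by linarith [(abs_lt.1 hz1).2] :
        0 < δ - (C'' a z - (1 - 6 / cosh z ^ 2) * C a z))
      linarith)
    (by
      rw [hw0 _ ⟨le_rfl, by linarith⟩, cosh_zero, div_one]
      ring)
    (by
      rw [hw0 _ ⟨by linarith, le_rfl⟩, cosh_zero, div_one]
      ring)
  exact ⟨a, ha, fun y hy => hboot a ha y (htrap fun z hz => hall z hz.1) y (right_mem_Icc.2 hy)⟩

/-- An approximate breather for the nonlinearity `g`. -/
structure IsApproxBreather (T ω ε δ K α b : ℝ) (g g' : ℝ → ℝ)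
    (q qx qt qxx qxt qtt : ℝ → ℝ → ℝ) : Prop where
  isC2 : IsC2 q qx qt qxx qxt qtt
  hT : 0 < T
  hT9 : T ≤ 9
  hω0 : 0 < ω
  hω : ω * T = 2 * π
  hωε : ω ^ 2 = 1 - ε ^ 2
  hε : 0 < ε
  hδ : 0 < δ
  hK : 1 ≤ K
  hKε : 128 * K ^ 2 * ε ≤ 1
  hg : ∀ s, HasDerivAt g (g' s) s
  hg' : Continuous g'
  g_odd : ∀ s, g (-s) = -g s
  g'_le : ∀ s, |g' s| ≤ K * ε ^ 2
  g'_lip : ∀ s r, |g' s - g' r| ≤ K * ε * |s - r|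
  hα : 0 ≤ α
  hαK : α ≤ K
  hb : 0 ≤ b
  hbK : b ≤ K
  hbα : b * α ^ 2 = 8
  g'_q : ∀ x t, |g' (q x t) - b * q x t ^ 2| ≤ K * |q x t| ^ 3
  qx_zero : ∀ t, qx 0 t = 0
  q_odd : ∀ x t, q x (-t) = -q x t
  q_per : ∀ x t, q x (t + T) = q x t
  q_lead : ∀ x t, |q x t - α * (ε / cosh (ε * x)) * sin (ω * t)| ≤ K * ε ^ 2
  q_exp : ∀ x t, |q x t| ≤ K * ε * exp (-(ε * x))
  q_le : ∀ x t, |q x t| ≤ K * ε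
  resid : ∀ x t, |qxx x t - qtt x t - q x t + g (q x t)| ≤ ε ^ 3 * δ * exp (-(ε * x))

section Trapped

variable {T ω ε δ K α b : ℝ} {g g' : ℝ → ℝ} {q qx qt qxx qxt qtt : ℝ → ℝ → ℝ}

theorem continuous_sinCoeff_deriv {c2 c1 : ℝ → ℝ → ℝ} (h2 : Continuous (Function.uncurry c2))
    (h1 : ∀ a x, HasDerivAt (c1 a) (c2 a x) x) (h0 : ∀ a, c1 a 0 = 0) :
    Continuous (Function.uncurry c1) := by
  have e : Function.uncurry c1 = fun p : ℝ × ℝ => ∫ y in (0 : ℝ)..p.2, c2 p.1 y := by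
    funext p
    have hc : Continuous (c2 p.1) := h2.comp (by fun_prop : Continuous fun y : ℝ => (p.1, y))
    rw [intervalIntegral.integral_eq_sub_of_hasDerivAt (fun y _ => h1 p.1 y)
      (hc.intervalIntegrable _ _), h0, sub_zero]
    rfl
  rw [e]
  refine intervalIntegral.continuous_parametric_intervalIntegral_of_continuous
    (f := fun (p : ℝ × ℝ) y => c2 p.1 y) ?_ continuous_snd
  have e' : (Function.uncurry fun (p : ℝ × ℝ) y => c2 p.1 y) =
    fun r : (ℝ × ℝ) × ℝ => Function.uncurry c2 (r.1.1, r.2) := rfl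
  rw [e']
  fun_prop

/-- Shooting in the `sin (ω t)` component at `x = 0` produces a solution staying close to the
approximate breather on the whole half line. -/
theorem exists_near_approx : ∃ K₃ : ℝ, 1 ≤ K₃ ∧ ∀ {T ω ε δ K α b : ℝ} {g g' : ℝ → ℝ}
    {q qx qt qxx qxt qtt : ℝ → ℝ → ℝ},
    IsApproxBreather T ω ε δ K α b g g' q qx qt qxx qxt qtt →
    4 * K₃ * (46 * (128 * K ^ 2) ^ 4 * ε) ≤ 1 → 2 * K₃ * δ < ε ^ 2 →
    ∃ u ux ut uxx uxt utt : ℝ → ℝ → ℝ, IsC2 u ux ut uxx uxt utt ∧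
      (∀ x t, uxx x t = utt x t + (u x t - g (u x t))) ∧
      (∀ x t, u (-x) t = u x t) ∧ (∀ x t, u x (-t) = -u x t) ∧ (∀ x t, u x (t + T) = u x t) ∧
      ∀ x, 0 ≤ x → |sinCoeff T ω (fun t => u x t - q x t)| ≤ 2 * K₃ * δ ∧
        remEnergy T ω (fun x t => u x t - q x t) (fun x t => ux x t - qx x t)
          (fun x t => ut x t - qt x t) x ≤
            200 * (K ^ 2) ^ 2 * T * ε ^ 2 * ((2 * K₃ * δ) ^ 2 + δ ^ 2) ∧
        ∀ t, |u x t - q x t - sinCoeff T ω (fun t => u x t - q x t) * sin (ω * t)| ≤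
          128 * K ^ 2 * ε * (2 * K₃ * δ + δ) := by
  obtain ⟨K₃, hK₃, hshoot⟩ := exists_bounded_solution
  refine ⟨K₃, hK₃, ?_⟩
  intro T ω ε δ K α b g g' q qx qt qxx qxt qtt H hκ hδε
  have hT := H.hT
  have hε := H.hε
  have hδ := H.hδ
  have hω0 := H.hω0
  have hω := H.hω
  have hK := H.hK
  have hq := H.isC2
  have hδε' : δ ≤ ε ^ 2 := by nlinarith
  have hε1 : ε ≤ 1 := by
    have := mul_le_mul_of_nonneg_right (one_le_pow₀ hK : 1 ≤ K ^ 2) hε.le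
    linarith [H.hKε]
  have hKε2 : K * ε ^ 2 ≤ 1 := by
    have h1 : K ≤ K ^ 2 := le_self_pow₀ hK two_ne_zero
    have h2 : ε ^ 2 ≤ ε := by nlinarith
    have h3 := mul_le_mul h1 h2 (sq_nonneg _) (by positivity)
    have h4 : 0 ≤ K ^ 2 * ε := by positivity
    linarith [H.hKε]
  have hgc : Continuous g := continuous_iff_continuousAt.2 fun s => (H.hg s).continuousAt
  set cl : ℝ → ℝ := fun a => max (-δ) (min δ a) with hcl
  have hclδ : ∀ a, |cl a| ≤ δ := fun a =>
    abs_le.2 ⟨le_max_left _ _, max_le (by linarith) (min_le_left _ _)⟩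
  have hclc : Continuous cl := by fun_prop
  have hcla : ∀ a ∈ Icc (-δ) δ, cl a = a := fun a ha => by
    rw [hcl]
    simp only
    rw [min_eq_right ha.2, max_eq_right ha.1]
  have hqc := hq.slice_continuous 0
  have hqttc := hq.slice_continuous_tt 0
  obtain ⟨u, huc, huC, hu0, huev, huodd, huper⟩ := exists_wave_solution
    (h := fun s => s - g s) (h' := fun s => 1 - g' s) (L := 2) (by norm_num)
    (fun s => (hasDerivAt_id s).sub (H.hg s)) (by have := H.hg'; fun_prop)
    (fun s => by rw [H.g_odd]; ring)
    (fun s r => by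
      have h1 := abs_sub_le_of_hasDerivAt (a := r) (b := s) H.hg fun x _ => H.g'_le x
      have h2 : s - g s - (r - g r) = (s - r) - (g s - g r) := by ring
      have h3 := mul_le_mul_of_nonneg_right hKε2 (abs_nonneg (s - r))
      rw [h2]
      refine (abs_sub _ _).trans ?_
      linarith)
    (Φ := fun a t => q 0 t + cl a * sin (ω * t))
    (Φ' := fun a t => qt 0 t + cl a * (ω * cos (ω * t)))
    (Φ'' := fun a t => qtt 0 t + cl a * (ω * -(ω * sin (ω * t))))
    (by
      have e : (Function.uncurry fun a t => q 0 t + cl a * sin (ω * t)) =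
        fun p : ℝ × ℝ => q 0 p.2 + cl p.1 * sin (ω * p.2) := rfl
      rw [e]
      fun_prop)
    (B := K * ε + δ)
    (fun a t => by
      refine (abs_add_le _ _).trans (add_le_add (H.q_le 0 t) ?_)
      rw [abs_mul]
      exact (mul_le_of_le_one_right (abs_nonneg _) (abs_sin_le_one _)).trans (hclδ a))
    (fun a t => (hq.ht 0 t).add ((hasDerivAt_sin_const_mul ω t).const_mul _))
    (fun a t => (hq.htt 0 t).add (((hasDerivAt_cos_const_mul ω t).const_mul ω).const_mul _))
    (fun a => by fun_prop)
    (fun a t => by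
      rw [H.q_odd, mul_neg, sin_neg]
      ring)
    (T := T)
    (fun a t => by rw [H.q_per, mul_add, hω, sin_add_two_pi])
  choose ux ut uxx uxt utt hu heq hux0 using huC
  have hvC : ∀ a, IsC2 (fun x t => u a x t - q x t) (fun x t => ux a x t - qx x t)
      (fun x t => ut a x t - qt x t) (fun x t => uxx a x t - qxx x t)
      (fun x t => uxt a x t - qxt x t) (fun x t => utt a x t - qtt x t) := fun a => (hu a).sub hq
  have hbd := fun {a m X : ℝ} => perturbation_bounds (a := cl a) (m := m) (X := X) (hvC a) hT H.hT9
    hω0 hω H.hωε hε hK H.hKε H.hg H.g_odd H.g'_le H.g'_lip H.hα H.hαK H.hb H.hbK H.hbα H.g'_q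
    hq.slice_continuous H.q_lead H.q_exp H.q_le
    (R := fun x t => qxx x t - qtt x t - q x t + g (q x t))
    (fun x => by
      have h1 := hq.slice_continuous x
      have h2 := hq.slice_continuous_xx x
      have h3 := hq.slice_continuous_tt x
      fun_prop) H.resid
    (fun x t => by
      rw [huodd, H.q_odd]
      ring)
    (fun x t => by rw [huper, H.q_per])
    (fun t => by rw [hux0, H.qx_zero, sub_zero]) (hclδ a)
    (fun t => by rw [hu0, add_sub_cancel_left])
    (fun x t => by
      rw [heq, add_sub_cancel]
      ring) hδε'
  have hc1 : ∀ a x, HasDerivAt (fun x => sinCoeff T ω (fun t => u a x t - q x t))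
      (sinCoeff T ω (fun t => ux a x t - qx x t)) x := fun a x =>
    hasDerivAt_sinCoeff (hvC a).slice_continuous (hvC a).cx (hvC a).hx x
  have hc2 : ∀ a x, HasDerivAt (fun x => sinCoeff T ω (fun t => ux a x t - qx x t))
      (sinCoeff T ω (fun t => uxx a x t - qxx x t)) x := fun a x =>
    hasDerivAt_sinCoeff (hvC a).slice_continuous_x (hvC a).cxx (hvC a).hxx x
  have hucc : Continuous fun p : (ℝ × ℝ) × ℝ => u p.1.1 p.1.2 p.2 :=
    huc.comp (by fun_prop : Continuous fun p : (ℝ × ℝ) × ℝ => (p.1.1, p.1.2, p.2))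
  have hcc0 : Continuous fun p : ℝ × ℝ => sinCoeff T ω (fun t => u p.1 p.2 t - q p.2 t) := by
    refine continuous_sinCoeff_param (F := fun p : ℝ × ℝ => fun t => u p.1 p.2 t - q p.2 t) ?_
    have hqq : Continuous fun p : (ℝ × ℝ) × ℝ => q p.1.2 p.2 :=
      hq.continuous.comp (by fun_prop : Continuous fun p : (ℝ × ℝ) × ℝ => (p.1.2, p.2))
    exact hucc.sub hqq
  have hcc2 : Continuous fun p : ℝ × ℝ => sinCoeff T ω (fun t => uxx p.1 p.2 t - qxx p.2 t) := by
    have e : (fun p : ℝ × ℝ => sinCoeff T ω (fun t => uxx p.1 p.2 t - qxx p.2 t)) = fun p =>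
        (-ω ^ 2 * sinCoeff T ω (u p.1 p.2) + sinCoeff T ω (fun t => u p.1 p.2 t - g (u p.1 p.2 t))) -
          sinCoeff T ω (qxx p.2) := by
      funext p
      have d1 := (hu p.1).slice_continuous_xx p.2
      have d2 := (hu p.1).slice_continuous_tt p.2
      have d3 := (hu p.1).slice_continuous p.2
      rw [sinCoeff_sub d1 (hq.slice_continuous_xx p.2), ← sinCoeff_deriv_deriv hω
        ((hu p.1).ht p.2) ((hu p.1).htt p.2) d2 (huper p.1 p.2),
        ← sinCoeff_add d2 (by fun_prop), funext (heq p.1 p.2)]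
    rw [e]
    have f1 := continuous_sinCoeff_param (T := T) (ω := ω)
      (F := fun p : ℝ × ℝ => fun t => u p.1 p.2 t) hucc
    have f2 := continuous_sinCoeff_param (T := T) (ω := ω)
      (F := fun p : ℝ × ℝ => fun t => u p.1 p.2 t - g (u p.1 p.2 t)) (hucc.sub (hgc.comp hucc))
    have hqq : Continuous fun p : (ℝ × ℝ) × ℝ => qxx p.1.2 p.2 :=
      hq.cxx.comp (by fun_prop : Continuous fun p : (ℝ × ℝ) × ℝ => (p.1.2, p.2))
    have f3 := continuous_sinCoeff_param (T := T) (ω := ω)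
      (F := fun p : ℝ × ℝ => fun t => qxx p.2 t) hqq
    exact ((f1.const_mul _).add f2).sub f3
  have hcc1 := continuous_sinCoeff_deriv
    (c1 := fun a x => sinCoeff T ω (fun t => ux a x t - qx x t))
    (c2 := fun a x => sinCoeff T ω (fun t => uxx a x t - qxx x t)) hcc2 hc2
    (fun a => by
      simp only [hux0, H.qx_zero, sub_zero, sinCoeff, zero_mul, intervalIntegral.integral_zero,
        mul_zero])
  have hresc : Continuous fun p : ℝ × ℝ => (p.1, p.2 / ε) := by fun_prop
  have hdiv : ∀ {φ : ℝ → ℝ} {φ' y : ℝ}, HasDerivAt φ φ' (y / ε) →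
      HasDerivAt (fun y => φ (y / ε)) (φ' / ε) y := fun {φ φ' y} hφ =>
    (hφ.comp y ((hasDerivAt_id y).div_const ε)).congr_deriv (by rw [mul_one_div])
  obtain ⟨a, ha, hbound⟩ := hshoot
    (C := fun a y => sinCoeff T ω (fun t => u a (y / ε) t - q (y / ε) t))
    (C' := fun a y => sinCoeff T ω (fun t => ux a (y / ε) t - qx (y / ε) t) / ε)
    (C'' := fun a y => sinCoeff T ω (fun t => uxx a (y / ε) t - qxx (y / ε) t) / ε / ε)
    (δ := δ) (κ := 46 * (128 * K ^ 2) ^ 4 * ε) (m₀ := ε ^ 2) hδ (by positivity) hκ hδε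
    (fun a y => hdiv (hc1 a (y / ε))) (fun a y => (hdiv (hc2 a (y / ε))).div_const ε)
    (hcc0.comp hresc) ((hcc1.comp hresc).div_const ε)
    (fun a => ((hcc2.comp (by fun_prop : Continuous fun y : ℝ => (a, y / ε))).div_const ε).div_const
      ε)
    (fun a ha => by
      simp only [zero_div, hu0, add_sub_cancel_left, hcla a ha]
      exact sinCoeff_mul_sin hT hω0 hω a)
    (fun a ha => by
      simp only [zero_div, hux0, H.qx_zero, sub_zero, sinCoeff, zero_mul,
        intervalIntegral.integral_zero, mul_zero])
    (fun a ha Y m hm0 hmε hm y hy => by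
      have h1 := (hbd (a := a) (m := m) (X := Y / ε) hm0 hmε (fun x hx => by
        have := hm (x * ε) ⟨mul_nonneg hx.1 hε.le, (le_div_iff₀ hε).1 hx.2⟩
        rwa [mul_div_cancel_right₀ _ hε.ne'] at this) (y / ε)
        ⟨div_nonneg hy.1 hε.le, div_le_div_of_nonneg_right hy.2 hε.le⟩).2.2
      rw [mul_div_cancel₀ _ hε.ne'] at h1
      have e : ∀ A B : ℝ, A / ε / ε - (1 - 6 / cosh y ^ 2) * B =
          (A - (ε ^ 2 - 6 * (ε / cosh y) ^ 2) * B) / ε ^ 2 := fun A B => by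
        have := (cosh_pos y).ne'
        field_simp
      rw [e, abs_div, abs_of_pos (pow_pos hε 2), div_le_iff₀ (pow_pos hε 2)]
      refine h1.trans (le_of_eq ?_)
      ring)
  refine ⟨u a, ux a, ut a, uxx a, uxt a, utt a, hu a, heq a, huev a, huodd a, huper a,
    fun x hx => ?_⟩
  have hall : ∀ x, 0 ≤ x → |sinCoeff T ω (fun t => u a x t - q x t)| ≤ 2 * K₃ * δ := fun x hx => by
    have := hbound (x * ε) (mul_nonneg hx hε.le)
    rwa [mul_div_cancel_right₀ _ hε.ne'] at this
  have h1 := hbd (a := a) (m := 2 * K₃ * δ) (X := x) (by positivity) hδε.le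
    (fun x hx => hall x hx.1) x ⟨hx, le_rfl⟩
  exact ⟨hall x hx, h1.1, h1.2.1⟩

end Trapped

theorem exists_forall_mul_exp_neg_div_le (A : ℝ) {c : ℝ} (hc : 0 < c) :
    ∃ ε₀ > 0, ∀ ε : ℝ, 0 < ε → ε < ε₀ → A * exp (-c / ε) ≤ ε ^ 3 := by
  have h1 : Tendsto (fun ε : ℝ => ε⁻¹) (nhdsWithin 0 (Ioi 0)) atTop := tendsto_inv_nhdsGT_zero
  have h2 := (Real.tendsto_pow_mul_exp_neg_atTop_nhds_zero 3).comp (h1.const_mul_atTop hc)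
  have h3 := h2.const_mul (A / c ^ 3)
  rw [mul_zero] at h3
  have h4 := h3.eventually (gt_mem_nhds one_pos)
  obtain ⟨ε₀, hε₀, h5⟩ := (mem_nhdsGT_iff_exists_Ioo_subset).1 h4
  refine ⟨ε₀, hε₀, fun ε h0 h1 => ?_⟩
  have h6 : A / c ^ 3 * ((c * ε⁻¹) ^ 3 * exp (-(c * ε⁻¹))) < 1 := h5 ⟨h0, h1⟩
  rw [show -(c * ε⁻¹) = -c / ε by ring] at h6
  have h7 : A / c ^ 3 * ((c * ε⁻¹) ^ 3 * exp (-c / ε)) * ε ^ 3 = A * exp (-c / ε) := by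
    field_simp
  rw [← h7]
  have : 0 < ε ^ 3 := by positivity
  nlinarith

theorem period_bounds {ε ω T : ℝ} (hε : 0 < ε) (hε' : ε ≤ 1 / 16) (hω0 : 0 < ω)
    (hω : ω ^ 2 = 1 - ε ^ 2) (hT : T = 2 * π / ω) :
    ω ≤ 1 ∧ 1 ≤ 4 * ω ^ 2 ∧ 1 ≤ T ∧ T ≤ 9 := by
  have hω1 : ω ≤ 1 := by nlinarith
  have hω2 : 9 / 10 ≤ ω := by nlinarith
  refine ⟨hω1, by nlinarith, ?_, ?_⟩
  · rw [hT, le_div_iff₀ hω0]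
    linarith [pi_gt_three]
  · rw [hT, div_le_iff₀ hω0]
    linarith [pi_lt_d2]

set_option maxHeartbeats 1000000 in
/-- An even standing wave close to `q` on the right half line, for every small amplitude. -/
theorem exists_breather {f : ℝ → ℝ} (hodd : ∀ x, f (-x) = -f x)
    (hanal : ∀ x : ℝ, AnalyticAt ℝ f x) (hf1 : deriv f 0 = 0) (hf3 : 0 < iteratedDeriv 3 f 0) :
    ∃ α > 0, ∃ L ≥ 1, ∃ D > 0, ∃ c > 0, ∃ ε₀ > 0, ∀ ε ω T : ℝ, 0 < ε → ε < ε₀ → 0 < ω →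
      ω ^ 2 = 1 - ε ^ 2 → T = 2 * π / ω →
      ∃ u ux ut uxx uxt utt q qx qt qxx qxt qtt : ℝ → ℝ → ℝ, IsC2 u ux ut uxx uxt utt ∧
        IsC2 q qx qt qxx qxt qtt ∧ 0 < T ∧ 1 ≤ T ∧ T ≤ 9 ∧ ε ≤ 1 ∧
        (∀ x t, uxx x t = utt x t + (u x t - f (u x t))) ∧
        (∀ x t, u (-x) t = u x t) ∧ (∀ x t, u x (-t) = -u x t) ∧ (∀ x t, u x (t + T) = u x t) ∧
        (∀ x t, |u x t| ≤ L * ε) ∧ (∀ t, |u 0 t - α * ε * sin (ω * t)| ≤ L * ε ^ 2) ∧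
        (∀ x t, |q x t| ≤ L * exp (-(ε * x))) ∧ (∀ x t, |qt x t| ≤ L * ε * exp (-(ε * x))) ∧
        ∀ x, 0 ≤ x → (∫ t in (0 : ℝ)..T, (u x t - q x t) ^ 2) ≤ D * exp (-c / ε) ^ 2 ∧
          (∫ t in (0 : ℝ)..T, (ut x t - qt x t) ^ 2) ≤ D * exp (-c / ε) ^ 2 := by
  obtain ⟨α, hα, hfα, K₁, hK₁, c, hc, ε₁, hε₁, hε₁', happ⟩ := exists_approx hodd (hanal 0) hf1 hf3
  obtain ⟨f', f'', K₂, hK₂, hdf, hdf', -, hf'e, hf''b, hf'b⟩ := exists_local_bounds hodd hanal hf1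
  obtain ⟨K₃, hK₃, hnear⟩ := exists_near_approx
  have hf'0 : f' 0 = 0 := by rw [← (hdf 0).deriv]; exact hf1
  obtain ⟨b, hbdef⟩ : ∃ b, b = iteratedDeriv 3 f 0 / 2 := ⟨_, rfl⟩
  rw [← hbdef] at hf'b
  have hb : 0 < b := by rw [hbdef]; linarith
  have hbα : b * α ^ 2 = 8 := by rw [hbdef]; linarith
  clear hf3 hfα
  obtain ⟨L, hL⟩ : ∃ L, L = K₁ + 1 := ⟨_, rfl⟩
  obtain ⟨K, hK⟩ : ∃ K, K = 1 + K₁ + α + b + K₂ + K₂ * L ^ 2 + K₂ * L := ⟨_, rfl⟩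
  have hL1 : 1 ≤ L := by linarith
  have hKL2 : 0 < K₂ * L ^ 2 := by positivity
  have hKL : 0 < K₂ * L := by positivity
  have hK1 : 1 ≤ K := by linarith
  obtain ⟨ε₂, hε₂, hexp⟩ := exists_forall_mul_exp_neg_div_le (K₁ + 4 * K₃ + 2) (half_pos hc)
  refine ⟨α, hα, L, hL1, 18 * K₃ ^ 2 + 1800 * K ^ 4 * (4 * K₃ ^ 2 + 1), by positivity, c / 2,
    half_pos hc, min ε₁ (min ε₂ (min (1 / L) (min (1 / (128 * K ^ 2))
      (1 / (4 * K₃ * (46 * (128 * K ^ 2) ^ 4)))))), by positivity, ?_⟩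
  intro ε ω T hε hεlt hω0 hωε hT
  simp only [lt_min_iff] at hεlt
  obtain ⟨h1, h2, h3, h4, h5⟩ := hεlt
  rw [lt_div_iff₀ (by positivity)] at h3 h4 h5
  have hε16 : ε ≤ 1 / 16 := by linarith
  obtain ⟨δ, hδdef⟩ : ∃ δ, δ = exp (-(c / 2) / ε) := ⟨_, rfl⟩
  have hδ : 0 < δ := by rw [hδdef]; positivity
  have hδε := hexp ε hε h2
  rw [← hδdef] at hδε ⊢
  have hδ2 : exp (-c / ε) = δ * δ := by
    rw [hδdef, ← exp_add]; congr 1; ring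
  have hωT : ω * T = 2 * π := by rw [hT]; field_simp
  obtain ⟨hω1, hωl, hT1, hT9⟩ := period_bounds hε hε16 hω0 hωε hT
  have hT0 : 0 < T := by linarith
  have hε32 : ε ^ 3 ≤ ε ^ 2 := pow_le_pow_of_le_one hε.le (by linarith) (by norm_num)
  have hε21 : ε ^ 2 ≤ ε := pow_le_of_le_one hε.le (by linarith) two_ne_zero
  have hK₁δ : K₁ * δ ≤ ε ^ 3 :=
    (mul_le_mul_of_nonneg_right (by linarith) hδ.le).trans hδε
  have hK₃δ : (4 * K₃ + 1) * δ ≤ ε ^ 2 :=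
    (mul_le_mul_of_nonneg_right (by linarith) hδ.le).trans (hδε.trans hε32)
  have hK₃δ' : 2 * K₃ * δ < ε ^ 2 :=
    (mul_lt_mul_of_pos_right (by linarith) hδ).trans_le hK₃δ
  obtain ⟨q, qx, qt, qxx, qxt, qtt, hq, hqx0, hqo, hqp, hqlead, -, hqexp, hqle, hqt, hres⟩ :=
    happ ε ω hε h1 hω0 hωε
  obtain ⟨g, g', hg, hg'c, hgo, hgf, hg'le, hg'lip⟩ := exists_cutoff hodd hdf hdf' hf'e hf'0 hf''b
    hK₂.le (M := L * ε) (by positivity) (by linarith)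
  have hqL : ∀ x t, |q x t| ≤ L * ε := fun x t => (hqle x t).trans (by rw [hL]; linarith)
  have H : IsApproxBreather T ω ε δ K α b g g' q qx qt qxx qxt qtt :=
    { isC2 := hq
      hT := hT0
      hT9 := hT9
      hω0 := hω0
      hω := hωT
      hωε := hωε
      hε := hε
      hδ := hδ
      hK := hK1
      hKε := by linarith
      hg := hg
      hg' := hg'c
      g_odd := hgo
      g'_le := fun s => (hg'le s).trans (by
        rw [mul_pow, ← mul_assoc]
        exact mul_le_mul_of_nonneg_right (by linarith) (by positivity))
      g'_lip := fun s r => (hg'lip s r).trans (by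
        rw [← mul_assoc K₂]
        exact mul_le_mul_of_nonneg_right
          (mul_le_mul_of_nonneg_right (by linarith) hε.le) (abs_nonneg _))
      hα := hα.le
      hαK := by linarith
      hb := hb.le
      hbK := by linarith
      hbα := hbα
      g'_q := fun x t => by
        rw [(hgf _ (hqL x t)).2]
        exact (hf'b _ ((hqL x t).trans (by linarith))).trans
          (mul_le_mul_of_nonneg_right (by linarith) (by positivity))
      qx_zero := hqx0
      q_odd := hqo
      q_per := by rw [hT]; exact hqp
      q_lead := fun x t => (hqlead x t).trans
          (mul_le_mul_of_nonneg_right (by linarith) (by positivity))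
      q_exp := fun x t => (hqexp x t).trans
          (mul_le_mul_of_nonneg_right (mul_le_mul_of_nonneg_right (by linarith) hε.le)
            (by positivity))
      q_le := fun x t => (hqle x t).trans (mul_le_mul_of_nonneg_right (by linarith) hε.le)
      resid := fun x t => by
        rw [(hgf _ (hqL x t)).1]
        refine (hres x t).trans (mul_le_mul_of_nonneg_right ?_ (by positivity))
        rw [hδ2, ← mul_assoc]
        exact mul_le_mul_of_nonneg_right hK₁δ hδ.le }
  obtain ⟨u, ux, ut, uxx, uxt, utt, hu, hpde, hue, huo, hup, hbd⟩ := hnear H (by linarith) hK₃δ'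
  have hdiff : ∀ x, 0 ≤ x → ∀ t, |u x t - q x t| ≤ ε ^ 2 := by
    intro x hx t
    obtain ⟨b1, -, b2⟩ := hbd x hx
    have b3 := b2 t
    set m := sinCoeff T ω (fun t => u x t - q x t)
    have b4 : |m * sin (ω * t)| ≤ 2 * K₃ * δ := by
      rw [abs_mul]
      exact (mul_le_of_le_one_right (abs_nonneg _) (abs_sin_le_one _)).trans b1
    have b5 := abs_add_le (u x t - q x t - m * sin (ω * t)) (m * sin (ω * t))
    rw [sub_add_cancel] at b5
    have b6 : 128 * K ^ 2 * ε * (2 * K₃ * δ + δ) ≤ 1 * (2 * K₃ * δ + δ) :=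
      mul_le_mul_of_nonneg_right (by linarith) (by positivity)
    linarith
  have huL : ∀ x t, |u x t| ≤ L * ε := by
    have key : ∀ x, 0 ≤ x → ∀ t, |u x t| ≤ L * ε := by
      intro x hx t
      have a1 := hdiff x hx t
      have a2 := hqle x t
      have a3 := abs_add_le (u x t - q x t) (q x t)
      rw [sub_add_cancel] at a3
      rw [hL]
      linarith
    intro x t
    rcases le_total 0 x with hx | hx
    · exact key x hx t
    · rw [← hue]
      exact key (-x) (by linarith) t
  refine ⟨u, ux, ut, uxx, uxt, utt, q, qx, qt, qxx, qxt, qtt, hu, hq, hT0, hT1, hT9, by linarith,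
    fun x t => ?_, hue, huo, hup, huL, fun t => ?_, fun x t => ?_, fun x t => ?_, fun x hx => ?_⟩
  · rw [hpde, (hgf _ (huL x t)).1]
  · have a1 := hdiff 0 le_rfl t
    have a2 := hqlead 0 t
    rw [mul_zero, cosh_zero, div_one] at a2
    have a3 := abs_add_le (u 0 t - q 0 t) (q 0 t - α * ε * sin (ω * t))
    rw [sub_add_sub_cancel] at a3
    rw [hL]
    linarith
  · refine (hqexp x t).trans (mul_le_mul_of_nonneg_right ?_ (by positivity))
    have : K₁ * ε ≤ K₁ * 1 := mul_le_mul_of_nonneg_left (by linarith) hK₁.le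
    linarith
  · refine (hqt x t).trans (mul_le_mul_of_nonneg_right ?_ (by positivity))
    exact mul_le_mul_of_nonneg_right (by linarith) hε.le
  · obtain ⟨b1, b2, -⟩ := hbd x hx
    have hv := hu.sub hq
    obtain ⟨s1, s2, -⟩ := slice_bounds hT0 hω0 hωT (fun t => hv.ht x t)
      (hv.slice_continuous_t x) (fun t => by rw [huo, hqo]; ring)
      (fun t => by rw [hup, H.q_per])
    unfold remEnergy at b2
    have n1 := integral_sq_nonneg' hT0 (φ := fun t => ux x t - qx x t)
    set m := sinCoeff T ω (fun t => u x t - q x t)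
    set h := ∫ t in (0 : ℝ)..T, (ut x t - qt x t - m * (ω * cos (ω * t))) ^ 2
    have n2 : 0 ≤ h := integral_sq_nonneg' hT0
    have e1 : h ≤ 1800 * K ^ 4 * (4 * K₃ ^ 2 + 1) * δ ^ 2 := by
      have e2 : T * ε ^ 2 ≤ 9 * 1 :=
        mul_le_mul hT9 (by linarith) (by positivity) (by norm_num)
      have e3 := mul_le_mul_of_nonneg_left e2
        (by positivity : 0 ≤ 200 * (K ^ 2) ^ 2 * ((2 * K₃ * δ) ^ 2 + δ ^ 2))
      linarith
    have e4 : m ^ 2 * (T / 2) ≤ 18 * K₃ ^ 2 * δ ^ 2 := by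
      have e5 : m ^ 2 ≤ (2 * K₃ * δ) ^ 2 := sq_le_sq.2 (b1.trans (le_abs_self _))
      have e6 := mul_le_mul e5 (by linarith : T / 2 ≤ 9 / 2) (by positivity) (by positivity)
      linarith
    have hm0 : 0 ≤ m ^ 2 * (T / 2) := by positivity
    constructor
    · have : (∫ t in (0 : ℝ)..T, (u x t - q x t) ^ 2) - m ^ 2 * (T / 2) ≤ h := by
        by_contra! hlt
        have := mul_le_mul_of_nonneg_right hωl (n2.trans hlt.le)
        linarith
      linarith
    · have : ω ^ 2 * (m ^ 2 * (T / 2)) ≤ 1 * (m ^ 2 * (T / 2)) :=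
        mul_le_mul_of_nonneg_right (pow_le_one₀ hω0.le hω1) hm0
      rw [s2]
      linarith

/-- Triangle inequality for the `H¹` norm of a profile close to a small one. -/
theorem sqrt_integral_sq_add_sq_le {T D δ η L : ℝ} {w w' p p' : ℝ → ℝ} (hT : 0 ≤ T) (hT9 : T ≤ 9)
    (hw : Continuous w) (hw' : Continuous w') (hp : Continuous p) (hp' : Continuous p')
    (hD : 0 ≤ D) (hδ : 0 ≤ δ) (hη : 0 ≤ L * η) (hpη : ∀ t, |p t| ≤ L * η)
    (hp'η : ∀ t, |p' t| ≤ L * η)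
    (h : (∫ t in (0 : ℝ)..T, (w t - p t) ^ 2) ≤ D * δ ^ 2)
    (h' : (∫ t in (0 : ℝ)..T, (w' t - p' t) ^ 2) ≤ D * δ ^ 2) :
    √(∫ t in (0 : ℝ)..T, (w t ^ 2 + w' t ^ 2)) ≤ 2 * √D * δ + 6 * L * η := by
  have h1 : (∫ t in (0 : ℝ)..T, (w t ^ 2 + w' t ^ 2)) ≤
      ∫ t in (0 : ℝ)..T, (2 * (w t - p t) ^ 2 + 2 * (w' t - p' t) ^ 2 + 4 * (L * η) ^ 2) := by
    refine intervalIntegral.integral_mono_on hT ?_ ?_ fun t _ => ?_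
    · exact Continuous.intervalIntegrable (by fun_prop) _ _
    · exact Continuous.intervalIntegrable (by fun_prop) _ _
    · have a1 : p t ^ 2 ≤ (L * η) ^ 2 := sq_le_sq.2 ((hpη t).trans (le_abs_self _))
      have a2 : p' t ^ 2 ≤ (L * η) ^ 2 := sq_le_sq.2 ((hp'η t).trans (le_abs_self _))
      linarith [sq_nonneg (w t - 2 * p t), sq_nonneg (w' t - 2 * p' t)]
  have h0 : (∫ t in (0 : ℝ)..T, (2 * (w t - p t) ^ 2 + 2 * (w' t - p' t) ^ 2 + 4 * (L * η) ^ 2)) =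
      2 * (∫ t in (0 : ℝ)..T, (w t - p t) ^ 2) + 2 * (∫ t in (0 : ℝ)..T, (w' t - p' t) ^ 2) +
        T * (4 * (L * η) ^ 2) := by
    rw [intervalIntegral.integral_add, intervalIntegral.integral_add,
      intervalIntegral.integral_const_mul, intervalIntegral.integral_const_mul,
      intervalIntegral.integral_const, sub_zero, smul_eq_mul]
    all_goals exact Continuous.intervalIntegrable (by fun_prop) _ _
  rw [h0] at h1
  rw [sqrt_le_iff]
  have hs := sqrt_nonneg D
  have hs2 := sq_sqrt hD
  have h2 : 0 ≤ √D * δ * (L * η) := by positivity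
  have h5 : 0 ≤ √D * δ := by positivity
  refine ⟨by linarith, h1.trans ?_⟩
  have h3 : T * (4 * (L * η) ^ 2) ≤ 9 * (4 * (L * η) ^ 2) :=
    mul_le_mul_of_nonneg_right hT9 (by positivity)
  have h4 : (2 * √D * δ + 6 * L * η) ^ 2 =
      4 * (√D ^ 2 * δ ^ 2) + 24 * (√D * δ * (L * η)) + 36 * (L * η) ^ 2 := by ring
  rw [h4, hs2]
  linarith

/-- Lower bound for the norm of a profile close to `α ε sin (ω t)`. -/
theorem le_sqrt_integral_of_near_sin {T ω ε α L : ℝ} {w w' : ℝ → ℝ} (hT : 1 ≤ T) (hω0 : 0 < ω)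
    (hω : ω * T = 2 * π) (hw : Continuous w) (hw' : Continuous w') (hε : 0 < ε)
    (hL : ε * (4 * L) ≤ α) (h : ∀ t, |w t - α * ε * sin (ω * t)| ≤ L * ε ^ 2) :
    α * ε / 4 ≤ √(∫ t in (0 : ℝ)..T, (w t ^ 2 + w' t ^ 2)) := by
  have h1 : ∫ t in (0 : ℝ)..T, ((α * ε) ^ 2 / 2 * sin (ω * t) ^ 2 - (α * ε / 4) ^ 2) ≤
      ∫ t in (0 : ℝ)..T, (w t ^ 2 + w' t ^ 2) := by
    refine intervalIntegral.integral_mono_on (by linarith) ?_ ?_ fun t _ => ?_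
    · exact Continuous.intervalIntegrable (by fun_prop) _ _
    · exact Continuous.intervalIntegrable (by fun_prop) _ _
    · have a1 : L * ε ^ 2 ≤ α * ε / 4 := by
        have := mul_le_mul_of_nonneg_right hL hε.le
        linarith
      have a2 : (w t - α * ε * sin (ω * t)) ^ 2 ≤ (α * ε / 4) ^ 2 :=
        sq_le_sq.2 (((h t).trans a1).trans (le_abs_self _))
      linarith [sq_nonneg (2 * w t - α * ε * sin (ω * t)), sq_nonneg (w' t)]
  rw [intervalIntegral.integral_sub, intervalIntegral.integral_const_mul,
    integral_sin_sq_period hω0 hω, intervalIntegral.integral_const, sub_zero, smul_eq_mul] at h1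
  · apply le_sqrt_of_sq_le
    refine le_trans ?_ h1
    have := mul_le_mul_of_nonneg_left hT (by positivity : 0 ≤ (α * ε / 4) ^ 2)
    have : 0 ≤ (α * ε / 4) ^ 2 := by positivity
    linarith
  all_goals exact Continuous.intervalIntegrable (by fun_prop) _ _

/-- **Main Theorem: small generalized breathers with exponentially small tails.**
Let `f : ℝ → ℝ` be odd and entire with `f(0) = 0`, `f'(0) = 0`, `f'''(0) > 0`.  Then there
are `ε₀, c, C > 0` such that for every `ε ∈ (0, ε₀)` the Klein–Gordon equation
`u_tt = u_xx − u + f(u)` has a classical solution `u` which is `2π/√(1−ε²)`-periodic and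
odd in `t`, of size `O(ε)` and of amplitude of order `ε`, and whose tails, measured in the
`H¹_t` norm over one period, are exponentially small as `|x| → ∞`. -/
theorem klein_gordon_small_breathers (f : ℝ → ℝ)
    (hodd : ∀ x, f (-x) = -f x)
    (hanal : ∀ x : ℝ, AnalyticAt ℝ f x)
    (hf0 : f 0 = 0) (hf1 : deriv f 0 = 0) (hf3 : 0 < iteratedDeriv 3 f 0) :
    ∃ ε₀ > (0 : ℝ), ∃ c > (0 : ℝ), ∃ C > (0 : ℝ), ∀ ε ∈ Ioo (0 : ℝ) ε₀,
      ∃ u : ℝ → ℝ → ℝ,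
        -- a classical (C²) solution of `u_tt = u_xx − u + f(u)`
        ContDiff ℝ 2 (Function.uncurry u) ∧
        (∀ x t, dtt u x t = dxx u x t - u x t + f (u x t)) ∧
        -- periodic in `t` with period `2π/√(1−ε²)` and odd in `t`
        (∀ x t, u x (t + 2 * π / Real.sqrt (1 - ε ^ 2)) = u x t) ∧
        (∀ x t, u x (-t) = -u x t) ∧
        -- uniformly of size `O(ε)`
        (∀ x t, |u x t| ≤ C * ε) ∧
        -- nontrivial, of amplitude of order `ε`
        ε / C ≤ (⨆ x : ℝ, profileNorm u (2 * π / Real.sqrt (1 - ε ^ 2)) x) ∧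
        -- exponentially small tails as `|x| → ∞`
        Filter.limsup (fun x => profileNorm u (2 * π / Real.sqrt (1 - ε ^ 2)) x)
          (Filter.cocompact ℝ) ≤ C * Real.exp (-c / ε) := by
  obtain ⟨α, hα, L, hL, D, hD, c, hc, ε₁, hε₁, hex⟩ := exists_breather hodd hanal hf1 hf3
  refine ⟨min ε₁ (min (1 / 16) (α / (4 * L))), by positivity, c, hc,
    7 * L + 2 * √D + 4 / α, by positivity, ?_⟩
  rintro ε ⟨hε, hεlt⟩
  simp only [lt_min_iff] at hεlt
  obtain ⟨h1, h2, h3⟩ := hεlt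
  rw [lt_div_iff₀ (by positivity)] at h3
  have hε2 : 0 < 1 - ε ^ 2 := by nlinarith
  obtain ⟨T, hT⟩ : ∃ T, T = 2 * π / √(1 - ε ^ 2) := ⟨_, rfl⟩
  rw [← hT]
  have hω0 := sqrt_pos.2 hε2
  have hωT : √(1 - ε ^ 2) * T = 2 * π := by rw [hT]; field_simp
  obtain ⟨u, ux, ut, uxx, uxt, utt, q, qx, qt, qxx, qxt, qtt, hu, hq, hT0, hT1, hT9, hε1, hpde, hue,
    huo, hup, huL, hu0, hqe, hqte, hint⟩ := hex ε _ T hε h1 hω0 (sq_sqrt hε2.le) hT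
  have hdt : ∀ x t, dt u x t = ut x t := fun x t => (hu.ht x t).deriv
  have hdtt : ∀ x t, dtt u x t = utt x t := fun x t => by
    have e : deriv (u x) = ut x := funext fun s => hdt x s
    rw [dtt, e]
    exact (hu.htt x t).deriv
  have hdxx : ∀ x t, dxx u x t = uxx x t := fun x t => by
    have e : (fun y => deriv (fun z => u z t) y) = fun y => ux y t :=
      funext fun y => (hu.hx y t).deriv
    rw [dxx, e]
    exact (hu.hxx x t).deriv
  have hpn : ∀ x, profileNorm u T x = √(∫ t in (0 : ℝ)..T, (u x t ^ 2 + ut x t ^ 2)) := fun x => by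
    simp only [profileNorm, hdt]
  have hδ : 0 < exp (-c / ε) := exp_pos _
  have hbound : ∀ x, profileNorm u T x ≤ 2 * √D * exp (-c / ε) + 6 * L * exp (-(ε * |x|)) := by
    have key : ∀ x, 0 ≤ x →
        profileNorm u T x ≤ 2 * √D * exp (-c / ε) + 6 * L * exp (-(ε * |x|)) := by
      intro x hx
      rw [hpn, abs_of_nonneg hx]
      obtain ⟨i1, i2⟩ := hint x hx
      exact sqrt_integral_sq_add_sq_le hT0.le hT9 (hu.slice_continuous x) (hu.slice_continuous_t x)
        (hq.slice_continuous x) (hq.slice_continuous_t x) hD.le hδ.le (by positivity)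
        (hqe x) (fun t => (hqte x t).trans (by
          have := mul_le_mul_of_nonneg_left hε1 (by positivity : 0 ≤ L * exp (-(ε * x)))
          linarith)) i1 i2
    intro x
    rcases le_total 0 x with hx | hx
    · exact key x hx
    · have e : profileNorm u T x = profileNorm u T (-x) := by
        have e' : u (-x) = u x := funext (hue x)
        simp only [profileNorm, dt, e']
      rw [e, ← abs_neg x]
      exact key (-x) (by linarith)
  refine ⟨u, hu.contDiff, fun x t => ?_, fun x t => ?_, huo, fun x t => ?_, ?_, ?_⟩
  · rw [hdtt, hdxx, hpde]
    ring
  · exact hup x t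
  · refine (huL x t).trans (mul_le_mul_of_nonneg_right ?_ hε.le)
    have : 0 < 4 / α := by positivity
    have : 0 ≤ √D := sqrt_nonneg _
    linarith
  · have hbdd : BddAbove (range fun x => profileNorm u T x) := by
      refine ⟨2 * √D * exp (-c / ε) + 6 * L, ?_⟩
      rintro _ ⟨x, rfl⟩
      refine (hbound x).trans ?_
      have : exp (-(ε * |x|)) ≤ 1 := exp_le_one_iff.2 (by have := abs_nonneg x; nlinarith)
      have := mul_le_mul_of_nonneg_left this (by linarith : 0 ≤ 6 * L)
      linarith
    refine le_trans ?_ (le_ciSup hbdd 0)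
    have h4 : ε / (7 * L + 2 * √D + 4 / α) ≤ α * ε / 4 := by
      have : ε / (7 * L + 2 * √D + 4 / α) ≤ ε / (4 / α) := by
        apply div_le_div_of_nonneg_left hε.le (by positivity)
        have : 0 ≤ √D := sqrt_nonneg _
        linarith
      refine this.trans (le_of_eq ?_)
      field_simp
    refine h4.trans ?_
    rw [hpn]
    exact le_sqrt_integral_of_near_sin hT1 hω0 hωT (hu.slice_continuous 0)
      (hu.slice_continuous_t 0) hε h3.le hu0
  · have hten : Tendsto (fun x : ℝ => exp (-(ε * |x|))) (cocompact ℝ) (nhds 0) :=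
      tendsto_exp_neg_atTop_nhds_zero.comp
        ((tendsto_norm_cocompact_atTop (E := ℝ)).const_mul_atTop hε)
    refine limsup_le_of_le
      (isCoboundedUnder_le_of_le (cocompact ℝ) (x := 0) fun x => sqrt_nonneg _) ?_
    filter_upwards [hten.eventually (gt_mem_nhds hδ)] with x hx
    refine (hbound x).trans ?_
    have h4 := mul_le_mul_of_nonneg_left hx.le (by linarith : 0 ≤ 6 * L)
    have h5 : 0 < (L + 4 / α) * exp (-c / ε) := by positivity
    linarith
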